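/- arXiv:1003.5336 — 2 statements merged into one kernel-verified Lean document; each statement's English description precedes it below -/
import Mathlib

section
/- Fix a totally real number field K₀ of class number one, and let 0 < σ < 1. Let φ be an even Schwartz function on ℝ whose Fourier transform φ̂ is supported in (−σ, σ). Then over the family of all CM-fields K whose maximal totally real subfield is K₀, the quantity (4/(h_K · log Δ_K)) · ∫₀^∞ φ̂(x/log Δ_K)·cosh(x/2) dx tends to 0 as Δ_K → ∞; precisely, for every ε > 0, all but finitely many CM-fields K with maximal totally real subfield K₀ satisfy |(4/(h_K · log Δ_K)) · ∫₀^∞ φ̂(x/log Δ_K)·cosh(x/2) dx| < ε. -/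
open NumberField MeasureTheory FourierTransform
open scoped Classical

/-- The class number of an intermediate field of `ℂ/ℚ` (junk value `0` if it is not finite
dimensional over `ℚ`, i.e. not a number field). -/
noncomputable def clsNum (K : IntermediateField ℚ ℂ) : ℕ :=
  if h : FiniteDimensional ℚ K then
    letI := h
    letI : NumberField K := ⟨⟩
    NumberField.classNumber K
  else 0

/-- The absolute value of the discriminant of an intermediate field of `ℂ/ℚ` (junk value `0`
if it is not finite dimensional over `ℚ`). -/
noncomputable def absDisc (K : IntermediateField ℚ ℂ) : ℕ :=
  if h : FiniteDimensional ℚ K then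
    letI := h
    letI : NumberField K := ⟨⟩
    (NumberField.discr K).natAbs
  else 0

/-- `K` is a CM-field with maximal totally real subfield `K₀`: it is a number field which is
totally imaginary (it has no real embedding) and is a quadratic extension of the totally real
field `K₀`. -/
def IsCMover (K₀ K : IntermediateField ℚ ℂ) : Prop :=
  FiniteDimensional ℚ K ∧ K₀ ≤ K ∧
    Module.finrank ℚ K = 2 * Module.finrank ℚ K₀ ∧
    IsEmpty (K →+* ℝ)

section Auxiliary

open scoped ENNReal NNReal IntermediateField

section LatticeCount

variable {E : Type*} [AddCommGroup E] [MeasurableSpace E] [MeasurableAdd E] {μ : Measure E}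
  [μ.IsAddLeftInvariant]

/-- The number of points of `L` in the set `T`. -/
noncomputable def latticeCount (L : AddSubgroup E) (T : Set E) : ℝ≥0∞ :=
  ∑' g : L, T.indicator 1 (g : E)

theorem measure_eq_lintegral_tsum_indicator {L : AddSubgroup E} [Countable L] {F S : Set E}
    (hF : IsAddFundamentalDomain L F μ) (hS : MeasurableSet S) :
    μ S = ∫⁻ y in F, ∑' g : L, S.indicator 1 ((g : E) + y) ∂μ := by
  rw [lintegral_tsum]
  · rw [← lintegral_indicator_one hS, hF.lintegral_eq_tsum'']
    rfl
  · intro g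
    exact ((measurable_one.indicator hS).comp (measurable_const_add (g : E))).aemeasurable

theorem measure_le_mul_latticeCount {L : AddSubgroup E} [Countable L] {F S T : Set E}
    (hF : IsAddFundamentalDomain L F μ) (hS : MeasurableSet S)
    (h : ∀ y : E, ∃ l : L, ∀ z : E, z + (y - l) ∈ S → z ∈ T) :
    μ S ≤ latticeCount L T * μ F := by
  rw [measure_eq_lintegral_tsum_indicator hF hS, ← setLIntegral_const]
  refine lintegral_mono fun y ↦ ?_
  obtain ⟨l, hl⟩ := h y
  rw [← (Equiv.addRight (-l)).tsum_eq]
  refine ENNReal.tsum_le_tsum fun g ↦ ?_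
  by_cases hg : (g : E) + (y - l) ∈ S
  · rw [Set.indicator_of_mem (hl _ hg)]
    exact Set.indicator_le_self' (by simp) _
  · rw [Set.indicator_of_notMem]
    · exact zero_le
    · convert hg using 1
      simp
      abel_nf

theorem latticeCount_mul_le_measure {L : AddSubgroup E} [Countable L] {F S T : Set E}
    (hF : IsAddFundamentalDomain L F μ) (hS : MeasurableSet S)
    (h : ∀ y : E, ∃ l : L, ∀ z ∈ T, z + (y - l) ∈ S) :
    latticeCount L T * μ F ≤ μ S := by
  rw [measure_eq_lintegral_tsum_indicator hF hS, ← setLIntegral_const]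
  refine lintegral_mono fun y ↦ ?_
  obtain ⟨l, hl⟩ := h y
  rw [← (Equiv.addRight (-l)).tsum_eq]
  refine ENNReal.tsum_le_tsum fun g ↦ ?_
  by_cases hg : (g : E) ∈ T
  · rw [Set.indicator_of_mem hg, Set.indicator_of_mem]
    · exact le_rfl
    · convert hl _ hg using 1
      simp
      abel
  · rw [Set.indicator_of_notMem hg]
    exact zero_le

end LatticeCount

section CoveringRadius

open NumberField.mixedEmbedding NumberField.InfinitePlace

variable (K : Type*) [Field K] [NumberField K]

theorem one_le_natAbs_discr : 1 ≤ (discr K).natAbs :=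
  Int.natAbs_pos.mpr (discr_ne_zero K)

theorem minkowskiBound_le (I : (FractionalIdeal (nonZeroDivisors (𝓞 K)) K)ˣ) :
    minkowskiBound K I ≤ ENNReal.ofReal (FractionalIdeal.absNorm (I : FractionalIdeal
        (nonZeroDivisors (𝓞 K)) K)) *
      ((discr K).natAbs * 2 ^ Module.finrank ℚ K : ℕ) := by
  rw [minkowskiBound, volume_fundamentalDomain_fractionalIdealLatticeBasis,
    volume_fundamentalDomain_latticeBasis, mixedEmbedding.finrank, mul_assoc]
  gcongr
  push_cast
  gcongr
  rw [← one_mul ((discr K).natAbs : ℝ≥0∞)]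
  gcongr
  · exact pow_le_one₀ (by simp) (by simp)
  · rw [← ENNReal.coe_natCast, ENNReal.coe_le_coe, NNReal.sqrt_le_iff_le_sq]
    have h : ‖discr K‖₊ = ((discr K).natAbs : ℝ≥0) := by
      rw [← NNReal.coe_inj]; simp [Int.norm_eq_abs, Nat.cast_natAbs]
    rw [h]
    exact_mod_cast Nat.le_self_pow two_ne_zero _

theorem minkowskiBound_one_le :
    minkowskiBound K 1 ≤ ((discr K).natAbs * 2 ^ Module.finrank ℚ K : ℕ) := by
  simpa using minkowskiBound_le K 1

theorem exists_small_primitive_element :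
    ∃ a : 𝓞 K, ℚ⟮(a : K)⟯ = ⊤ ∧
      ∀ w : InfinitePlace K, w a ≤ (discr K).natAbs * 2 ^ (Module.finrank ℚ K + 2) := by
  have h1 := one_le_natAbs_discr K
  set B : ℕ := (discr K).natAbs * 2 ^ Module.finrank ℚ K + 1 with hB
  have hlt : minkowskiBound K 1 < (B : ℝ≥0∞) := by
    refine (minkowskiBound_one_le K).trans_lt ?_
    exact_mod_cast Nat.lt_succ_self _
  have hB2 : (B : ℝ) + 1 ≤ (discr K).natAbs * 2 ^ (Module.finrank ℚ K + 2) := by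
    have : 1 ≤ (discr K).natAbs * 2 ^ Module.finrank ℚ K := Nat.mul_pos h1 (by positivity)
    rw [pow_add, ← mul_assoc]
    norm_cast
    rw [hB]
    omega
  obtain ⟨w₀⟩ := (inferInstance : Nonempty (InfinitePlace K))
  rcases w₀.isReal_or_isComplex with hw | hw
  · obtain ⟨a, ha, h⟩ := exists_primitive_element_lt_of_isReal K hw (B := B) (by
      refine hlt.trans_le ?_
      conv_lhs => rw [← one_mul (B : ℝ≥0∞)]
      gcongr
      · exact_mod_cast one_le_convexBodyLTFactor K
      · simp)
    refine ⟨a, ha, fun w ↦ (h w).le.trans (le_trans ?_ hB2)⟩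
    simp
  · obtain ⟨a, ha, h⟩ := exists_primitive_element_lt_of_isComplex K hw (B := B) (by
      refine hlt.trans_le ?_
      conv_lhs => rw [← one_mul (B : ℝ≥0∞)]
      gcongr
      · exact_mod_cast one_le_convexBodyLT'Factor K
      · simp)
    refine ⟨a, ha, fun w ↦ (h w).le.trans (le_trans ?_ hB2)⟩
    rw [Real.sqrt_le_left (by positivity)]
    simp
    nlinarith [Nat.cast_nonneg (α := ℝ) B]

variable {K} in
theorem mem_span_mixedEmbedding_pow {a : 𝓞 K} (ha : ℚ⟮(a : K)⟯ = ⊤) (z : mixedSpace K) :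
    ∃ c : Fin (Module.finrank ℚ K) → ℝ, z = ∑ i, c i • mixedEmbedding K ((a : K) ^ (i : ℕ)) := by
  have hint : IsIntegral ℚ (a : K) := Algebra.IsIntegral.isIntegral _
  have hadj : Algebra.adjoin ℚ {(a : K)} = ⊤ := by
    rw [← IntermediateField.adjoin_simple_toSubalgebra_of_isAlgebraic hint.isAlgebraic, ha]
    rfl
  let P := PowerBasis.ofAdjoinEqTop hint hadj
  have hdim : P.dim = Module.finrank ℚ K := P.finrank.symm
  have hgen : P.gen = a := PowerBasis.ofAdjoinEqTop_gen hint hadj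
  let V : Submodule ℝ (mixedSpace K) :=
    Submodule.span ℝ (Set.range fun i : Fin (Module.finrank ℚ K) ↦
      mixedEmbedding K ((a : K) ^ (i : ℕ)))
  have hK : ∀ x : K, mixedEmbedding K x ∈ V := by
    intro x
    rw [← P.basis.sum_repr x, map_sum]
    refine Submodule.sum_mem _ fun i _ ↦ ?_
    have : mixedEmbedding K (P.basis.repr x i • P.basis i) =
        ((P.basis.repr x i : ℚ) : ℝ) • mixedEmbedding K ((a : K) ^ (i : ℕ)) := by
      rw [P.basis_eq_pow, hgen, Algebra.smul_def, map_mul]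
      ext <;> simp [mixedEmbedding]
    rw [this]
    exact V.smul_mem _ (Submodule.subset_span ⟨Fin.cast hdim i, rfl⟩)
  have hV : V = ⊤ := by
    rw [eq_top_iff, ← (latticeBasis K).span_eq, Submodule.span_le]
    rintro _ ⟨i, rfl⟩
    rw [latticeBasis_apply]
    exact hK _
  have hz : z ∈ V := hV ▸ Submodule.mem_top
  obtain ⟨c, hc⟩ := (Submodule.mem_span_range_iff_exists_fun ℝ).mp hz
  exact ⟨c, hc.symm⟩

/-- A bound for the covering radius of the ring of integers, polynomial in the discriminant. -/
noncomputable def covBound : ℕ :=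
  (discr K).natAbs * 2 ^ (Module.finrank ℚ K + 1) * (Module.finrank ℚ K *
    ((discr K).natAbs * 2 ^ (Module.finrank ℚ K + 2)) ^ Module.finrank ℚ K)

theorem exists_mem_ideal_normAtPlace_sub_le (J : Ideal (𝓞 K)) (hJ : J ≠ 0)
    (f : InfinitePlace K → ℝ) (hf : ∀ w, 0 < f w) (hf1 : ∏ w, f w ^ w.mult = 1)
    (y : mixedSpace K) :
    ∃ a ∈ J, ∀ w, normAtPlace w (y - mixedEmbedding K (a : K)) ≤
      (Ideal.absNorm J : ℝ) ^ (1 / (Module.finrank ℚ K : ℝ)) * covBound K * f w := by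
  set N := Module.finrank ℚ K with hN
  have hN0 : N ≠ 0 := Module.finrank_pos.ne'
  have h1 := one_le_natAbs_discr K
  have hJ' : J ∈ nonZeroDivisors (Ideal (𝓞 K)) := mem_nonZeroDivisors_of_ne_zero hJ
  set Y : ℝ := (Ideal.absNorm J : ℝ) ^ (1 / (N : ℝ)) * ((discr K).natAbs * 2 ^ (N + 1) : ℕ) with hY
  have hNJ : 0 < Ideal.absNorm J := Ideal.absNorm_pos_iff_mem_nonZeroDivisors.mpr hJ'
  have hY0 : 0 < Y := by
    have : 0 < (discr K).natAbs * 2 ^ (N + 1) := by positivity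
    positivity
  obtain ⟨α, hαJ, hα0, hα⟩ : ∃ α ∈ J, α ≠ 0 ∧ ∀ w : InfinitePlace K, w α ≤ Y * f w := by
    let I := FractionalIdeal.mk0 K ⟨J, hJ'⟩
    obtain ⟨x, hxI, hx0, hx⟩ := exists_ne_zero_mem_ideal_lt K
      (f := fun w ↦ (Y * f w).toNNReal) I (by
        refine (minkowskiBound_le K I).trans_lt ?_
        rw [convexBodyLT_volume]
        have : (∏ w : InfinitePlace K, (Y * f w).toNNReal ^ w.mult) = Y.toNNReal ^ N := by
          rw [← NNReal.coe_inj]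
          push_cast
          simp_rw [Real.coe_toNNReal _ hY0.le, fun w ↦ Real.coe_toNNReal _ (mul_pos hY0 (hf w)).le,
            mul_pow, Finset.prod_mul_distrib, hf1, mul_one, Finset.prod_pow_eq_pow_sum,
            sum_mult_eq, hN]
        rw [this]
        have hI : (FractionalIdeal.absNorm (I : FractionalIdeal (nonZeroDivisors (𝓞 K)) K) : ℝ) =
            Ideal.absNorm J := by
          simp [I, FractionalIdeal.coeIdeal_absNorm]
        rw [hI]
        calc _ < ((((Ideal.absNorm J : ℝ≥0) * ((discr K).natAbs * 2 ^ (N + 1) : ℕ) : ℝ≥0)) : ℝ≥0∞)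
            := by
              rw [ENNReal.ofReal_natCast, ← ENNReal.coe_natCast, ← ENNReal.coe_natCast,
                ← ENNReal.coe_mul, ENNReal.coe_lt_coe]
              norm_cast
              refine Nat.mul_lt_mul_of_pos_left ?_ hNJ
              refine Nat.mul_lt_mul_of_pos_left ?_ h1
              exact Nat.pow_lt_pow_right (by norm_num) (by omega)
          _ ≤ (Y.toNNReal ^ N : ℝ≥0) := by
              rw [ENNReal.coe_le_coe, ← NNReal.coe_le_coe]
              push_cast
              rw [Real.coe_toNNReal _ hY0.le]
              conv_rhs => rw [hY]
              rw [mul_pow, ← Real.rpow_natCast (_ ^ (1 / (N : ℝ))), ← Real.rpow_mul (by positivity),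
                one_div_mul_cancel (by exact_mod_cast hN0), Real.rpow_one]
              gcongr
              exact_mod_cast Nat.le_self_pow hN0 _
          _ ≤ _ := by
              conv_lhs => rw [← one_mul ((Y.toNNReal ^ N : ℝ≥0) : ℝ≥0∞)]
              gcongr
              exact_mod_cast one_le_convexBodyLTFactor K)
    simp only [I, FractionalIdeal.coe_mk0, FractionalIdeal.mem_coeIdeal] at hxI
    obtain ⟨α, hαJ, rfl⟩ := hxI
    exact ⟨α, hαJ, by rintro rfl; simp at hx0, fun w ↦
      ((hx w).le.trans_eq (Real.coe_toNNReal _ (mul_pos hY0 (hf w)).le))⟩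
  obtain ⟨θ, hθ, hθB⟩ := exists_small_primitive_element K
  obtain ⟨c, hc⟩ := mem_span_mixedEmbedding_pow hθ (mixedEmbedding K ((α : K)⁻¹) * y)
  have hα0' : (α : K) ≠ 0 := by simpa using hα0
  refine ⟨α * ∑ i, (⌊c i⌋ : 𝓞 K) * θ ^ (i : ℕ), J.mul_mem_right _ hαJ, fun w ↦ ?_⟩
  have key : y - mixedEmbedding K ((α * ∑ i, (⌊c i⌋ : 𝓞 K) * θ ^ (i : ℕ) : 𝓞 K) : K) =
      mixedEmbedding K (α : K) * ∑ i, Int.fract (c i) • mixedEmbedding K ((θ : K) ^ (i : ℕ)) := by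
    have hy : y = mixedEmbedding K (α : K) * (mixedEmbedding K ((α : K)⁻¹) * y) := by
      rw [← mul_assoc, ← map_mul, mul_inv_cancel₀ hα0', map_one, one_mul]
    conv_lhs => rw [hy, hc]
    push_cast
    rw [map_mul, map_sum, ← mul_sub, ← Finset.sum_sub_distrib]
    congr 1
    refine Finset.sum_congr rfl fun i _ ↦ ?_
    rw [Int.fract, sub_smul, map_mul]
    congr 1
    ext <;> simp
  rw [key, map_mul, normAtPlace_apply]
  have hsum : ∀ (s : Finset (Fin N)) (g : Fin N → mixedSpace K),
      normAtPlace w (∑ i ∈ s, g i) ≤ ∑ i ∈ s, normAtPlace w (g i) := by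
    intro s g
    refine Finset.le_sum_of_subadditive _ (by simp) (normAtPlace_add_le w) _ _
  set B : ℝ := (discr K).natAbs * 2 ^ (N + 2) with hB
  have hB1 : 1 ≤ B := by
    have : 1 ≤ (discr K).natAbs * 2 ^ (N + 2) := Nat.mul_pos h1 (by positivity)
    rw [hB]
    exact_mod_cast this
  calc w α * normAtPlace w (∑ i, Int.fract (c i) • mixedEmbedding K ((θ : K) ^ (i : ℕ)))
      ≤ (Y * f w) * (N * B ^ N) := by
        gcongr
        · exact normAtPlace_nonneg _ _
        · have := hf w; positivity
        · exact hα w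
        · refine (hsum _ _).trans ((Finset.sum_le_card_nsmul _ _ (B ^ N) fun i _ ↦ ?_).trans_eq
            (by simp))
          rw [normAtPlace_smul, normAtPlace_apply, map_pow, abs_of_nonneg (Int.fract_nonneg _)]
          calc _ ≤ 1 * B ^ (i : ℕ) := by
                gcongr
                · exact (Int.fract_lt_one _).le
                · exact hθB w
            _ ≤ B ^ N := by
                rw [one_mul]
                exact pow_le_pow_right₀ hB1 i.2.le
    _ = _ := by
      rw [hY, covBound]
      push_cast
      rw [← hN, hB]
      ring

end CoveringRadius

section IdealPoints

open NumberField.mixedEmbedding NumberField.InfinitePlace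

variable (K : Type*) [Field K] [NumberField K]

/-- The number of nonzero points of the ideal `J` whose absolute values satisfy `w a < b w`. -/
noncomputable def boxCount {K : Type*} [Field K] [NumberField K] (J : Ideal (𝓞 K))
    (b : InfinitePlace K → ℝ) : ℝ≥0∞ :=
  ∑' a : 𝓞 K, if a ∈ J ∧ a ≠ 0 ∧ ∀ w : InfinitePlace K, w (a : K) < b w then 1 else 0

variable {K}

theorem mem_convexBodyLT_iff {b : InfinitePlace K → ℝ} (hb : ∀ w, 0 < b w) (x : mixedSpace K) :
    x ∈ convexBodyLT K (fun w ↦ (b w).toNNReal) ↔ ∀ w, normAtPlace w x < b w := by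
  simp only [convexBodyLT, Set.mem_prod, Set.mem_univ_pi, mem_ball_zero_iff,
    Real.coe_toNNReal _ (hb _).le]
  constructor
  · rintro ⟨h1, h2⟩ w
    rcases w.isReal_or_isComplex with hw | hw
    · rw [normAtPlace_apply_of_isReal hw]; exact h1 ⟨w, hw⟩
    · rw [normAtPlace_apply_of_isComplex hw]; exact h2 ⟨w, hw⟩
  · intro h
    exact ⟨fun w ↦ by simpa [normAtPlace_apply_of_isReal w.2] using h w.1,
      fun w ↦ by simpa [normAtPlace_apply_of_isComplex w.2] using h w.1⟩

theorem measurableSet_convexBodyLT (f : InfinitePlace K → ℝ≥0) :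
    MeasurableSet (convexBodyLT K f) :=
  ((isOpen_set_pi Set.finite_univ fun _ _ ↦ Metric.isOpen_ball).prod
    (isOpen_set_pi Set.finite_univ fun _ _ ↦ Metric.isOpen_ball)).measurableSet

theorem volume_convexBodyLT_mul {f : InfinitePlace K → ℝ} (hf : ∀ w, 0 < f w)
    (hf1 : ∏ w, f w ^ w.mult = 1) {X : ℝ} (hX : 0 < X) :
    volume (convexBodyLT K (fun w ↦ (X * f w).toNNReal)) =
      ENNReal.ofReal (convexBodyLTFactor K * X ^ Module.finrank ℚ K) := by
  rw [convexBodyLT_volume, ENNReal.ofReal, ← ENNReal.coe_mul, ENNReal.coe_inj, ← NNReal.coe_inj,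
    Real.coe_toNNReal _ (by positivity)]
  push_cast
  simp_rw [fun w ↦ Real.coe_toNNReal _ (mul_pos hX (hf w)).le, mul_pow, Finset.prod_mul_distrib,
    hf1, mul_one, Finset.prod_pow_eq_pow_sum, sum_mult_eq]

theorem latticeCount_idealLattice (J : Ideal (𝓞 K)) (hJ : J ∈ nonZeroDivisors (Ideal (𝓞 K)))
    {b : InfinitePlace K → ℝ} (hb : ∀ w, 0 < b w) :
    latticeCount (idealLattice K (FractionalIdeal.mk0 K ⟨J, hJ⟩)).toAddSubgroup
      (convexBodyLT K (fun w ↦ (b w).toNNReal)) = 1 + boxCount J b := by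
  set L := (idealLattice K (FractionalIdeal.mk0 K ⟨J, hJ⟩)).toAddSubgroup
  have hmem : ∀ x : mixedSpace K, x ∈ L ↔ ∃ a ∈ J, mixedEmbedding K (a : K) = x := by
    intro x
    rw [Submodule.mem_toAddSubgroup, mem_idealLattice]
    simp
  let e : J ≃ L := Equiv.ofBijective (fun a ↦ ⟨mixedEmbedding K (a : 𝓞 K), (hmem _).2 ⟨a, a.2,
      rfl⟩⟩) (by
    constructor
    · intro a a' h
      have := (mixedEmbedding_injective K) (Subtype.ext_iff.mp h)
      exact Subtype.ext (RingOfIntegers.ext this)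
    · rintro ⟨x, hx⟩
      obtain ⟨a, ha, rfl⟩ := (hmem x).1 hx
      exact ⟨⟨a, ha⟩, rfl⟩)
  rw [latticeCount, ← e.tsum_eq]
  have h1 : ∀ a : J, (convexBodyLT K (fun w ↦ (b w).toNNReal)).indicator (1 : mixedSpace K → ℝ≥0∞)
      (e a) =
      (fun a : 𝓞 K ↦ if ∀ w : InfinitePlace K, w (a : K) < b w then (1 : ℝ≥0∞) else 0) a := by
    intro a
    rw [Set.indicator_apply]
    refine if_congr ?_ rfl rfl
    rw [mem_convexBodyLT_iff hb]
    exact forall_congr' fun w ↦ by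
      rw [show ((e a : L) : mixedSpace K) = mixedEmbedding K ((a : 𝓞 K) : K) from rfl,
        normAtPlace_apply]
  rw [tsum_congr h1]
  refine (tsum_subtype (J : Set (𝓞 K)) (fun a : 𝓞 K ↦
    if ∀ w : InfinitePlace K, w (a : K) < b w then (1 : ℝ≥0∞) else 0)).trans ?_
  rw [ENNReal.tsum_eq_add_tsum_ite 0, boxCount]
  congr 1
  · simp [hb]
  · refine tsum_congr fun a ↦ ?_
    simp only [Set.indicator_apply, SetLike.mem_coe]
    by_cases ha : a ∈ J <;> by_cases h0 : a = 0 <;> simp [ha, h0]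

theorem one_add_pow_le_of_le_one {u : ℝ} (h0 : 0 ≤ u) (h1 : u ≤ 1) (n : ℕ) :
    (1 + u) ^ n ≤ 1 + 2 ^ n * u := by
  suffices h : (1 + u) ^ n ≤ 1 + (2 ^ n - 1) * u by linarith
  induction n with
  | zero => simp
  | succ n ih =>
    have : (1:ℝ) ≤ 2 ^ n := one_le_pow₀ (by norm_num)
    rw [pow_succ, pow_succ]
    nlinarith [mul_le_mul_of_nonneg_right ih (by linarith : 0 ≤ 1 + u),
      mul_nonneg (mul_nonneg (sub_nonneg.2 this) h0) (by linarith : 0 ≤ 1 - u)]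

theorem covBound_pos (K : Type*) [Field K] [NumberField K] : 0 < covBound K := by
  have := one_le_natAbs_discr K
  have : 0 < Module.finrank ℚ K := Module.finrank_pos
  unfold covBound
  positivity

set_option maxHeartbeats 1000000 in
variable (K) in
theorem exists_boxCount_bounds : ∃ A : ℝ, 0 < A ∧ ∀ J : Ideal (𝓞 K), J ≠ 0 →
    ∀ f : InfinitePlace K → ℝ, (∀ w, 0 < f w) → ∏ w, f w ^ w.mult = 1 →
    ∀ x : ℝ, (covBound K : ℝ) ^ Module.finrank ℚ K ≤ x →
      ENNReal.ofReal (A * x * (1 - 2 ^ (2 * Module.finrank ℚ K) *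
        (covBound K / x ^ (1 / (Module.finrank ℚ K : ℝ))))) ≤
        boxCount J (fun w ↦ (Ideal.absNorm J * x) ^ (1 / (Module.finrank ℚ K : ℝ)) * f w) ∧
      boxCount J (fun w ↦ (Ideal.absNorm J * x) ^ (1 / (Module.finrank ℚ K : ℝ)) * f w) ≤
        ENNReal.ofReal (A * x * (1 + 2 ^ (2 * Module.finrank ℚ K) *
        (covBound K / x ^ (1 / (Module.finrank ℚ K : ℝ))))) := by
  set N := Module.finrank ℚ K with hN
  have hN0 : N ≠ 0 := Module.finrank_pos.ne'
  have hD := covBound_pos K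
  set D : ℝ := ((covBound K : ℕ) : ℝ) with hDdef
  have hD0 : 0 < D := Nat.cast_pos.2 hD
  set c : ℝ := ((convexBodyLTFactor K : ℝ≥0) : ℝ)
  have hc : 0 < c := NNReal.coe_pos.2 (pos_iff_ne_zero.2 (convexBodyLTFactor_ne_zero K))
  set V₁ : ℝ := 2⁻¹ ^ InfinitePlace.nrComplexPlaces K * √|↑(discr K)|
  have hV₁ : 0 < V₁ := by
    have : (0:ℝ) < |(discr K : ℝ)| := abs_pos.2 (by exact_mod_cast discr_ne_zero K)
    positivity
  refine ⟨c / V₁, by positivity, fun J hJ f hf hf1 x hx ↦ ?_⟩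
  have hJ' : J ∈ nonZeroDivisors (Ideal (𝓞 K)) := mem_nonZeroDivisors_of_ne_zero hJ
  have hx0 : 0 < x := lt_of_lt_of_le (by positivity) hx
  set n : ℝ := ((Ideal.absNorm J : ℕ) : ℝ) with hn
  have hn0 : 0 < n := by
    rw [hn]; exact_mod_cast Ideal.absNorm_pos_iff_mem_nonZeroDivisors.mpr hJ'
  set d : ℝ := n ^ (1 / (N : ℝ)) * D with hd
  have hd0 : 0 < d := by positivity
  set X : ℝ := (n * x) ^ (1 / (N : ℝ)) with hX
  have hX0 : 0 < X := by positivity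
  have hroot : ∀ y : ℝ, 0 ≤ y → (y ^ (1 / (N : ℝ))) ^ N = y := fun y hy ↦ by
    rw [← Real.rpow_natCast, ← Real.rpow_mul hy, one_div_mul_cancel (by exact_mod_cast hN0),
      Real.rpow_one]
  have hXN : X ^ N = n * x := hroot _ (by positivity)
  have hdN : d ^ N = n * D ^ N := by rw [hd, mul_pow, hroot _ hn0.le]
  set u : ℝ := D / x ^ (1 / (N : ℝ)) with hu
  have hu0 : 0 < u := by positivity
  have hdu : d = X * u := by
    rw [hd, hX, hu, Real.mul_rpow hn0.le hx0.le]
    field_simp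
  have hu1 : u ≤ 1 := by
    rw [hu, div_le_one (by positivity)]
    refine le_of_pow_le_pow_left₀ hN0 (by positivity) ?_
    rw [hroot _ hx0.le]; exact hx
  set I := FractionalIdeal.mk0 K ⟨J, hJ'⟩ with hI
  set F := ZSpan.fundamentalDomain (fractionalIdealLatticeBasis K I)
  have hF : IsAddFundamentalDomain (idealLattice K I).toAddSubgroup F volume :=
    fundamentalDomain_idealLattice K I
  have hVF : volume F = ENNReal.ofReal (n * V₁) := by
    have h1 := covolume_idealLattice K I
    rw [ZLattice.covolume_eq_measure_fundamentalDomain _ _ (fundamentalDomain_idealLattice K I)]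
        at h1
    have h2 : (FractionalIdeal.absNorm (I : FractionalIdeal (nonZeroDivisors (𝓞 K)) K) : ℝ) = n :=
        by
      simp [hI, FractionalIdeal.coeIdeal_absNorm, hn]
    rw [h2, mul_assoc] at h1
    rw [← h1, measureReal_def, ENNReal.ofReal_toReal]
    exact (ZSpan.fundamentalDomain_isBounded _).measure_lt_top.ne
  have : Countable (idealLattice K I).toAddSubgroup := by
    change Countable (idealLattice K I)
    infer_instance
  have hshift : ∀ (y : mixedSpace K), ∃ l : (idealLattice K I).toAddSubgroup,
      ∀ w, normAtPlace w (y - (l : mixedSpace K)) ≤ d * f w := by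
    intro y
    obtain ⟨a, haJ, ha⟩ := exists_mem_ideal_normAtPlace_sub_le K J hJ f hf hf1 y
    refine ⟨⟨mixedEmbedding K (a : K), ?_⟩, ha⟩
    rw [Submodule.mem_toAddSubgroup, mem_idealLattice]
    exact ⟨a, by simpa [hI] using haJ, rfl⟩
  have upper : ∀ Y : ℝ, 0 < Y → (1 + boxCount J (fun w ↦ Y * f w)) * ENNReal.ofReal (n * V₁) ≤
      ENNReal.ofReal (c * (Y + d) ^ N) := by
    intro Y hY
    rw [← latticeCount_idealLattice J hJ' (fun w ↦ mul_pos hY (hf w)), ← hVF,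
      ← volume_convexBodyLT_mul hf hf1 (by positivity)]
    refine latticeCount_mul_le_measure hF (measurableSet_convexBodyLT _) fun y ↦ ?_
    obtain ⟨l, hl⟩ := hshift y
    refine ⟨l, fun z hz ↦ ?_⟩
    rw [mem_convexBodyLT_iff (fun w ↦ mul_pos hY (hf w))] at hz
    rw [mem_convexBodyLT_iff (fun w ↦ mul_pos (by positivity) (hf w))]
    intro w
    calc _ ≤ _ := normAtPlace_add_le _ _ _
      _ < Y * f w + d * f w := add_lt_add_of_lt_of_le (hz w) (hl w)
      _ = (Y + d) * f w := by ring
  have lower : d < X → ENNReal.ofReal (c * (X - d) ^ N) ≤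
      (1 + boxCount J (fun w ↦ X * f w)) * ENNReal.ofReal (n * V₁) := by
    intro hlt
    rw [← latticeCount_idealLattice J hJ' (fun w ↦ mul_pos hX0 (hf w)), ← hVF,
      ← volume_convexBodyLT_mul hf hf1 (by linarith)]
    refine measure_le_mul_latticeCount hF (measurableSet_convexBodyLT _) fun y ↦ ?_
    obtain ⟨l, hl⟩ := hshift y
    refine ⟨l, fun z hz ↦ ?_⟩
    rw [mem_convexBodyLT_iff (fun w ↦ mul_pos (by linarith) (hf w))] at hz
    rw [mem_convexBodyLT_iff (fun w ↦ mul_pos hX0 (hf w))]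
    intro w
    have hz' : normAtPlace w z ≤ normAtPlace w (z + (y - l)) + normAtPlace w (y - l) := by
      have := normAtPlace_add_le w (z + (y - l)) (-(y - l))
      rwa [normAtPlace_neg, add_neg_cancel_right] at this
    have := hz w
    have := hl w
    nlinarith
  have hV₁d : V₁ ≤ c * x * (2 ^ N * u) := by
    have h := (le_mul_of_one_le_left zero_le (le_add_of_nonneg_right zero_le)).trans (upper d hd0)
    rw [ENNReal.ofReal_le_ofReal_iff (by positivity), ← two_mul, mul_pow, hdu, mul_pow, hXN] at h
    have hu' : u ^ N ≤ u := pow_le_of_le_one hu0.le hu1 hN0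
    refine le_of_mul_le_mul_left (h.trans ?_) hn0
    calc c * (2 ^ N * (n * x * u ^ N)) ≤ c * (2 ^ N * (n * x * u)) := by gcongr
      _ = _ := by ring
  have h4 : (2:ℝ) ^ (2 * N) = 2 ^ N * 2 ^ N := by rw [two_mul, pow_add]
  have h2N : (2:ℝ) ≤ 2 ^ N := by
    calc (2:ℝ) = 2 ^ 1 := by norm_num
      _ ≤ 2 ^ N := pow_le_pow_right₀ (by norm_num) (by omega)
  have hup := upper X hX0
  have hfin : boxCount J (fun w ↦ X * f w) ≠ ⊤ := by
    intro h
    rw [h, add_top, ENNReal.top_mul (by simpa using mul_pos hn0 hV₁), top_le_iff] at hup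
    exact ENNReal.ofReal_ne_top hup
  set b := boxCount J (fun w ↦ X * f w) with hb
  have h1b : (1 + b) * ENNReal.ofReal (n * V₁) = ENNReal.ofReal ((1 + b.toReal) * (n * V₁)) := by
    rw [ENNReal.ofReal_mul (p := 1 + b.toReal) (by positivity),
      ENNReal.ofReal_add (by positivity) (by positivity),
      ENNReal.ofReal_one, ENNReal.ofReal_toReal hfin]
  constructor
  · by_cases hu4 : 2 ^ (2 * N) * u < 1
    · have hult : u < 1 := by nlinarith
      have hlow := lower (by rw [hdu]; nlinarith)
      rw [h1b, ENNReal.ofReal_le_ofReal_iff (by positivity), hdu,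
        show X - X * u = X * (1 - u) by ring, mul_pow, hXN] at hlow
      rw [← ENNReal.ofReal_toReal hfin]
      refine ENNReal.ofReal_le_ofReal ?_
      have hbern : 1 + (N : ℝ) * (-u) ≤ (1 + (-u)) ^ N := one_add_mul_le_pow (by linarith) N
      have hN2 : (N : ℝ) ≤ 2 ^ N := by exact_mod_cast Nat.lt_two_pow_self.le
      have h3 : c * x * (1 - 2 ^ N * u) ≤ (1 + b.toReal) * V₁ := by
        refine le_of_mul_le_mul_left (le_trans ?_ (hlow.trans_eq (by ring))) hn0
        calc n * (c * x * (1 - 2 ^ N * u)) = c * (n * x * (1 - 2 ^ N * u)) := by ring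
          _ ≤ c * (n * x * (1 - u) ^ N) := by
            gcongr
            rw [sub_eq_add_neg 1 u]
            nlinarith
      rw [div_mul_eq_mul_div, div_mul_eq_mul_div, div_le_iff₀ hV₁]
      have h5 : c * x * (1 - 2 ^ (2 * N) * u) ≤ c * x * (1 - 2 ^ N * u - 2 ^ N * u) := by
        refine mul_le_mul_of_nonneg_left ?_ (by positivity)
        rw [h4]
        nlinarith [mul_nonneg hu0.le (by linarith : (0:ℝ) ≤ 2 ^ N - 2)]
      linarith
    · rw [ENNReal.ofReal_of_nonpos]
      · exact zero_le
      · exact mul_nonpos_of_nonneg_of_nonpos (by positivity) (by linarith)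
  · rw [h1b, ENNReal.ofReal_le_ofReal_iff (by positivity), hdu,
      show X + X * u = X * (1 + u) by ring, mul_pow, hXN] at hup
    rw [← ENNReal.ofReal_toReal hfin]
    refine ENNReal.ofReal_le_ofReal ?_
    have h3 : (1 + b.toReal) * V₁ ≤ c * x * (1 + 2 ^ N * u) := by
      refine le_of_mul_le_mul_left (le_trans ((by ring : _ = _).trans_le hup) ?_) hn0
      calc c * (n * x * (1 + u) ^ N) ≤ c * (n * x * (1 + 2 ^ N * u)) := by
            gcongr
            exact one_add_pow_le_of_le_one hu0.le hu1 N
        _ = _ := by ring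
    rw [div_mul_eq_mul_div, div_mul_eq_mul_div, le_div_iff₀ hV₁]
    have h5 : c * x * (1 + 2 ^ N * u) ≤ c * x * (1 + 2 ^ (2 * N) * u) := by
      refine mul_le_mul_of_nonneg_left ?_ (by positivity)
      rw [h4]
      nlinarith [mul_nonneg hu0.le (by linarith : (0:ℝ) ≤ 2 ^ N - 2)]
    linarith

end IdealPoints

section LogScale

open scoped Pointwise

open NumberField.InfinitePlace NumberField.Units NumberField.Units.dirichletUnitTheorem

variable {K : Type*} [Field K] [NumberField K]

theorem mult_cast_pos (w : InfinitePlace K) : (0 : ℝ) < w.mult :=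
  Nat.cast_pos.2 mult_pos

/-- The coordinates, at all the infinite places, of a point of the logarithmic space. -/
noncomputable def logCoord (t : logSpace K) (w : InfinitePlace K) : ℝ :=
  if h : w ≠ w₀ then t ⟨w, h⟩ / w.mult else -(∑ v, t v) / w.mult

theorem sum_mult_mul_logCoord (t : logSpace K) : ∑ w, w.mult * logCoord t w = 0 := by
  rw [Fintype.sum_eq_add_sum_subtype_ne _ (w₀ : InfinitePlace K)]
  have h : ∀ v : {w : InfinitePlace K // w ≠ w₀}, (v.1.mult : ℝ) * logCoord t v.1 = t v := by
    intro v
    rw [logCoord, dif_pos v.2, mul_div_cancel₀ _ mult_coe_ne_zero]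
  rw [Finset.sum_congr rfl fun v _ ↦ h v, logCoord, dif_neg (by simp),
    mul_div_cancel₀ _ mult_coe_ne_zero, neg_add_cancel]

theorem logCoord_add (s t : logSpace K) (w : InfinitePlace K) :
    logCoord (s + t) w = logCoord s w + logCoord t w := by
  unfold logCoord
  split_ifs
  · simp [add_div]
  · simp [Finset.sum_add_distrib]; ring

theorem logCoord_smul (c : ℝ) (t : logSpace K) (w : InfinitePlace K) :
    logCoord (c • t) w = c * logCoord t w := by
  unfold logCoord
  split_ifs
  · simp [mul_div_assoc]
  · simp [← Finset.mul_sum]; ring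

theorem continuous_logCoord (w : InfinitePlace K) :
    Continuous fun t : logSpace K ↦ logCoord t w := by
  unfold logCoord
  split_ifs <;> fun_prop

theorem logCoord_of_sum_eq_zero {v : InfinitePlace K → ℝ} (hv : ∑ w, w.mult * v w = 0)
    (w : InfinitePlace K) : logCoord (fun w : {w // w ≠ w₀} ↦ w.1.mult * v w.1) w = v w := by
  unfold logCoord
  split_ifs with h
  · rw [mul_div_cancel_left₀ _ mult_coe_ne_zero]
  · rw [not_not] at h
    subst h
    rw [Fintype.sum_eq_add_sum_subtype_ne _ (w₀ : InfinitePlace K)] at hv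
    rw [div_eq_iff mult_coe_ne_zero]
    linarith

theorem logCoord_logEmbedding (u : (𝓞 K)ˣ) (w : InfinitePlace K) :
    logCoord (logEmbedding K (Additive.ofMul u)) w = Real.log (w (u : K)) :=
  logCoord_of_sum_eq_zero (sum_mult_mul_log u) w

/-- The set of points of the logarithmic space all of whose coordinates are less than `y`. -/
def logSimplex (K : Type*) [Field K] [NumberField K] (y : ℝ) : Set (logSpace K) :=
  {t | ∀ w, logCoord t w < y}

theorem isOpen_logSimplex (y : ℝ) : IsOpen (logSimplex K y) := by
  simp only [logSimplex, Set.ofPred_forall]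
  exact isOpen_iInter_of_finite fun w ↦ isOpen_lt (continuous_logCoord w) continuous_const

theorem logSimplex_of_nonpos {y : ℝ} (hy : y ≤ 0) : logSimplex K y = ∅ := by
  rw [Set.eq_empty_iff_forall_notMem]
  intro t ht
  have := sum_mult_mul_logCoord t
  have h : ∑ w : InfinitePlace K, (w.mult : ℝ) * logCoord t w < 0 := by
    refine Finset.sum_neg (fun w _ ↦ mul_neg_of_pos_of_neg (mult_cast_pos w) ((ht w).trans_le hy))
      Finset.univ_nonempty
  exact h.ne this

theorem volume_logSimplex {y : ℝ} (hy : 0 < y) :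
    volume (logSimplex K y) = ENNReal.ofReal (y ^ rank K) * volume (logSimplex K 1) := by
  have h : logSimplex K y = y • logSimplex K 1 := by
    ext t
    rw [Set.mem_smul_set_iff_inv_smul_mem₀ hy.ne']
    refine forall_congr' fun w ↦ ?_
    rw [logCoord_smul, inv_mul_lt_iff₀ hy, mul_one]
  rw [h, Measure.addHaar_smul, abs_of_pos (by positivity)]
  congr 3
  rw [Module.finrank_fintype_fun_eq_card, rank, Fintype.card_subtype_compl, Fintype.card_subtype_eq]

theorem volume_logSimplex_one_pos : 0 < volume (logSimplex K 1) := by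
  refine (isOpen_logSimplex 1).measure_pos _ ⟨0, fun w ↦ ?_⟩
  have := logCoord_smul (0 : ℝ) (0 : logSpace K) w
  rw [zero_smul, zero_mul] at this
  rw [this]
  exact one_pos

theorem volume_logSimplex_one_lt_top : volume (logSimplex K 1) < ⊤ := by
  have hsub : logSimplex K 1 ⊆ Set.Icc (fun _ ↦ -(Module.finrank ℚ K : ℝ)) (fun _ ↦ 2) := by
    intro t ht
    have h : ∀ v : {w : InfinitePlace K // w ≠ w₀}, (v.1.mult : ℝ) * logCoord t v.1 = t v := by
      intro v
      rw [logCoord, dif_pos v.2, mul_div_cancel₀ _ mult_coe_ne_zero]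
    refine ⟨fun v ↦ ?_, fun v ↦ ?_⟩
    · have h0 := sum_mult_mul_logCoord t
      rw [← Finset.add_sum_erase _ _ (Finset.mem_univ v.1), h v] at h0
      have h1 : ∑ w ∈ Finset.univ.erase v.1, (w.mult : ℝ) * logCoord t w ≤
          ∑ w : InfinitePlace K, (w.mult : ℝ) := by
        refine (Finset.sum_le_sum fun w _ ↦ mul_le_of_le_one_right (by positivity)
          (ht w).le).trans ?_
        exact Finset.sum_le_sum_of_subset_of_nonneg (Finset.erase_subset _ _)
          fun _ _ _ ↦ by positivity
      have h2 : ∑ w : InfinitePlace K, (w.mult : ℝ) = Module.finrank ℚ K := by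
        exact_mod_cast sum_mult_eq
      change -(Module.finrank ℚ K : ℝ) ≤ t v
      linarith
    · change t v ≤ 2
      rw [← h v]
      have h1 := (ht v.1).le
      have h2 : (v.1.mult : ℝ) ≤ 2 := by
        exact_mod_cast (by unfold mult; split_ifs <;> norm_num : v.1.mult ≤ 2)
      nlinarith [mult_cast_pos v.1]
  exact (measure_mono hsub).trans_lt (Metric.isBounded_Icc _ _).measure_lt_top

/-- The scalings of `a` by the logarithmic space whose absolute values are less than `X`. -/
def scaleSet (a : 𝓞 K) (X : ℝ) : Set (logSpace K) :=
  {t | ∀ w : InfinitePlace K, w (a : K) < X * Real.exp (-logCoord t w)}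

theorem isOpen_scaleSet (a : 𝓞 K) (X : ℝ) : IsOpen (scaleSet a X) := by
  simp only [scaleSet, Set.ofPred_forall]
  refine isOpen_iInter_of_finite fun w ↦ isOpen_lt continuous_const ?_
  have := continuous_logCoord w
  fun_prop

theorem mem_scaleSet_iff {a : 𝓞 K} (ha : a ≠ 0) {X : ℝ} (hX : 0 < X) (t : logSpace K) :
    t ∈ scaleSet a X ↔ ∀ w, logCoord t w + Real.log (w (a : K)) < Real.log X := by
  refine forall_congr' fun w ↦ ?_
  have hwa : 0 < w (a : K) := pos_iff.2 (by simpa using ha)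
  rw [← Real.log_lt_log_iff hwa (by positivity), Real.log_mul hX.ne' (Real.exp_pos _).ne',
    Real.log_exp]
  constructor <;> intro h <;> linarith

theorem sum_mult_mul_log_eq {a : 𝓞 K} (ha : a ≠ 0) :
    ∑ w : InfinitePlace K, w.mult * Real.log (w (a : K)) =
      Real.log (Ideal.absNorm (Ideal.span {a})) := by
  have h := prod_eq_abs_norm (a : K)
  have h2 : (Ideal.absNorm (Ideal.span {a}) : ℝ) = ((|Algebra.norm ℚ (a : K)| : ℚ) : ℝ) := by
    rw [Ideal.absNorm_span_singleton, ← Algebra.coe_norm_int, Nat.cast_natAbs]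
    push_cast
    rfl
  rw [h2, ← h, Real.log_prod]
  · simp [Real.log_pow]
  · intro w _
    have hwa : 0 < w (a : K) := pos_iff.2 (by simpa using ha)
    positivity

theorem volume_scaleSet {a : 𝓞 K} (ha : a ≠ 0) {X : ℝ} (hX : 0 < X) :
    volume (scaleSet a X) = volume (logSimplex K (Real.log X -
      Real.log (Ideal.absNorm (Ideal.span {a})) / Module.finrank ℚ K)) := by
  set n : ℝ := Real.log (Ideal.absNorm (Ideal.span {a})) / Module.finrank ℚ K with hn
  have hN : (Module.finrank ℚ K : ℝ) ≠ 0 := by exact_mod_cast Module.finrank_pos.ne'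
  have hsum : ∑ w : InfinitePlace K, w.mult * (Real.log (w (a : K)) - n) = 0 := by
    simp_rw [mul_sub, Finset.sum_sub_distrib, sum_mult_mul_log_eq ha, ← Finset.sum_mul]
    have h2 : ∑ w : InfinitePlace K, (w.mult : ℝ) = Module.finrank ℚ K := by
      exact_mod_cast sum_mult_eq
    rw [h2, hn, mul_div_cancel₀ _ hN, sub_self]
  rw [← measure_preimage_add_right volume
    (fun w : {w : InfinitePlace K // w ≠ w₀} ↦ w.1.mult * (Real.log (w.1 (a : K)) - n))
    (logSimplex K _)]
  congr 1
  ext t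
  rw [mem_scaleSet_iff ha hX]
  refine forall_congr' fun w ↦ ?_
  rw [logCoord_add, logCoord_of_sum_eq_zero hsum]
  constructor <;> intro h <;> linarith

theorem tsum_units_eq (φ : logSpace K → ℝ≥0∞) :
    ∑' u : (𝓞 K)ˣ, φ (logEmbedding K (Additive.ofMul u)) =
      torsionOrder K * ∑' l : unitLattice K, φ l := by
  let p : (𝓞 K)ˣ → unitLattice K := fun u ↦ ⟨logEmbedding K (Additive.ofMul u),
    Submodule.mem_map.2 ⟨Additive.ofMul u, trivial, rfl⟩⟩
  have hp : ∀ l, ∃ u, p u = l := by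
    rintro ⟨l, hl⟩
    obtain ⟨u, -, hu⟩ := Submodule.mem_map.1 hl
    exact ⟨u.toMul, Subtype.ext hu⟩
  rw [← (Equiv.sigmaFiberEquiv p).tsum_eq, ENNReal.tsum_sigma', ← ENNReal.tsum_mul_left]
  refine tsum_congr fun l ↦ ?_
  obtain ⟨u₀, hu₀⟩ := hp l
  have hker : ∀ u : (𝓞 K)ˣ, p (u₀ * u) = l ↔ u ∈ torsion K := by
    intro u
    rw [← logEmbedding_eq_zero_iff, ← hu₀, Subtype.ext_iff]
    simp [p]
  let e : torsion K ≃ {u // p u = l} :=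
    { toFun := fun ζ ↦ ⟨u₀ * ζ, (hker _).2 ζ.2⟩
      invFun := fun u ↦ ⟨u₀⁻¹ * u, (hker _).1 (by rw [mul_inv_cancel_left]; exact u.2)⟩
      left_inv := fun ζ ↦ by simp
      right_inv := fun u ↦ by simp }
  have h1 : ∀ c : {u // p u = l}, φ (logEmbedding K (Additive.ofMul
      ((Equiv.sigmaFiberEquiv p) ⟨l, c⟩))) = φ l := by
    rintro ⟨u, rfl⟩
    rfl
  have := Fintype.ofFinite (torsion K)
  rw [tsum_congr h1, ← e.tsum_eq, tsum_fintype, Finset.sum_const, nsmul_eq_mul, Finset.card_univ,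
      torsionOrder,
    Nat.card_eq_fintype_card]

/-- A fundamental domain of the unit lattice, of volume the regulator. -/
theorem exists_fundamentalDomain_unitLattice : ∃ F : Set (logSpace K),
    IsAddFundamentalDomain (unitLattice K).toAddSubgroup F volume ∧
      volume F = ENNReal.ofReal (regulator K) := by
  have hF := ZLattice.isAddFundamentalDomain (Module.Free.chooseBasis ℤ (unitLattice K)) volume
  refine ⟨_, hF, ?_⟩
  rw [regulator, ZLattice.covolume_eq_measure_fundamentalDomain _ _ hF, measureReal_def,
    ENNReal.ofReal_toReal]
  exact (ZSpan.fundamentalDomain_isBounded _).measure_lt_top.ne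

theorem tsum_units_volume_scaleSet {F : Set (logSpace K)}
    (hF : IsAddFundamentalDomain (unitLattice K).toAddSubgroup F volume) {a : 𝓞 K} (ha : a ≠ 0) {X
        : ℝ}
    (hX : 0 < X) :
    ∑' u : (𝓞 K)ˣ, volume (scaleSet ((u : 𝓞 K) * a) X ∩ F) =
      torsionOrder K * volume (scaleSet a X) := by
  have h1 : ∀ u : (𝓞 K)ˣ, scaleSet ((u : 𝓞 K) * a) X =
      (-(logEmbedding K (Additive.ofMul u))) +ᵥ scaleSet a X := by
    intro u
    ext t
    rw [Set.mem_vadd_set_iff_neg_vadd_mem, neg_neg, mem_scaleSet_iff ha hX,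
      mem_scaleSet_iff (by simp [ha]) hX]
    refine forall_congr' fun w ↦ ?_
    have hwa : 0 < w (a : K) := pos_iff.2 (by simpa using ha)
    have hwu : 0 < w ((u : 𝓞 K) : K) := pos_iff.2 (by simp)
    have hmul : w (((u : 𝓞 K) * a : 𝓞 K) : K) = w ((u : 𝓞 K) : K) * w (a : K) := by
      rw [← map_mul]; rfl
    rw [vadd_eq_add, logCoord_add, logCoord_logEmbedding, hmul,
      Real.log_mul hwu.ne' hwa.ne']
    constructor <;> intro h <;> linarith
  simp_rw [h1]
  have : Countable (unitLattice K).toAddSubgroup := by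
    change Countable (unitLattice K)
    infer_instance
  rw [tsum_units_eq (fun l ↦ volume ((-l +ᵥ scaleSet a X) ∩ F)), hF.measure_eq_tsum,
    ← (Equiv.neg (unitLattice K)).tsum_eq]
  congr 1
  refine tsum_congr fun l ↦ ?_
  rw [Equiv.neg_apply, Submodule.coe_neg, neg_neg]
  rfl

end LogScale

section Unfolding

open NumberField.InfinitePlace NumberField.Units NumberField.Units.dirichletUnitTheorem
open scoped nonZeroDivisors

variable {K : Type*} [Field K] [NumberField K]

variable (K) in
theorem countable_ringOfIntegers : Countable (𝓞 K) :=
  (Module.Free.chooseBasis ℤ (𝓞 K)).equivFun.injective.countable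

/-- The nonzero elements of `J` correspond to the pairs of an ideal in the class inverse to that
of `J` and a unit. -/
theorem tsum_mem_ideal_eq (J : (Ideal (𝓞 K))⁰) (g : 𝓞 K → ℝ≥0∞) (h : Ideal (𝓞 K) → ℝ≥0∞)
    (hg : ∀ a : 𝓞 K, a ≠ 0 → ∀ I : Ideal (𝓞 K), Ideal.span {a} = J * I →
      ∑' u : (𝓞 K)ˣ, g (u * a) = h I) :
    ∑' a : 𝓞 K, (if a ∈ (J : Ideal (𝓞 K)) ∧ a ≠ 0 then g a else 0) =
      ∑' I : {I : (Ideal (𝓞 K))⁰ // ClassGroup.mk0 I = (ClassGroup.mk0 J)⁻¹}, h I.1 := by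
  have hJ0 : (J : Ideal (𝓞 K)) ≠ 0 := nonZeroDivisors.ne_zero J.2
  have key : ∀ a : {a : 𝓞 K // a ∈ (J : Ideal (𝓞 K)) ∧ a ≠ 0},
      ∃ I : {I : (Ideal (𝓞 K))⁰ // ClassGroup.mk0 I = (ClassGroup.mk0 J)⁻¹},
        Ideal.span {a.1} = (J : Ideal (𝓞 K)) * (I.1 : Ideal (𝓞 K)) := by
    rintro ⟨a, haJ, ha⟩
    obtain ⟨I, hI⟩ := Ideal.dvd_span_singleton.2 haJ
    have hs : Ideal.span {a} ≠ 0 := by simpa using ha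
    have hI0 : I ≠ 0 := fun h0 ↦ hs (by rw [hI, h0, mul_zero])
    refine ⟨⟨⟨I, mem_nonZeroDivisors_of_ne_zero hI0⟩, ?_⟩, hI⟩
    rw [eq_inv_iff_mul_eq_one, mul_comm, ← map_mul, ClassGroup.mk0_eq_one_iff]
    exact ⟨⟨a, hI.symm⟩⟩
  choose q hq using key
  have hsurj : ∀ I, ∃ a, q a = I := by
    intro I
    have h1 := I.2
    rw [eq_inv_iff_mul_eq_one, mul_comm, ← map_mul, ClassGroup.mk0_eq_one_iff] at h1
    obtain ⟨a, ha⟩ := h1.principal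
    rw [Submonoid.coe_mul, ← Ideal.span] at ha
    have ha0 : a ≠ 0 := by
      rintro rfl
      have hI0 : (I.1 : Ideal (𝓞 K)) ≠ 0 := nonZeroDivisors.ne_zero I.1.2
      exact mul_ne_zero hJ0 hI0 (by rw [ha]; simp)
    refine ⟨⟨a, Ideal.dvd_span_singleton.1 ⟨_, ha.symm⟩, ha0⟩, Subtype.ext (Subtype.ext ?_)⟩
    exact mul_left_cancel₀ hJ0 ((hq _).symm.trans ha.symm)
  have h0 : ∑' a : 𝓞 K, (if a ∈ (J : Ideal (𝓞 K)) ∧ a ≠ 0 then g a else 0) =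
      ∑' a : {a : 𝓞 K // a ∈ (J : Ideal (𝓞 K)) ∧ a ≠ 0}, g a.1 := by
    refine Eq.symm ((tsum_subtype {a : 𝓞 K | a ∈ (J : Ideal (𝓞 K)) ∧ a ≠ 0} g).trans ?_)
    refine tsum_congr fun a ↦ ?_
    rw [Set.indicator_apply]
    rfl
  rw [h0, ← (Equiv.sigmaFiberEquiv q).tsum_eq, ENNReal.tsum_sigma']
  refine tsum_congr fun I ↦ ?_
  obtain ⟨a, rfl⟩ := hsurj I
  rw [← hg a.1 a.2.2 _ (hq a)]
  have hspan : ∀ b, q b = q a ↔ Ideal.span {b.1} = Ideal.span {a.1} := by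
    intro b
    rw [hq, hq]
    exact ⟨fun h ↦ by rw [h], fun h ↦ Subtype.ext (Subtype.ext (mul_left_cancel₀ hJ0 h))⟩
  have hmem : ∀ u : (𝓞 K)ˣ, (u : 𝓞 K) * a.1 ∈ (J : Ideal (𝓞 K)) ∧ (u : 𝓞 K) * a.1 ≠ 0 := fun u ↦
    ⟨Ideal.mul_mem_left _ _ a.2.1, mul_ne_zero u.ne_zero a.2.2⟩
  let e : (𝓞 K)ˣ ≃ {b // q b = q a} := Equiv.ofBijective
    (fun u ↦ ⟨⟨u * a.1, hmem u⟩, (hspan _).2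
      (Ideal.span_singleton_mul_left_unit u.isUnit a.1)⟩) (by
    constructor
    · intro u v huv
      have h2 : (u : 𝓞 K) * a.1 = v * a.1 := congrArg (fun z ↦ z.1.1) huv
      exact Units.ext (mul_right_cancel₀ a.2.2 h2)
    · rintro ⟨b, hb⟩
      obtain ⟨u, hu⟩ := Ideal.span_singleton_eq_span_singleton.1 ((hspan b).1 hb).symm
      exact ⟨u, Subtype.ext (Subtype.ext (by rw [← hu, mul_comm]))⟩)
  rw [← e.tsum_eq]
  rfl

/-- The Riesz mean, of order the unit rank, of the coefficients of the Dedekind zeta function. -/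
noncomputable def rieszSum (K : Type*) [Field K] [NumberField K] (x : ℝ) : ℝ≥0∞ :=
  ∑' I : (Ideal (𝓞 K))⁰, if (Ideal.absNorm (I : Ideal (𝓞 K)) : ℝ) < x then
    ENNReal.ofReal (Real.log (x / Ideal.absNorm (I : Ideal (𝓞 K))) ^ rank K) else 0

theorem lintegral_boxCount {F : Set (logSpace K)}
    (hF : IsAddFundamentalDomain (unitLattice K).toAddSubgroup F volume) (J : (Ideal (𝓞 K))⁰)
    {x : ℝ} (hx : 0 < x) :
    ∫⁻ t in F, boxCount (J : Ideal (𝓞 K)) (fun w ↦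
      (Ideal.absNorm (J : Ideal (𝓞 K)) * x) ^ (1 / (Module.finrank ℚ K : ℝ)) *
        Real.exp (-logCoord t w)) =
    ∑' I : {I : (Ideal (𝓞 K))⁰ // ClassGroup.mk0 I = (ClassGroup.mk0 J)⁻¹},
      torsionOrder K * volume (logSimplex K 1) *
        ENNReal.ofReal ((1 / (Module.finrank ℚ K : ℝ)) ^ rank K) *
        (if (Ideal.absNorm (I : Ideal (𝓞 K)) : ℝ) < x then
        ENNReal.ofReal (Real.log (x / Ideal.absNorm (I : Ideal (𝓞 K))) ^ rank K) else 0) := by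
  have hN0 : (Module.finrank ℚ K : ℝ) ≠ 0 := by exact_mod_cast Module.finrank_pos.ne'
  have hN1 : (0 : ℝ) < Module.finrank ℚ K := by exact_mod_cast Module.finrank_pos
  have hJ0 : (0 : ℝ) < Ideal.absNorm (J : Ideal (𝓞 K)) := by
    exact_mod_cast Ideal.absNorm_pos_iff_mem_nonZeroDivisors.mpr J.2
  set X : ℝ := (Ideal.absNorm (J : Ideal (𝓞 K)) * x) ^ (1 / (Module.finrank ℚ K : ℝ)) with hX
  have hX0 : 0 < X := by positivity
  have hmeas : ∀ a : 𝓞 K, Measurable fun t : logSpace K ↦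
      (if a ∈ (J : Ideal (𝓞 K)) ∧ a ≠ 0 ∧ ∀ w : InfinitePlace K,
        w (a : K) < X * Real.exp (-logCoord t w) then (1 : ℝ≥0∞) else 0) := by
    intro a
    by_cases ha : a ∈ (J : Ideal (𝓞 K)) ∧ a ≠ 0
    · simp only [ha, ne_eq, not_false_eq_true, true_and]
      exact Measurable.ite (isOpen_scaleSet a X).measurableSet measurable_const measurable_const
    · simp only [← and_assoc, ha, false_and, if_false]
      exact measurable_const
  unfold boxCount
  have := countable_ringOfIntegers K
  rw [lintegral_tsum fun a ↦ (hmeas a).aemeasurable]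
  refine Eq.trans ?_ (tsum_mem_ideal_eq J (fun a ↦ volume (scaleSet a X ∩ F))
    (fun I ↦ torsionOrder K * volume (logSimplex K 1) *
      ENNReal.ofReal ((1 / (Module.finrank ℚ K : ℝ)) ^ rank K) *
      (if (Ideal.absNorm I : ℝ) < x then
        ENNReal.ofReal (Real.log (x / Ideal.absNorm I) ^ rank K) else 0)) ?_)
  · refine tsum_congr fun a ↦ ?_
    by_cases ha : a ∈ (J : Ideal (𝓞 K)) ∧ a ≠ 0
    · rw [if_pos ha]
      simp only [ha, ne_eq, not_false_eq_true, true_and]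
      have h2 : ∀ t : logSpace K, (if ∀ w : InfinitePlace K,
          w (a : K) < X * Real.exp (-logCoord t w) then (1 : ℝ≥0∞) else 0) =
          (scaleSet a X).indicator 1 t := by
        intro t
        rw [Set.indicator_apply]
        exact if_congr Iff.rfl rfl rfl
      simp_rw [h2]
      rw [lintegral_indicator_one (isOpen_scaleSet a X).measurableSet,
        Measure.restrict_apply (isOpen_scaleSet a X).measurableSet]
    · rw [if_neg ha]
      simp only [← and_assoc, ha, false_and, if_false, lintegral_zero]
  · intro a ha I hI
    rw [tsum_units_volume_scaleSet hF ha hX0, volume_scaleSet ha hX0, hI, map_mul, mul_assoc,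
      mul_assoc]
    congr 1
    have hI0 : (0 : ℝ) < Ideal.absNorm I := by
      have : I ≠ 0 := by
        rintro rfl
        rw [mul_zero, Ideal.zero_eq_bot, Ideal.span_singleton_eq_bot] at hI
        exact ha hI
      exact_mod_cast Ideal.absNorm_pos_iff_mem_nonZeroDivisors.mpr
        (mem_nonZeroDivisors_of_ne_zero this)
    have h3 : Real.log X - Real.log ((Ideal.absNorm (J : Ideal (𝓞 K)) * Ideal.absNorm I : ℕ) : ℝ) /
        Module.finrank ℚ K = 1 / (Module.finrank ℚ K : ℝ) * Real.log (x / Ideal.absNorm I) := by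
      rw [hX, Real.log_rpow (by positivity), Real.log_mul hJ0.ne' hx.ne', Nat.cast_mul,
        Real.log_mul hJ0.ne' hI0.ne', Real.log_div hx.ne' hI0.ne']
      field_simp
      ring
    rw [h3]
    split_ifs with hlt
    · have hl : 0 < Real.log (x / Ideal.absNorm I) := Real.log_pos (by rwa [one_lt_div hI0])
      rw [volume_logSimplex (by positivity), mul_pow, ENNReal.ofReal_mul (by positivity)]
      ring
    · rw [logSimplex_of_nonpos, measure_empty, mul_zero, mul_zero]
      refine mul_nonpos_of_nonneg_of_nonpos (by positivity) (Real.log_nonpos (by positivity) ?_)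
      rw [div_le_one hI0]
      exact not_lt.1 hlt

variable (K) in
/-- The ideal counting asymptotics, with an error term of explicit size. -/
theorem exists_rieszSum_bounds : ∃ A : ℝ, 0 < A ∧ ∀ x : ℝ,
    (covBound K : ℝ) ^ Module.finrank ℚ K ≤ x →
      ENNReal.ofReal (A * x * (1 - 2 ^ (2 * Module.finrank ℚ K) *
        (covBound K / x ^ (1 / (Module.finrank ℚ K : ℝ))))) ≤ rieszSum K x ∧
      rieszSum K x ≤ ENNReal.ofReal (A * x * (1 + 2 ^ (2 * Module.finrank ℚ K) *
        (covBound K / x ^ (1 / (Module.finrank ℚ K : ℝ))))) := by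
  obtain ⟨A, hA, hbox⟩ := exists_boxCount_bounds K
  obtain ⟨F, hF, hvol⟩ := exists_fundamentalDomain_unitLattice (K := K)
  have hN1 : (0 : ℝ) < Module.finrank ℚ K := by exact_mod_cast Module.finrank_pos
  have hR := regulator_pos K
  set V : ℝ := (volume (logSimplex K 1)).toReal with hV
  have hV0 : 0 < V := ENNReal.toReal_pos volume_logSimplex_one_pos.ne'
      volume_logSimplex_one_lt_top.ne
  have hw : (0 : ℝ) < torsionOrder K := by exact_mod_cast torsionOrder_pos K
  set c : ℝ := torsionOrder K * V * (1 / (Module.finrank ℚ K : ℝ)) ^ rank K with hc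
  have hc0 : 0 < c := by positivity
  have hcE : (torsionOrder K : ℝ≥0∞) * volume (logSimplex K 1) *
        ENNReal.ofReal ((1 / (Module.finrank ℚ K : ℝ)) ^ rank K) = ENNReal.ofReal c := by
    rw [hc, ENNReal.ofReal_mul (by positivity), ENNReal.ofReal_mul (by positivity),
      ENNReal.ofReal_natCast, hV, ENNReal.ofReal_toReal volume_logSimplex_one_lt_top.ne]
  have hcard : (0 : ℝ) < Fintype.card (ClassGroup (𝓞 K)) := by exact_mod_cast Fintype.card_pos
  refine ⟨Fintype.card (ClassGroup (𝓞 K)) * (regulator K * A / c), by positivity, fun x hx ↦ ?_⟩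
  have hD := covBound_pos K
  have hx0 : 0 < x := lt_of_lt_of_le (by positivity) hx
  set S : ClassGroup (𝓞 K) → ℝ≥0∞ := fun C ↦
    ∑' I : {I : (Ideal (𝓞 K))⁰ // ClassGroup.mk0 I = C},
      (if (Ideal.absNorm (I : Ideal (𝓞 K)) : ℝ) < x then
        ENNReal.ofReal (Real.log (x / Ideal.absNorm (I : Ideal (𝓞 K))) ^ rank K) else 0) with hS
  have hsum : rieszSum K x = ∑ C, S C := by
    rw [rieszSum, ← (Equiv.sigmaFiberEquiv (ClassGroup.mk0 (R := 𝓞 K))).tsum_eq,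
      ENNReal.tsum_sigma', tsum_fintype]
    rfl
  set lo := A * x * (1 - 2 ^ (2 * Module.finrank ℚ K) *
        (covBound K / x ^ (1 / (Module.finrank ℚ K : ℝ)))) with hlo
  set hi := A * x * (1 + 2 ^ (2 * Module.finrank ℚ K) *
        (covBound K / x ^ (1 / (Module.finrank ℚ K : ℝ)))) with hhi
  have hC : ∀ C, ENNReal.ofReal (regulator K / c * lo) ≤ S C ∧
      S C ≤ ENNReal.ofReal (regulator K / c * hi) := by
    intro C
    obtain ⟨J, hJ⟩ := ClassGroup.mk0_surjective C⁻¹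
    have hint := lintegral_boxCount hF J hx0
    rw [hcE, ENNReal.tsum_mul_left, hJ, inv_inv] at hint
    have hb : ∀ t : logSpace K, _ := fun t ↦ hbox J (nonZeroDivisors.ne_zero J.2)
      (fun w ↦ Real.exp (-logCoord t w)) (fun w ↦ Real.exp_pos _) (by
        simp_rw [← Real.exp_nat_mul, ← Real.exp_sum, mul_neg, Finset.sum_neg_distrib,
          sum_mult_mul_logCoord, neg_zero, Real.exp_zero]) x hx
    have h1 : ENNReal.ofReal lo * volume F ≤ ENNReal.ofReal c * S C := by
      rw [hS, ← hint, ← setLIntegral_const]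
      exact lintegral_mono fun t ↦ (hb t).1
    have h2 : ENNReal.ofReal c * S C ≤ ENNReal.ofReal hi * volume F := by
      rw [hS, ← hint, ← setLIntegral_const]
      exact lintegral_mono fun t ↦ (hb t).2
    have hcinv : ∀ y : ℝ≥0∞, ENNReal.ofReal c⁻¹ * (ENNReal.ofReal c * y) = y := fun y ↦ by
      rw [← mul_assoc, ← ENNReal.ofReal_mul (by positivity), inv_mul_cancel₀ hc0.ne',
        ENNReal.ofReal_one, one_mul]
    have hr : ∀ y : ℝ, ENNReal.ofReal (regulator K / c * y) =
        ENNReal.ofReal c⁻¹ * (ENNReal.ofReal y * volume F) := fun y ↦ by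
      rw [hvol, mul_comm (ENNReal.ofReal y), ← mul_assoc, ← ENNReal.ofReal_mul (by positivity),
        ← ENNReal.ofReal_mul (by positivity)]
      congr 1
      ring
    rw [hr, hr, ← hcinv (S C)]
    exact ⟨by gcongr, by gcongr⟩
  have hfin : ∀ y : ℝ, ∑ _C : ClassGroup (𝓞 K), ENNReal.ofReal (regulator K / c * y) =
      ENNReal.ofReal (Fintype.card (ClassGroup (𝓞 K)) * (regulator K / c * y)) := fun y ↦ by
    rw [Finset.sum_const, nsmul_eq_mul, Finset.card_univ, ENNReal.ofReal_mul hcard.le,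
      ENNReal.ofReal_natCast]
  rw [hsum]
  constructor
  · refine le_trans (le_of_eq ?_) ((hfin lo).symm.trans_le (Finset.sum_le_sum fun C _ ↦ (hC C).1))
    congr 1
    rw [hlo]
    ring
  · refine (Finset.sum_le_sum fun C _ ↦ (hC C).2).trans ((hfin hi).trans_le (le_of_eq ?_))
    congr 1
    rw [hhi]
    ring

end Unfolding

section Laplace

open Set ProbabilityTheory

theorem analyticOnNhd_laplace_of_nonneg {S : Set ℝ} (hS : MeasurableSet S) {g : ℝ → ℝ}
    (hg : Measurable g) (hg0 : ∀ t ∈ S, 0 ≤ g t) {δ : ℝ}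
    (hint : ∀ s, δ < s → IntegrableOn (fun t ↦ g t * Real.exp (-s * t)) S) :
    AnalyticOnNhd ℝ (fun s ↦ ∫ t in S, g t * Real.exp (-s * t)) (Ioi δ) := by
  set μ : Measure ℝ := (volume.restrict S).withDensity (fun t ↦ ENNReal.ofReal (g t)) with hμ
  have hm : Measurable fun t ↦ ENNReal.ofReal (g t) := hg.ennreal_ofReal
  have hfin : ∀ᵐ t ∂(volume.restrict S), ENNReal.ofReal (g t) < ∞ := by
    simp
  have htoReal : ∀ s : ℝ, (fun t ↦ (ENNReal.ofReal (g t)).toReal • Real.exp (-s * t))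
      =ᵐ[volume.restrict S] fun t ↦ g t * Real.exp (-s * t) := by
    intro s
    filter_upwards [ae_restrict_mem hS] with t ht
    rw [ENNReal.toReal_ofReal (hg0 t ht), smul_eq_mul]
  have h1 : Iio (-δ) ⊆ interior (integrableExpSet id μ) := by
    rw [← (isOpen_Iio (a := -δ)).interior_eq]
    refine interior_mono fun s hs ↦ ?_
    rw [integrableExpSet, mem_ofPred_eq, hμ, integrable_withDensity_iff_integrable_smul' hm hfin]
    have := (integrable_congr (htoReal (-s))).2 (hint (-s) (by rw [mem_Iio] at hs; linarith))
    simpa using this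
  have h2 : (fun s ↦ ∫ t in S, g t * Real.exp (-s * t)) = fun s ↦ mgf id μ (-s) := by
    funext s
    rw [mgf, hμ, integral_withDensity_eq_integral_toReal_smul hm hfin]
    exact (integral_congr_ae (htoReal s)).symm
  rw [h2]
  intro s hs
  exact (analyticAt_mgf (h1 (by rw [mem_Iio]; rw [mem_Ioi] at hs; linarith))).comp
    analyticAt_id.neg

/-- The analytic continuation of `s ↦ (s - 1) * ∫₀^∞ T(t) exp(-s t) dt` when `T(t)` is close to
`A exp t`. -/
noncomputable def laplaceCont (T : ℝ → ℝ) (A t₁ s : ℝ) : ℝ :=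
  (s - 1) * ((∫ t in Ioc 0 t₁, T t * Real.exp (-s * t)) +
    ∫ t in Ioi t₁, (T t - A * Real.exp t) * Real.exp (-s * t)) + A * Real.exp ((1 - s) * t₁)

variable {T : ℝ → ℝ} {A B δ t₁ : ℝ}

theorem integrableOn_Ioc_mul_exp (hT : Monotone T) (s : ℝ) :
    IntegrableOn (fun t ↦ T t * Real.exp (-s * t)) (Ioc 0 t₁) := by
  have h1 : IntegrableOn T (Icc 0 t₁) := (hT.monotoneOn _).integrableOn_isCompact isCompact_Icc
  exact (h1.mul_continuousOn (by fun_prop) isCompact_Icc).mono_set Ioc_subset_Icc_self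

theorem integrableOn_exp_mul_exp {a s : ℝ} (h : a < s) (c : ℝ) :
    IntegrableOn (fun t ↦ Real.exp (a * t) * Real.exp (-s * t)) (Ioi c) := by
  refine (integrableOn_exp_mul_Ioi (a := a - s) (by linarith) c).congr_fun (fun t _ ↦ ?_)
    measurableSet_Ioi
  simp only
  rw [← Real.exp_add]
  ring_nf

theorem integral_exp_mul_exp {a s : ℝ} (h : a < s) (c : ℝ) :
    ∫ t in Ioi c, Real.exp (a * t) * Real.exp (-s * t) = Real.exp ((a - s) * c) / (s - a) := by
  have h1 : ∀ t, Real.exp (a * t) * Real.exp (-s * t) = Real.exp ((a - s) * t) := fun t ↦ by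
    rw [← Real.exp_add]
    ring_nf
  simp_rw [h1]
  rw [integral_exp_mul_Ioi (by linarith), neg_div, ← div_neg, neg_sub]

theorem integrableOn_error (hT : Monotone T)
    (hE : ∀ t, t₁ ≤ t → |T t - A * Real.exp t| ≤ B * Real.exp (δ * t)) {s : ℝ} (hs : δ < s) :
    IntegrableOn (fun t ↦ (T t - A * Real.exp t) * Real.exp (-s * t)) (Ioi t₁) := by
  refine Integrable.mono' ((integrableOn_exp_mul_exp hs t₁).const_mul B)
    (((hT.measurable.sub (by fun_prop)).mul (by fun_prop)).aestronglyMeasurable) ?_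
  filter_upwards [ae_restrict_mem measurableSet_Ioi] with t ht
  rw [norm_mul, Real.norm_eq_abs, Real.norm_eq_abs, Real.abs_exp, ← mul_assoc]
  exact mul_le_mul_of_nonneg_right (hE t (le_of_lt ht)) (Real.exp_pos _).le

theorem analyticOnNhd_laplaceCont (hT : Monotone T) (hT0 : ∀ t, 0 ≤ T t) (hB : 0 ≤ B)
    (hE : ∀ t, t₁ ≤ t → |T t - A * Real.exp t| ≤ B * Real.exp (δ * t)) :
    AnalyticOnNhd ℝ (laplaceCont T A t₁) (Ioi δ) := by
  have h1 : AnalyticOnNhd ℝ (fun s ↦ ∫ t in Ioc 0 t₁, T t * Real.exp (-s * t)) (Ioi δ) :=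
    analyticOnNhd_laplace_of_nonneg measurableSet_Ioc hT.measurable (fun t _ ↦ hT0 t)
      fun s _ ↦ integrableOn_Ioc_mul_exp hT s
  have h2 : AnalyticOnNhd ℝ (fun s ↦ ∫ t in Ioi t₁, (B * Real.exp (δ * t)) * Real.exp (-s * t))
      (Ioi δ) := by
    refine analyticOnNhd_laplace_of_nonneg measurableSet_Ioi (by fun_prop) (fun t _ ↦ by positivity)
      fun s hs ↦ ?_
    simp_rw [mul_assoc]
    exact (integrableOn_exp_mul_exp hs t₁).const_mul B
  have hsplit : ∀ s, δ < s → IntegrableOn (fun t ↦ (T t - A * Real.exp t + B * Real.exp (δ * t)) *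
      Real.exp (-s * t)) (Ioi t₁) := by
    intro s hs
    have := (integrableOn_error hT hE hs).add ((integrableOn_exp_mul_exp hs t₁).const_mul B)
    refine this.congr_fun (fun t _ ↦ ?_) measurableSet_Ioi
    simp only [Pi.add_apply]
    ring
  have h3 : AnalyticOnNhd ℝ (fun s ↦ ∫ t in Ioi t₁, (T t - A * Real.exp t + B * Real.exp (δ * t)) *
      Real.exp (-s * t)) (Ioi δ) := by
    refine analyticOnNhd_laplace_of_nonneg measurableSet_Ioi ((hT.measurable.sub (by fun_prop)).add
      (by fun_prop)) (fun t ht ↦ ?_) hsplit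
    have := (abs_le.1 (hE t (le_of_lt ht))).1
    change 0 ≤ T t - A * Real.exp t + B * Real.exp (δ * t)
    linarith
  have h4 : AnalyticOnNhd ℝ (fun s ↦ ∫ t in Ioi t₁, (T t - A * Real.exp t) * Real.exp (-s * t))
      (Ioi δ) := by
    refine (h3.sub h2).congr isOpen_Ioi fun s hs ↦ ?_
    simp only [Pi.sub_apply]
    rw [← integral_sub (hsplit s hs) (by
      simp_rw [mul_assoc]; exact (integrableOn_exp_mul_exp hs t₁).const_mul B)]
    refine integral_congr_ae (.of_forall fun t ↦ ?_)
    simp only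
    ring
  intro s hs
  unfold laplaceCont
  have h5 : AnalyticAt ℝ (fun s : ℝ ↦ Real.exp ((1 - s) * t₁)) s := by fun_prop
  exact ((analyticAt_id.sub analyticAt_const).mul ((h1 s hs).add (h4 s hs))).add
    (analyticAt_const.mul h5)

theorem laplaceCont_one : laplaceCont T A t₁ 1 = A := by
  simp [laplaceCont]

theorem laplaceCont_of_one_lt (hT : Monotone T) (ht₁ : 0 ≤ t₁) (hδ : δ < 1)
    (hE : ∀ t, t₁ ≤ t → |T t - A * Real.exp t| ≤ B * Real.exp (δ * t)) {s : ℝ} (hs : 1 < s) :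
    IntegrableOn (fun t ↦ T t * Real.exp (-s * t)) (Ioi 0) ∧
      laplaceCont T A t₁ s = (s - 1) * ∫ t in Ioi 0, T t * Real.exp (-s * t) := by
  have hA : IntegrableOn (fun t ↦ A * (Real.exp (1 * t) * Real.exp (-s * t))) (Ioi t₁) :=
    (integrableOn_exp_mul_exp hs t₁).const_mul A
  have hEi := integrableOn_error hT hE (hδ.trans hs)
  have heq : ∀ t, T t * Real.exp (-s * t) = (T t - A * Real.exp t) * Real.exp (-s * t) +
      A * (Real.exp (1 * t) * Real.exp (-s * t)) := fun t ↦ by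
    rw [one_mul]; ring
  have h2 : IntegrableOn (fun t ↦ T t * Real.exp (-s * t)) (Ioi t₁) := by
    simp_rw [heq]
    exact hEi.add hA
  have h1 := integrableOn_Ioc_mul_exp (t₁ := t₁) hT s
  have hun : Ioi (0 : ℝ) = Ioc 0 t₁ ∪ Ioi t₁ := (Ioc_union_Ioi_eq_Ioi ht₁).symm
  refine ⟨by rw [hun]; exact h1.union h2, ?_⟩
  have hs1 : s - 1 ≠ 0 := by linarith
  have hint2 : ∫ t in Ioi t₁, T t * Real.exp (-s * t) =
      (∫ t in Ioi t₁, (T t - A * Real.exp t) * Real.exp (-s * t)) +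
        A * (Real.exp ((1 - s) * t₁) / (s - 1)) := by
    rw [← integral_exp_mul_exp hs, ← integral_const_mul, ← integral_add hEi hA]
    simp_rw [← heq]
  rw [hun, setIntegral_union (Ioc_disjoint_Ioi le_rfl) measurableSet_Ioi h1 h2, hint2, laplaceCont]
  field_simp
  ring

/-- Nonnegativity of the continuation to the left of `1` bounds `A` from below. -/
theorem le_of_laplaceCont_nonneg {r : ℕ} (hT : Monotone T) (hT0 : ∀ t, 0 ≤ T t)
    (hTr : ∀ t, 0 < t → t ^ r ≤ T t) (ht₁ : 1 ≤ t₁)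
    (hE : ∀ t, t₁ ≤ t → |T t - A * Real.exp t| ≤ B * Real.exp (δ * t)) {β : ℝ} (hβ0 : 0 ≤ β)
    (hβδ : δ < β) (hβ : β < 1) (hpos : 0 ≤ laplaceCont T A t₁ β) :
    Real.exp (-1) / (r + 1) ≤
      A * Real.exp ((1 - β) * t₁) / (1 - β) + B * Real.exp ((δ - β) * t₁) / (β - δ) := by
  have h1 : Real.exp (-1) / (r + 1) ≤ ∫ t in Ioc 0 t₁, T t * Real.exp (-β * t) := by
    have hi := integrableOn_Ioc_mul_exp (t₁ := t₁) hT β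
    have h2 : ∫ t in Ioc (0 : ℝ) 1, t ^ r * Real.exp (-1) ≤
        ∫ t in Ioc 0 t₁, T t * Real.exp (-β * t) := by
      refine le_trans ?_ (setIntegral_mono_set hi (.of_forall fun t ↦ ?_)
        (Ioc_subset_Ioc_right ht₁).eventuallyLE)
      · refine setIntegral_mono_on ?_ (hi.mono_set (Ioc_subset_Ioc_right ht₁)) measurableSet_Ioc
          fun t ht ↦ ?_
        · exact (Continuous.integrableOn_Icc (by fun_prop)).mono_set Ioc_subset_Icc_self
        · refine mul_le_mul (hTr t ht.1) (Real.exp_le_exp.2 ?_) (Real.exp_pos _).le (hT0 t)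
          nlinarith [ht.1, ht.2]
      · exact mul_nonneg (hT0 t) (Real.exp_pos _).le
    refine le_trans (le_of_eq ?_) h2
    rw [← intervalIntegral.integral_of_le zero_le_one, intervalIntegral.integral_mul_const,
      integral_pow]
    simp
    ring
  have h2 : |∫ t in Ioi t₁, (T t - A * Real.exp t) * Real.exp (-β * t)| ≤
      B * (Real.exp ((δ - β) * t₁) / (β - δ)) := by
    rw [← integral_exp_mul_exp hβδ, ← integral_const_mul, ← Real.norm_eq_abs]
    refine norm_integral_le_of_norm_le ((integrableOn_exp_mul_exp hβδ t₁).const_mul B) ?_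
    filter_upwards [ae_restrict_mem measurableSet_Ioi] with t ht
    rw [norm_mul, Real.norm_eq_abs, Real.norm_eq_abs, Real.abs_exp, ← mul_assoc]
    exact mul_le_mul_of_nonneg_right (hE t (le_of_lt ht)) (Real.exp_pos _).le
  have h3 := (abs_le.1 h2).1
  unfold laplaceCont at hpos
  have h4 : (1 - β) * ((∫ t in Ioc 0 t₁, T t * Real.exp (-β * t)) +
    ∫ t in Ioi t₁, (T t - A * Real.exp t) * Real.exp (-β * t)) ≤ A * Real.exp ((1 - β) * t₁) := by
    linarith
  rw [← le_div_iff₀' (by linarith)] at h4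
  rw [mul_div_assoc B]
  linarith

end Laplace

section ZetaSum

open NumberField.Units
open scoped nonZeroDivisors

variable (K : Type*) [Field K] [NumberField K]

/-- The Dedekind zeta function at real arguments, as a sum of nonnegative terms. -/
noncomputable def zetaSum (s : ℝ) : ℝ≥0∞ :=
  ∑' I : (Ideal (𝓞 K))⁰, ENNReal.ofReal ((Ideal.absNorm (I : Ideal (𝓞 K)) : ℝ) ^ (-s))

variable {K}

theorem one_le_absNorm (I : (Ideal (𝓞 K))⁰) : (1 : ℝ) ≤ Ideal.absNorm (I : Ideal (𝓞 K)) := by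
  exact_mod_cast Nat.one_le_iff_ne_zero.2
    (Ideal.absNorm_pos_iff_mem_nonZeroDivisors.mpr I.2).ne'

theorem rieszSum_mono : Monotone (rieszSum K) := by
  intro x y hxy
  refine ENNReal.tsum_le_tsum fun I ↦ ?_
  have hI := one_le_absNorm I
  split_ifs with h1 h2
  · refine ENNReal.ofReal_le_ofReal (pow_le_pow_left₀ (Real.log_nonneg ?_) (Real.log_le_log ?_ ?_)
      _)
    · rw [one_le_div (by linarith)]
      exact h1.le
    · exact div_pos (by linarith) (by linarith)
    · gcongr
  · exact absurd (h1.trans_le hxy) h2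
  · exact zero_le
  · exact zero_le

theorem rieszSum_ne_top (x : ℝ) : rieszSum K x ≠ ⊤ := by
  obtain ⟨A, -, h⟩ := exists_rieszSum_bounds K
  refine ne_top_of_le_ne_top ?_ (rieszSum_mono (le_max_left x ((covBound K : ℝ) ^ Module.finrank ℚ
      K)))
  exact ne_top_of_le_ne_top ENNReal.ofReal_ne_top (h _ (le_max_right _ _)).2

theorem log_pow_le_rieszSum {x : ℝ} (hx : 1 < x) :
    ENNReal.ofReal (Real.log x ^ rank K) ≤ rieszSum K x := by
  refine le_trans (le_of_eq ?_) (ENNReal.le_tsum (1 : (Ideal (𝓞 K))⁰))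
  simp [hx]

theorem rieszSum_le_mul_zetaSum {x s : ℝ} (hx : 0 < x) (hs : 1 ≤ s) :
    rieszSum K x ≤ ENNReal.ofReal ((rank K).factorial * x ^ s) * zetaSum K s := by
  rw [rieszSum, zetaSum, ← ENNReal.tsum_mul_left]
  refine ENNReal.tsum_le_tsum fun I ↦ ?_
  have hI := one_le_absNorm I
  set n : ℝ := ((Ideal.absNorm (I : Ideal (𝓞 K)) : ℕ) : ℝ) with hn
  split_ifs with h1
  · rw [← ENNReal.ofReal_mul (by positivity)]
    refine ENNReal.ofReal_le_ofReal ?_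
    have h2 : 1 ≤ x / n := by rw [one_le_div (by linarith)]; exact h1.le
    have h3 := Real.pow_div_factorial_le_exp _ (Real.log_nonneg h2) (rank K)
    rw [Real.exp_log (by linarith), div_le_iff₀ (by positivity)] at h3
    have h4 : x / n ≤ (x / n) ^ s := Real.self_le_rpow_of_one_le h2 hs
    rw [Real.rpow_neg (by linarith), mul_assoc, ← div_eq_mul_inv, ← Real.div_rpow hx.le (by
        linarith)]
    nlinarith [(Nat.cast_pos (α := ℝ)).2 (Nat.factorial_pos (rank K))]
  · exact zero_le

/-- The Laplace transform of the Riesz mean is the Dedekind zeta function. -/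
theorem lintegral_rieszSum {s : ℝ} (hs : 0 < s) :
    ∫⁻ t in Set.Ioi 0, rieszSum K (Real.exp t) * ENNReal.ofReal (Real.exp (-s * t)) =
      ENNReal.ofReal ((rank K).factorial / s ^ (rank K + 1)) * zetaSum K s := by
  set r := rank K with hr
  set G : ℝ → ℝ≥0∞ := (Set.Ioi (0 : ℝ)).indicator
    (fun u ↦ ENNReal.ofReal (u ^ r * Real.exp (-s * u))) with hG
  have hGm : Measurable G := by
    refine Measurable.indicator ?_ measurableSet_Ioi
    fun_prop
  have hGint : ∫⁻ u, G u = ENNReal.ofReal (r.factorial / s ^ (r + 1)) := by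
    have h1 := Real.integral_rpow_mul_exp_neg_mul_Ioi (a := r + 1) (r := s) (by positivity) hs
    have h2 : ∀ t : ℝ, t ^ ((r : ℝ) + 1 - 1) * Real.exp (-(s * t)) = t ^ r * Real.exp (-s * t) := by
      intro t
      rw [add_sub_cancel_right, Real.rpow_natCast, neg_mul]
    simp_rw [h2] at h1
    rw [Real.Gamma_nat_eq_factorial, show ((r : ℝ) + 1) = ((r + 1 : ℕ) : ℝ) by push_cast; rfl,
      Real.rpow_natCast, one_div, inv_pow, ← div_eq_inv_mul] at h1
    have hint : Integrable (fun t ↦ t ^ r * Real.exp (-s * t)) (volume.restrict (Set.Ioi 0)) := by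
      refine Integrable.of_integral_ne_zero ?_
      rw [h1]
      positivity
    rw [hG, lintegral_indicator measurableSet_Ioi, ← ofReal_integral_eq_lintegral_ofReal hint, h1]
    filter_upwards [ae_restrict_mem measurableSet_Ioi] with t ht
    exact mul_nonneg (pow_nonneg (le_of_lt ht) _) (Real.exp_pos _).le
  have : Countable (Ideal (𝓞 K))⁰ := by
    have hc := countable_ringOfIntegers K
    have : Function.Injective fun I : (Ideal (𝓞 K))⁰ ↦
        ((IsNoetherian.noetherian (I : Ideal (𝓞 K))).choose) := by
      intro I I' h
      have e1 := (IsNoetherian.noetherian (I : Ideal (𝓞 K))).choose_spec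
      have e2 := (IsNoetherian.noetherian (I' : Ideal (𝓞 K))).choose_spec
      simp only at h
      exact Subtype.ext (by rw [← e1, h, e2])
    exact this.countable
  have hterm : ∀ I : (Ideal (𝓞 K))⁰, ∀ t ∈ Set.Ioi (0 : ℝ),
      (if (Ideal.absNorm (I : Ideal (𝓞 K)) : ℝ) < Real.exp t then
        ENNReal.ofReal (Real.log (Real.exp t / Ideal.absNorm (I : Ideal (𝓞 K))) ^ r) else 0) *
        ENNReal.ofReal (Real.exp (-s * t)) =
      ENNReal.ofReal ((Ideal.absNorm (I : Ideal (𝓞 K)) : ℝ) ^ (-s)) *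
        G (t - Real.log (Ideal.absNorm (I : Ideal (𝓞 K)))) := by
    intro I t ht
    have hI := one_le_absNorm I
    set n : ℝ := ((Ideal.absNorm (I : Ideal (𝓞 K)) : ℕ) : ℝ) with hn
    have hn0 : 0 < n := by linarith
    have hiff : n < Real.exp t ↔ t - Real.log n ∈ Set.Ioi (0 : ℝ) := by
      rw [Set.mem_Ioi, sub_pos, Real.log_lt_iff_lt_exp hn0]
    rw [hG, Set.indicator_apply]
    by_cases h : n < Real.exp t
    · have h' : 0 < t - Real.log n := hiff.1 h
      rw [if_pos h, if_pos (hiff.1 h), Real.log_div (Real.exp_pos _).ne' hn0.ne', Real.log_exp,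
        ← ENNReal.ofReal_mul (by positivity), ← ENNReal.ofReal_mul (by positivity)]
      congr 1
      rw [Real.rpow_def_of_pos hn0, mul_left_comm, ← Real.exp_add]
      ring_nf
    · rw [if_neg h, if_neg (fun h' ↦ h (hiff.2 h')), zero_mul, mul_zero]
  simp_rw [rieszSum, ← ENNReal.tsum_mul_right]
  rw [setLIntegral_congr_fun measurableSet_Ioi (fun t ht ↦ tsum_congr fun I ↦ hterm I t ht),
    lintegral_tsum, zetaSum, ← ENNReal.tsum_mul_left]
  · refine tsum_congr fun I ↦ ?_
    have hI := one_le_absNorm I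
    set n : ℝ := ((Ideal.absNorm (I : Ideal (𝓞 K)) : ℕ) : ℝ) with hn
    rw [lintegral_const_mul _ (by fun_prop), mul_comm, ← hGint,
      ← lintegral_sub_right_eq_self G (Real.log n)]
    congr 1
    rw [← lintegral_indicator measurableSet_Ioi]
    refine lintegral_congr fun t ↦ ?_
    rw [Set.indicator_apply]
    split_ifs with ht
    · rfl
    · rw [hG, Set.indicator_of_notMem]
      have := Real.log_nonneg hI
      rw [Set.mem_Ioi] at ht ⊢
      linarith
  · intro I
    fun_prop

theorem dedekindZeta_eq_zetaSum {s : ℝ} (hs : s ≠ 0) :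
    dedekindZeta K s = (zetaSum K s).toReal := by
  have hfin : ∀ n : ℕ, Finite {I : (Ideal (𝓞 K))⁰ // Ideal.absNorm (I : Ideal (𝓞 K)) = n} := by
    intro n
    have : Finite {I : Ideal (𝓞 K) // Ideal.absNorm I = n} :=
      (Ideal.finite_setOfPred_absNorm_eq (S := 𝓞 K) n).to_subtype
    exact Finite.of_injective
      (β := {I : Ideal (𝓞 K) // Ideal.absNorm I = n}) (fun I ↦ ⟨I.1.1, I.2⟩) (fun I I' h ↦ by
        have h' := Subtype.ext_iff.1 h
        exact Subtype.ext (Subtype.ext h'))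
  have h1 : zetaSum K s = ∑' n : ℕ, ENNReal.ofReal
      (Nat.card {I : (Ideal (𝓞 K))⁰ // Ideal.absNorm (I : Ideal (𝓞 K)) = n} * (n : ℝ) ^ (-s)) := by
    rw [zetaSum, ← (Equiv.sigmaFiberEquiv
      (fun I : (Ideal (𝓞 K))⁰ ↦ Ideal.absNorm (I : Ideal (𝓞 K)))).tsum_eq, ENNReal.tsum_sigma']
    refine tsum_congr fun n ↦ ?_
    have := Fintype.ofFinite {I : (Ideal (𝓞 K))⁰ // Ideal.absNorm (I : Ideal (𝓞 K)) = n}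
    have h2 : ∀ I : {I : (Ideal (𝓞 K))⁰ // Ideal.absNorm (I : Ideal (𝓞 K)) = n},
        ENNReal.ofReal ((Ideal.absNorm ((Equiv.sigmaFiberEquiv
        (fun I : (Ideal (𝓞 K))⁰ ↦ Ideal.absNorm (I : Ideal (𝓞 K))) ⟨n, I⟩ : (Ideal (𝓞 K))⁰) :
          Ideal (𝓞 K)) : ℝ) ^ (-s)) = ENNReal.ofReal ((n : ℝ) ^ (-s)) := by
      rintro ⟨I, rfl⟩
      rfl
    rw [tsum_congr h2, tsum_fintype, Finset.sum_const, nsmul_eq_mul, Finset.card_univ,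
      ENNReal.ofReal_mul (by positivity), ENNReal.ofReal_natCast, Nat.card_eq_fintype_card]
  rw [h1, ENNReal.tsum_toReal_eq (fun _ ↦ ENNReal.ofReal_ne_top), dedekindZeta, LSeries,
    Complex.ofReal_tsum]
  refine tsum_congr fun n ↦ ?_
  rw [ENNReal.toReal_ofReal (by positivity)]
  rcases Nat.eq_zero_or_pos n with rfl | hn
  · rw [LSeries.term_zero, Nat.cast_zero, Real.zero_rpow (neg_ne_zero.2 hs), mul_zero,
      Complex.ofReal_zero]
  · rw [LSeries.term_of_ne_zero hn.ne', Real.rpow_neg (Nat.cast_nonneg n), Complex.ofReal_mul,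
      Complex.ofReal_inv, Complex.ofReal_cpow (Nat.cast_nonneg n), div_eq_mul_inv]
    congr 1
    norm_cast
    refine Nat.card_congr ⟨fun I ↦ ⟨⟨I.1, ?_⟩, I.2⟩, fun I ↦ ⟨I.1.1, I.2⟩, fun _ ↦ rfl, fun _ ↦ rfl⟩
    rw [← Ideal.absNorm_pos_iff_mem_nonZeroDivisors, I.2]
    exact hn

end ZetaSum

section ZetaContinuation

open NumberField.Units Filter Topology

variable (K : Type*) [Field K] [NumberField K]

theorem eight_le_covBound : 8 ≤ covBound K := by
  have hd := one_le_natAbs_discr K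
  have hN : 1 ≤ Module.finrank ℚ K := Module.finrank_pos
  unfold covBound
  have h1 : 4 ≤ 2 ^ (Module.finrank ℚ K + 1) :=
    le_trans (by norm_num) (Nat.pow_le_pow_right (n := 2) (by norm_num) (by omega : 2 ≤
        Module.finrank ℚ K + 1))
  have h2 : 8 ≤ 2 ^ (Module.finrank ℚ K + 2) :=
    le_trans (by norm_num) (Nat.pow_le_pow_right (n := 2) (by norm_num) (by omega : 3 ≤
        Module.finrank ℚ K + 2))
  have h3 : 2 ≤ ((discr K).natAbs * 2 ^ (Module.finrank ℚ K + 2)) ^ Module.finrank ℚ K := by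
    refine le_trans ?_ (Nat.le_self_pow (by omega) _)
    nlinarith
  calc 8 = 1 * 4 * (1 * 2) := by norm_num
    _ ≤ _ := by gcongr

theorem rank_add_one_le_finrank : rank K + 1 ≤ Module.finrank ℚ K := by
  have h : Fintype.card (InfinitePlace K) ≤ Module.finrank ℚ K := by
    rw [← InfinitePlace.sum_mult_eq (K := K), Fintype.card_eq_sum_ones]
    exact Finset.sum_le_sum fun w _ ↦ InfinitePlace.mult_pos
  have h0 : 0 < Fintype.card (InfinitePlace K) := Fintype.card_pos
  rw [rank]
  omega

/-- The constant, depending only on the degree, in the lower bound for the residue. -/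
noncomputable def residueConst (N : ℕ) : ℝ :=
  Real.exp (-1) / (N * N.factorial * (1 + 2 ^ (2 * N) * (2 * N)))

/-- The continuation of `(s - 1) ζ(s)` to the left of `s = 1`, with the bounds for the residue that
the ideal counting asymptotics provide. -/
theorem exists_zeta_continuation : ∃ ξ : ℝ → ℝ,
    AnalyticOnNhd ℝ ξ (Set.Ioi (1 - 1 / (Module.finrank ℚ K : ℝ))) ∧
    (∀ s, 1 < s → zetaSum K s ≠ ⊤ ∧ ξ s = (s - 1) * (zetaSum K s).toReal) ∧
    ξ 1 = dedekindZeta_residue K ∧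
    (∀ β, 1 - 1 / (2 * Module.finrank ℚ K : ℝ) ≤ β → β < 1 → 0 ≤ ξ β →
      residueConst (Module.finrank ℚ K) * (1 - β) ≤
        dedekindZeta_residue K * (covBound K : ℝ) ^ (Module.finrank ℚ K * (1 - β))) ∧
    ∀ η : ℝ, 0 < η → dedekindZeta_residue K ≤
      2 * (2 * 2 ^ (2 * Module.finrank ℚ K) * (covBound K : ℝ)) ^ (Module.finrank ℚ K * η) *
        (zetaSum K (1 + η)).toReal := by
  obtain ⟨A, hA, hS⟩ := exists_rieszSum_bounds K
  have hr := rank_add_one_le_finrank K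
  set N := Module.finrank ℚ K with hN
  have hN0 : N ≠ 0 := by omega
  have hN1 : (1 : ℝ) ≤ N := by exact_mod_cast Nat.one_le_iff_ne_zero.2 hN0
  set r := rank K with hrdef
  have hD8 : (8 : ℝ) ≤ (covBound K : ℝ) := by exact_mod_cast eight_le_covBound K
  set D : ℝ := ((covBound K : ℕ) : ℝ) with hD
  have hD0 : 0 < D := by linarith
  set T : ℝ → ℝ := fun t ↦ (rieszSum K (Real.exp t)).toReal with hTdef
  have hT : Monotone T := fun a b hab ↦
    ENNReal.toReal_mono (rieszSum_ne_top _) (rieszSum_mono (Real.exp_le_exp.2 hab))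
  have hT0 : ∀ t, 0 ≤ T t := fun t ↦ ENNReal.toReal_nonneg
  have hTr : ∀ t, 0 < t → t ^ r ≤ T t := by
    intro t ht
    have h := log_pow_le_rieszSum (K := K) (x := Real.exp t) (by simpa using ht)
    rw [Real.log_exp, ENNReal.ofReal_le_iff_le_toReal (rieszSum_ne_top _)] at h
    exact h
  set t₁ : ℝ := N * Real.log D with ht₁def
  set δ : ℝ := 1 - 1 / (N : ℝ) with hδ
  have hδ1 : δ < 1 := by rw [hδ]; linarith [show (0 : ℝ) < 1 / N by positivity]
  have hlogD : 1 ≤ Real.log D := by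
    rw [Real.le_log_iff_exp_le hD0]
    linarith [Real.exp_one_lt_d9]
  have ht₁ : 1 ≤ t₁ := by
    rw [ht₁def]; nlinarith
  set B : ℝ := A * (2 ^ (2 * N) * D) with hB
  have hB0 : 0 ≤ B := by positivity
  have hE : ∀ t, t₁ ≤ t → |T t - A * Real.exp t| ≤ B * Real.exp (δ * t) := by
    intro t ht
    have hx : D ^ N ≤ Real.exp t := by
      rw [← Real.exp_log hD0, ← Real.exp_nat_mul]
      exact Real.exp_le_exp.2 ht
    obtain ⟨h1, h2⟩ := hS _ hx
    have hpow : Real.exp t * (D / Real.exp t ^ (1 / (N : ℝ))) = D * Real.exp (δ * t) := by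
      rw [← Real.exp_mul, hδ, sub_mul, one_mul, Real.exp_sub, mul_comm (1 / (N : ℝ)) t]
      ring
    rw [ENNReal.ofReal_le_iff_le_toReal (rieszSum_ne_top _)] at h1
    have h2' := ENNReal.toReal_mono ENNReal.ofReal_ne_top h2
    rw [ENNReal.toReal_ofReal (by positivity)] at h2'
    change _ ≤ T t at h1
    change T t ≤ _ at h2'
    rw [abs_le, hB]
    constructor
    · linear_combination h1 + A * 2 ^ (2 * N) * hpow
    · linear_combination h2' + A * 2 ^ (2 * N) * hpow
  have hfac : (0 : ℝ) < r.factorial := by positivity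
  set ξ : ℝ → ℝ := fun s ↦ s ^ (r + 1) / r.factorial * laplaceCont T A t₁ s with hξdef
  have hξan : AnalyticOnNhd ℝ ξ (Set.Ioi δ) := by
    have h := analyticOnNhd_laplaceCont hT hT0 hB0 hE
    intro s hs
    exact ((analyticAt_id.pow (r + 1)).div_const).mul (h s hs)
  have hξs : ∀ s, 1 < s → zetaSum K s ≠ ⊤ ∧ ξ s = (s - 1) * (zetaSum K s).toReal := by
    intro s hs
    obtain ⟨hint, heq⟩ := laplaceCont_of_one_lt hT (by linarith) hδ1 hE hs
    have hs0 : 0 < s := by linarith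
    have hnn : ∀ t, 0 ≤ T t * Real.exp (-s * t) := fun t ↦ mul_nonneg (hT0 t) (Real.exp_pos _).le
    have h1 := lintegral_rieszSum (K := K) hs0
    have h2 : ∫⁻ t in Set.Ioi (0 : ℝ), rieszSum K (Real.exp t) * ENNReal.ofReal (Real.exp (-s *
        t)) =
        ENNReal.ofReal (∫ t in Set.Ioi (0 : ℝ), T t * Real.exp (-s * t)) := by
      rw [ofReal_integral_eq_lintegral_ofReal hint (Filter.Eventually.of_forall hnn)]
      refine lintegral_congr fun t ↦ ?_
      rw [ENNReal.ofReal_mul (hT0 t), hTdef, ENNReal.ofReal_toReal (rieszSum_ne_top _)]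
    have hc : 0 < (r.factorial : ℝ) / s ^ (r + 1) := by positivity
    have h3 := h1.symm.trans h2
    have hne : zetaSum K s ≠ ⊤ := by
      intro htop
      rw [htop, ENNReal.mul_top (by simpa using hc)] at h3
      exact ENNReal.ofReal_ne_top h3.symm
    refine ⟨hne, ?_⟩
    have h4 := congrArg ENNReal.toReal h3
    rw [ENNReal.toReal_mul, ENNReal.toReal_ofReal hc.le,
      ENNReal.toReal_ofReal (integral_nonneg hnn)] at h4
    rw [hξdef]
    simp only
    rw [heq, ← h4]
    field_simp
  have hξ1 : ξ 1 = A / r.factorial := by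
    rw [hξdef]
    simp only [one_pow, laplaceCont_one]
    ring
  have hres : A / r.factorial = dedekindZeta_residue K := by
    have h1 : Tendsto ξ (𝓝[>] 1) (𝓝 (ξ 1)) :=
      ((hξan 1 hδ1).continuousAt.tendsto).mono_left nhdsWithin_le_nhds
    have h2 := tendsto_sub_one_mul_dedekindZeta_nhdsGT K
    have h3 : Tendsto (fun s : ℝ ↦ ((ξ s : ℝ) : ℂ)) (𝓝[>] 1) (𝓝 ((dedekindZeta_residue K : ℝ) :
        ℂ)) := by
      refine h2.congr' ?_
      filter_upwards [self_mem_nhdsWithin] with s hs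
      have hs' : (1 : ℝ) < s := hs
      rw [dedekindZeta_eq_zetaSum (by linarith), (hξs s hs').2]
      push_cast
      ring
    rw [← hξ1]
    exact_mod_cast tendsto_nhds_unique ((Complex.continuous_ofReal.tendsto _).comp h1) h3
  refine ⟨ξ, hξan, hξs, hξ1.trans hres, ?_, ?_⟩
  · intro β hβ hβ1 hβξ
    have hNinv : 1 / (2 * N : ℝ) ≤ 1 / 2 := by
      apply one_div_le_one_div_of_le <;> linarith
    have hβ0 : 0 < β := by linarith
    have hδβ : 1 / (2 * N : ℝ) ≤ β - δ := by
      have : (1 : ℝ) / N = 1 / (2 * N) + 1 / (2 * N) := by field_simp; norm_num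
      rw [hδ]; linarith
    have hN2 : (0 : ℝ) < 1 / (2 * N : ℝ) := by positivity
    have hpos : 0 ≤ laplaceCont T A t₁ β := by
      refine nonneg_of_mul_nonneg_right (a := β ^ (r + 1) / r.factorial) ?_ (by positivity)
      exact hβξ
    have h := le_of_laplaceCont_nonneg hT hT0 hTr ht₁ hE hβ0.le (by linarith) hβ1 hpos
    have he1 : Real.exp ((1 - β) * t₁) = D ^ (N * (1 - β)) := by
      rw [Real.rpow_def_of_pos hD0, ht₁def]; ring_nf
    have he2 : B * Real.exp ((δ - β) * t₁) = A * 2 ^ (2 * N) * D ^ (N * (1 - β)) := by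
      rw [← he1, hB]
      have : D * Real.exp ((δ - β) * t₁) = Real.exp ((1 - β) * t₁) := by
        rw [show (δ - β) * t₁ = (1 - β) * t₁ - Real.log D by rw [ht₁def, hδ]; field_simp; ring,
          Real.exp_sub, Real.exp_log hD0]
        field_simp
      linear_combination A * 2 ^ (2 * N) * this
    rw [he2, he1] at h
    set P := D ^ (N * (1 - β)) with hP
    have hP0 : 0 < P := by positivity
    have hβ' : 0 < 1 - β := by linarith
    have h5 : A * 2 ^ (2 * N) * P / (β - δ) ≤ A * P * (2 ^ (2 * N) * (2 * N)) / (1 - β) := by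
      rw [div_le_div_iff₀ (by linarith) hβ']
      have : 1 ≤ (2 * N) * (β - δ) := by
        rw [div_le_iff₀ (by positivity)] at hδβ
        linarith
      have hAP : 0 ≤ A * P * 2 ^ (2 * N) := by positivity
      nlinarith [mul_le_mul_of_nonneg_left this hAP, mul_nonneg hAP hβ0.le]
    have h6 : Real.exp (-1) / (r + 1) * (1 - β) ≤ A * P * (1 + 2 ^ (2 * N) * (2 * N)) := by
      rw [← le_div_iff₀ hβ']
      refine h.trans ((add_le_add_right h5 _).trans_eq ?_)
      ring
    have hrN : (r : ℝ) + 1 ≤ N := by exact_mod_cast hr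
    have hrf : (r.factorial : ℝ) ≤ N.factorial := by
      exact_mod_cast Nat.factorial_le (by omega)
    have h7 : Real.exp (-1) / (N * N.factorial) * (1 - β) ≤
        A / r.factorial * P * (1 + 2 ^ (2 * N) * (2 * N)) := by
      calc Real.exp (-1) / (N * N.factorial) * (1 - β)
          ≤ Real.exp (-1) / ((r + 1) * r.factorial) * (1 - β) := by gcongr
        _ = Real.exp (-1) / (r + 1) * (1 - β) / r.factorial := by field_simp
        _ ≤ A * P * (1 + 2 ^ (2 * N) * (2 * N)) / r.factorial := by gcongr
        _ = _ := by ring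
    rw [← hres, residueConst]
    have hc : (0 : ℝ) < 1 + 2 ^ (2 * N) * (2 * N) := by positivity
    rw [← div_div, div_mul_eq_mul_div, div_le_iff₀ hc]
    exact h7
  · intro η hη
    obtain ⟨hfin, -⟩ := hξs (1 + η) (by linarith)
    set Y : ℝ := 2 * 2 ^ (2 * N) * D with hY
    have h1p : (1 : ℝ) ≤ 2 * 2 ^ (2 * N) := by
      have := one_le_pow₀ (M₀ := ℝ) (a := 2) (by norm_num) (n := 2 * N)
      linarith
    have hYD : D ≤ Y := by rw [hY]; nlinarith
    have hY0 : 0 < Y := by positivity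
    have hx : D ^ N ≤ Y ^ N := by gcongr
    obtain ⟨h1, -⟩ := hS _ hx
    have hroot : (Y ^ N) ^ (1 / (N : ℝ)) = Y := by
      rw [one_div, Real.pow_rpow_inv_natCast hY0.le hN0]
    have hhalf : 1 - 2 ^ (2 * N) * (D / Y) = 1 / 2 := by
      rw [hY]; field_simp; norm_num
    rw [hroot, hhalf] at h1
    have h2 := h1.trans (rieszSum_le_mul_zetaSum (K := K) (by positivity) (by linarith : 1 ≤ 1 + η))
    rw [ENNReal.ofReal_le_iff_le_toReal (ENNReal.mul_ne_top ENNReal.ofReal_ne_top hfin),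
      ENNReal.toReal_mul, ENNReal.toReal_ofReal (by positivity)] at h2
    have h3 : (Y ^ N) ^ (1 + η) = Y ^ N * Y ^ (N * η) := by
      rw [Real.rpow_add (by positivity), Real.rpow_one, ← Real.rpow_natCast Y N, ← Real.rpow_mul
          hY0.le]
    rw [h3] at h2
    have hYN : 0 < Y ^ N := by positivity
    rw [← hres, div_le_iff₀ hfac]
    refine le_of_mul_le_mul_left ?_ hYN
    linear_combination 2 * h2

end ZetaContinuation

section EulerProduct

open IsDedekindDomain Filter Topology

variable {R : Type*} [CommRing R] [IsDedekindDomain R]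

theorem tsum_mul_prod_one_sub (g : Ideal R →*₀ ℝ) (hg : Summable g)
    (T : Finset (HeightOneSpectrum R)) :
    (∑' I, g I) * ∏ P ∈ T, (1 - g P.asIdeal) =
      ∑' I, {I : Ideal R | ∀ P ∈ T, ¬ P.asIdeal ∣ I}.indicator g I := by
  induction T using Finset.induction_on with
  | empty => simp
  | insert Q T hQ ih =>
    rw [Finset.prod_insert hQ, mul_left_comm, ih]
    have hQ0 : Q.asIdeal ≠ 0 := Q.ne_bot
    have hinj : Function.Injective (fun I : Ideal R ↦ Q.asIdeal * I) :=
      fun a b hab ↦ mul_left_cancel₀ hQ0 hab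
    have h1 : g Q.asIdeal * ∑' I, {I : Ideal R | ∀ P ∈ T, ¬ P.asIdeal ∣ I}.indicator g I =
        ∑' I, {I : Ideal R | Q.asIdeal ∣ I ∧ ∀ P ∈ T, ¬ P.asIdeal ∣ I}.indicator g I := by
      rw [← tsum_mul_left]
      refine Eq.trans ?_ (hinj.tsum_eq (f := {I : Ideal R | Q.asIdeal ∣ I ∧
        ∀ P ∈ T, ¬ P.asIdeal ∣ I}.indicator g) ?_)
      · refine tsum_congr fun I ↦ ?_
        rw [Set.indicator_apply, Set.indicator_apply, mul_ite, mul_zero, map_mul]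
        refine if_congr ?_ rfl rfl
        simp only [Set.mem_ofPred_eq, dvd_mul_right, true_and]
        refine forall₂_congr fun P hP ↦ not_congr ?_
        rw [P.prime.dvd_mul, or_iff_right]
        intro hdvd
        refine hQ ?_
        have : P = Q := HeightOneSpectrum.ext <| by
          have := (prime_dvd_prime_iff_eq P.prime Q.prime).1 hdvd
          exact this
        rwa [← this]
      · intro I hI
        rw [Function.mem_support, Set.indicator_apply] at hI
        have : Q.asIdeal ∣ I := by
          by_contra h
          exact hI (if_neg fun h' ↦ h h'.1)
        obtain ⟨J, rfl⟩ := this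
        exact ⟨J, rfl⟩
    rw [sub_mul, one_mul, h1, ← (hg.indicator _).tsum_sub (hg.indicator _)]
    refine tsum_congr fun I ↦ ?_
    simp only [Set.indicator_apply, Set.mem_ofPred_eq, Finset.forall_mem_insert]
    by_cases h2 : Q.asIdeal ∣ I <;> by_cases h3 : ∀ P ∈ T, ¬ P.asIdeal ∣ I <;> simp [h2, h3]

theorem hasProd_one_sub_of_summable (g : Ideal R →*₀ ℝ) (hg : Summable g) (hg0 : ∀ I, 0 ≤ g I) :
    HasProd (fun P : HeightOneSpectrum R ↦ 1 - g P.asIdeal) (∑' I, g I)⁻¹ := by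
  have hZ : 0 < ∑' I, g I := hg.tsum_pos hg0 1 (by rw [map_one]; exact one_pos)
  have h1 : Tendsto (fun T : Finset (HeightOneSpectrum R) ↦
      ∑' I, {I : Ideal R | ∀ P ∈ T, ¬ P.asIdeal ∣ I}.indicator g I) atTop
      (𝓝 (∑' I, ({1} : Set (Ideal R)).indicator g I)) := by
    refine tendsto_tsum_of_dominated_convergence hg ?_ ?_
    · intro I
      refine tendsto_const_nhds.congr' ?_
      by_cases hI0 : I = 0
      · filter_upwards with T
        simp only [Set.indicator_apply, hI0, map_zero, ite_self]
      by_cases hI : I = 1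
      · filter_upwards with T
        have : (1 : Ideal R) ∈ {I : Ideal R | ∀ P ∈ T, ¬ P.asIdeal ∣ I} := fun P _ h ↦
          P.prime.not_isUnit (isUnit_of_dvd_one h)
        rw [hI, Set.indicator_of_mem this,
          Set.indicator_of_mem (Set.mem_singleton _)]
      · obtain ⟨P, hP, hle⟩ := Ideal.exists_le_maximal I (by rwa [← Ideal.one_eq_top])
        have hPb : P ≠ ⊥ := fun h ↦ hI0 (le_bot_iff.1 (h ▸ hle))
        filter_upwards [eventually_ge_atTop ({⟨P, hP.isPrime, hPb⟩} : Finset (HeightOneSpectrum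
            R))] with T hT
        have : I ∉ {I : Ideal R | ∀ P ∈ T, ¬ P.asIdeal ∣ I} := fun h ↦
          h ⟨P, hP.isPrime, hPb⟩ (hT (Finset.mem_singleton_self _)) (Ideal.dvd_iff_le.2 hle)
        rw [Set.indicator_of_notMem this, Set.indicator_of_notMem (by exact hI)]
    · filter_upwards with T I
      rw [Real.norm_of_nonneg (Set.indicator_nonneg (fun _ _ ↦ hg0 _) _)]
      exact Set.indicator_le_self' (fun _ _ ↦ hg0 _) _
  have h2 : ∑' I, ({1} : Set (Ideal R)).indicator g I = 1 := by
    rw [tsum_eq_single 1 fun I hI ↦ Set.indicator_of_notMem (by exact hI) _,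
      Set.indicator_of_mem (Set.mem_singleton _), map_one]
  rw [h2] at h1
  simp_rw [← tsum_mul_prod_one_sub g hg] at h1
  have h3 := h1.const_mul (∑' I, g I)⁻¹
  rw [mul_one] at h3
  rw [HasProd, SummationFilter.unconditional_filter]
  refine h3.congr fun T ↦ ?_
  rw [← mul_assoc, inv_mul_cancel₀ hZ.ne', one_mul]

end EulerProduct

section ZetaEuler

open IsDedekindDomain

variable (K : Type*) [Field K] [NumberField K]

/-- The function `I ↦ N(I)⁻ˢ` on ideals. -/
noncomputable def normPow (s : ℝ) (hs : s ≠ 0) : Ideal (𝓞 K) →*₀ ℝ where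
  toFun I := (Ideal.absNorm I : ℝ) ^ (-s)
  map_zero' := by simp [Real.zero_rpow (neg_ne_zero.2 hs)]
  map_one' := by simp
  map_mul' I J := by
    rw [map_mul, Nat.cast_mul, Real.mul_rpow (Nat.cast_nonneg _) (Nat.cast_nonneg _)]

variable {K}

theorem tsum_ofReal_normPow {s : ℝ} (hs : s ≠ 0) :
    ∑' I, ENNReal.ofReal (normPow K s hs I) = zetaSum K s := by
  rw [zetaSum]
  symm
  refine Function.Injective.tsum_eq (f := fun I ↦ ENNReal.ofReal (normPow K s hs I))
      Subtype.val_injective (fun I hI ↦ ?_)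
  rw [Subtype.range_coe]
  refine mem_nonZeroDivisors_of_ne_zero fun h ↦ hI ?_
  change ENNReal.ofReal (normPow K s hs I) = 0
  rw [h, map_zero, ENNReal.ofReal_zero]

theorem summable_normPow {s : ℝ} (hs : s ≠ 0) (h : zetaSum K s ≠ ⊤) : Summable (normPow K s hs) :=
    by
  rw [← tsum_ofReal_normPow hs] at h
  have := ENNReal.summable_toReal h
  refine this.congr fun I ↦ ?_
  rw [ENNReal.toReal_ofReal]
  exact Real.rpow_nonneg (Nat.cast_nonneg _) _

theorem tsum_normPow {s : ℝ} (hs : s ≠ 0) (h : zetaSum K s ≠ ⊤) :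
    ∑' I, normPow K s hs I = (zetaSum K s).toReal := by
  have h0 : ∀ I, 0 ≤ normPow K s hs I := fun I ↦ Real.rpow_nonneg (Nat.cast_nonneg _) _
  rw [← tsum_ofReal_normPow hs, ← ENNReal.ofReal_tsum_of_nonneg h0 (summable_normPow hs h),
    ENNReal.toReal_ofReal (tsum_nonneg h0)]

variable (K) in
theorem zetaSum_ne_top {s : ℝ} (hs : 1 < s) : zetaSum K s ≠ ⊤ := by
  obtain ⟨ξ, -, h, -⟩ := exists_zeta_continuation K
  exact (h s hs).1

variable (K) in
theorem hasProd_zetaSum {s : ℝ} (hs : 1 < s) :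
    HasProd (fun P : HeightOneSpectrum (𝓞 K) ↦ 1 - (Ideal.absNorm P.asIdeal : ℝ) ^ (-s))
      (zetaSum K s).toReal⁻¹ := by
  have hs0 : s ≠ 0 := by linarith
  rw [← tsum_normPow hs0 (zetaSum_ne_top K hs)]
  exact hasProd_one_sub_of_summable (normPow K s hs0) (summable_normPow hs0 (zetaSum_ne_top K hs))
    fun I ↦ Real.rpow_nonneg (Nat.cast_nonneg _) _

variable (K) in
theorem zetaSum_toReal_pos {s : ℝ} (hs : 1 < s) : 0 < (zetaSum K s).toReal := by
  have hs0 : s ≠ 0 := by linarith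
  have h := zetaSum_ne_top K hs
  rw [← tsum_normPow hs0 h]
  exact (summable_normPow hs0 h).tsum_pos (fun I ↦ Real.rpow_nonneg (Nat.cast_nonneg _) _) 1
    (by rw [map_one]; exact one_pos)

end ZetaEuler

section EulerFactor

open IsDedekindDomain (HeightOneSpectrum)

variable (k K : Type*) [Field k] [NumberField k] [Field K] [NumberField K] [Algebra k K]

/-- The Euler factor at a prime `p` of the base field. -/
noncomputable def eulerFactor (p : Ideal (𝓞 k)) (s : ℝ) : ℝ :=
  ∏ P ∈ IsDedekindDomain.primesOverFinset p (𝓞 K), (1 - (Ideal.absNorm P : ℝ) ^ (-s))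

theorem hasProd_eulerFactor {s : ℝ} (hs : 1 < s) :
    HasProd (fun p : HeightOneSpectrum (𝓞 k) ↦ eulerFactor k K p.asIdeal s)
      (zetaSum K s).toReal⁻¹ := by
  have hmem : ∀ (p : HeightOneSpectrum (𝓞 k)) (P : IsDedekindDomain.primesOverFinset p.asIdeal (𝓞
      K)),
      P.1.IsPrime ∧ P.1.LiesOver p.asIdeal := fun p P ↦
    (IsDedekindDomain.mem_primesOverFinset_iff p.ne_bot _).1 P.2
  let f : (Σ p : HeightOneSpectrum (𝓞 k), IsDedekindDomain.primesOverFinset p.asIdeal (𝓞 K)) →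
      HeightOneSpectrum (𝓞 K) := fun x ↦
    ⟨x.2.1, (hmem x.1 x.2).1, fun h ↦ x.1.ne_bot <| by
      rw [(hmem x.1 x.2).2.over, h, Ideal.under_bot]⟩
  have hf : Function.Bijective f := by
    constructor
    · rintro ⟨p, P, hP⟩ ⟨q, Q, hQ⟩ h
      have h' := congrArg HeightOneSpectrum.asIdeal h
      change P = Q at h'
      subst h'
      have : p = q := HeightOneSpectrum.ext <| by
        rw [(hmem p ⟨P, hP⟩).2.over, (hmem q ⟨P, hQ⟩).2.over]
      subst this
      rfl
    · intro P
      have hb : P.asIdeal.under (𝓞 k) ≠ ⊥ := mt Ideal.eq_bot_of_comap_eq_bot P.ne_bot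
      refine ⟨⟨⟨P.asIdeal.under (𝓞 k), inferInstance, hb⟩, P.asIdeal, ?_⟩, rfl⟩
      exact (IsDedekindDomain.mem_primesOverFinset_iff hb _).2 ⟨P.isPrime, ⟨rfl⟩⟩
  have h := (Equiv.ofBijective f hf).hasProd_iff.2 (hasProd_zetaSum K hs)
  exact h.sigma fun p ↦ Finset.hasProd _ (fun P ↦ 1 - (Ideal.absNorm P : ℝ) ^ (-s))

theorem absNorm_rpow_mem_Ioo (P : HeightOneSpectrum (𝓞 K)) {s : ℝ} (hs : 0 < s) :
    (Ideal.absNorm P.asIdeal : ℝ) ^ (-s) ∈ Set.Ioo 0 1 := by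
  have h1 : 1 < Ideal.absNorm P.asIdeal := by
    have h0 : Ideal.absNorm P.asIdeal ≠ 0 := fun h ↦ P.ne_bot (Ideal.absNorm_eq_zero_iff.1 h)
    have h1 : Ideal.absNorm P.asIdeal ≠ 1 := fun h ↦
      P.isPrime.ne_top (Ideal.absNorm_eq_one_iff.1 h)
    omega
  have h2 : (1 : ℝ) < Ideal.absNorm P.asIdeal := by exact_mod_cast h1
  exact ⟨by positivity, Real.rpow_lt_one_of_one_lt_of_neg h2 (by linarith)⟩

variable {k} in
theorem absNorm_rpow_of_liesOver (p : HeightOneSpectrum (𝓞 k)) (P : Ideal (𝓞 K)) [P.IsPrime]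
    [P.LiesOver p.asIdeal] (s : ℝ) :
    (Ideal.absNorm P : ℝ) ^ (-s) = ((Ideal.absNorm p.asIdeal : ℝ) ^ (-s)) ^ P.inertiaDeg (𝓞 k) := by
  have : p.asIdeal.IsMaximal := p.isMaximal
  have : P.IsMaximal := Ideal.IsMaximal.of_liesOver_isMaximal P p.asIdeal
  rw [Ideal.absNorm_eq_pow_inertiaDeg'_of_liesOver P p.asIdeal p.isPrime p.ne_bot,
    Ideal.inertiaDeg'_eq_inertiaDeg, Nat.cast_pow, ← Real.rpow_natCast, ← Real.rpow_natCast,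
    ← Real.rpow_mul (by positivity), ← Real.rpow_mul (by positivity), mul_comm]

variable {k}

theorem eulerFactor_of_isGalois [IsGalois k K] (p : HeightOneSpectrum (𝓞 k)) (s : ℝ) :
    eulerFactor k K p.asIdeal s =
      (1 - ((Ideal.absNorm p.asIdeal : ℝ) ^ (-s)) ^ p.asIdeal.inertiaDegIn (𝓞 K)) ^
        (p.asIdeal.primesOver (𝓞 K)).ncard := by
  rw [eulerFactor, ← IsDedekindDomain.coe_primesOverFinset p.ne_bot, Set.ncard_coe_finset]
  refine Finset.prod_eq_pow_card fun P hP ↦ ?_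
  obtain ⟨h1, h2⟩ := (IsDedekindDomain.mem_primesOverFinset_iff p.ne_bot _).1 hP
  rw [absNorm_rpow_of_liesOver K p P, Ideal.inertiaDegIn_eq_inertiaDeg p.asIdeal P Gal(K/k)]

variable (k) in
theorem card_primesOverFinset_le (p : HeightOneSpectrum (𝓞 k)) :
    (IsDedekindDomain.primesOverFinset p.asIdeal (𝓞 K)).card ≤ Module.finrank k K := by
  have : Finite (p.asIdeal.primesOver (𝓞 K)) := (Algebra.QuasiFinite.finite_primesOver p.asIdeal)
  have := Fintype.ofFinite (p.asIdeal.primesOver (𝓞 K))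
  rw [IsFractionRing.finrank_eq (𝓞 k) k (𝓞 K) K,
    ← Ideal.sum_ramification_inertia_eq_finrank p.asIdeal, ← Set.ncard_coe_finset,
    IsDedekindDomain.coe_primesOverFinset p.ne_bot, ← Set.fintypeCard_eq_ncard, ← Finset.card_univ,
    Finset.card_eq_sum_ones]
  refine Finset.sum_le_sum fun P _ ↦ ?_
  have h1 := P.1.ramificationIdx_pos (𝓞 k)
  have h2 := P.1.inertiaDeg_pos (𝓞 k)
  nlinarith

theorem pow_finrank_le_eulerFactor (p : HeightOneSpectrum (𝓞 k)) {s : ℝ} (hs : 0 < s) :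
    (1 - (Ideal.absNorm p.asIdeal : ℝ) ^ (-s)) ^ Module.finrank k K ≤
      eulerFactor k K p.asIdeal s := by
  have hx := absNorm_rpow_mem_Ioo k p hs
  set x := (Ideal.absNorm p.asIdeal : ℝ) ^ (-s)
  have : p.asIdeal.IsMaximal := p.isMaximal
  calc (1 - x) ^ Module.finrank k K
      ≤ (1 - x) ^ (IsDedekindDomain.primesOverFinset p.asIdeal (𝓞 K)).card :=
        pow_le_pow_of_le_one (by linarith [hx.2]) (by linarith [hx.1])
          (card_primesOverFinset_le k K p)
    _ = ∏ P ∈ IsDedekindDomain.primesOverFinset p.asIdeal (𝓞 K), (1 - x) := (Finset.prod_const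
        _).symm
    _ ≤ _ := by
        refine Finset.prod_le_prod (fun _ _ ↦ by linarith [hx.2]) fun P hP ↦ ?_
        obtain ⟨h1, h2⟩ := (IsDedekindDomain.mem_primesOverFinset_iff p.ne_bot _).1 hP
        rw [absNorm_rpow_of_liesOver K p P]
        have := pow_le_of_le_one hx.1.le hx.2.le (P.inertiaDeg_pos (𝓞 k)).ne'
        linarith

variable (k) in
theorem zetaSum_le_pow {s : ℝ} (hs : 1 < s) :
    (zetaSum K s).toReal ≤ (zetaSum k s).toReal ^ Module.finrank k K := by
  have h1 := hasProd_eulerFactor k K hs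
  have h2 : Filter.Tendsto (fun T : Finset (HeightOneSpectrum (𝓞 k)) ↦
      (∏ p ∈ T, (1 - (Ideal.absNorm p.asIdeal : ℝ) ^ (-s))) ^ Module.finrank k K) Filter.atTop
      (nhds ((zetaSum k s).toReal⁻¹ ^ Module.finrank k K)) := by
    have := hasProd_zetaSum k hs
    rw [HasProd, SummationFilter.unconditional_filter] at this
    exact this.pow _
  rw [HasProd, SummationFilter.unconditional_filter] at h1
  have h3 := le_of_tendsto_of_tendsto' h2 h1 fun T ↦ by
    rw [← Finset.prod_pow]
    refine Finset.prod_le_prod (fun p _ ↦ ?_) fun p _ ↦ pow_finrank_le_eulerFactor K p (by linarith)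
    exact pow_nonneg (by linarith [(absNorm_rpow_mem_Ioo k p (by linarith : 0 < s)).2]) _
  rw [inv_pow] at h3
  exact (inv_le_inv₀ (pow_pos (zetaSum_toReal_pos k hs) _) (zetaSum_toReal_pos K hs)).1 h3

end EulerFactor

theorem biquadratic_euler_identity {e f g e₁ f₁ g₁ e₂ f₂ g₂ e₃ f₃ g₃ a₁ a₂ a₃ b₁ b₂ b₃ : ℕ}
    (h : g * (e * f) = 4) (hne : e ≠ 1 ∨ f ≠ 4)
    (h₁ : g₁ * (e₁ * f₁) = 2) (h₂ : g₂ * (e₂ * f₂) = 2) (h₃ : g₃ * (e₃ * f₃) = 2)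
    (ha₁ : e₁ * a₁ = e) (ha₂ : e₂ * a₂ = e) (ha₃ : e₃ * a₃ = e)
    (hb₁ : f₁ * b₁ = f) (hb₂ : f₂ * b₂ = f) (hb₃ : f₃ * b₃ = f)
    (ha : a₁ + a₂ + a₃ = e + 2) (hc : a₁ * b₁ + a₂ * b₂ + a₃ * b₃ = e * f + 2) (x : ℝ) :
    (1 - x ^ f₁) ^ g₁ * (1 - x ^ f₂) ^ g₂ * (1 - x ^ f₃) ^ g₃ = (1 - x ^ f) ^ g * (1 - x) ^ 2 := by
  have key : ∀ {u v w : ℕ}, u * (v * w) = 2 →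
      (u = 2 ∧ v = 1 ∧ w = 1) ∨ (u = 1 ∧ v = 2 ∧ w = 1) ∨ (u = 1 ∧ v = 1 ∧ w = 2) := by
    intro u v w h
    have hu : u ≤ 2 := Nat.le_of_dvd two_pos ⟨_, h.symm⟩
    have hv : v ≤ 2 := Nat.le_of_dvd two_pos ⟨u * w, by rw [← h]; ring⟩
    have hw : w ≤ 2 := Nat.le_of_dvd two_pos ⟨u * v, by rw [← h]; ring⟩
    interval_cases u <;> interval_cases v <;> interval_cases w <;> simp_all
  have key' : (e = 1 ∧ f = 1 ∧ g = 4) ∨ (e = 1 ∧ f = 2 ∧ g = 2) ∨ (e = 2 ∧ f = 1 ∧ g = 2) ∨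
      (e = 2 ∧ f = 2 ∧ g = 1) ∨ (e = 4 ∧ f = 1 ∧ g = 1) := by
    have hu : e ≤ 4 := Nat.le_of_dvd four_pos ⟨g * f, by rw [← h]; ring⟩
    have hv : f ≤ 4 := Nat.le_of_dvd four_pos ⟨g * e, by rw [← h]; ring⟩
    interval_cases e <;> interval_cases f <;> omega
  rcases key h₁ with ⟨rfl, rfl, rfl⟩ | ⟨rfl, rfl, rfl⟩ | ⟨rfl, rfl, rfl⟩ <;>
  rcases key h₂ with ⟨rfl, rfl, rfl⟩ | ⟨rfl, rfl, rfl⟩ | ⟨rfl, rfl, rfl⟩ <;>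
  rcases key h₃ with ⟨rfl, rfl, rfl⟩ | ⟨rfl, rfl, rfl⟩ | ⟨rfl, rfl, rfl⟩ <;>
  rcases key' with ⟨rfl, rfl, rfl⟩ | ⟨rfl, rfl, rfl⟩ | ⟨rfl, rfl, rfl⟩ | ⟨rfl, rfl, rfl⟩ |
    ⟨rfl, rfl, rfl⟩ <;>
  first
  | omega
  | ring1
  | (exfalso
     obtain rfl | rfl : b₁ = 1 ∨ b₁ = 2 := by omega
     all_goals obtain rfl | rfl : b₂ = 1 ∨ b₂ = 2 := by omega
     all_goals obtain rfl | rfl : b₃ = 1 ∨ b₃ = 2 := by omega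
     all_goals omega)

theorem exists_of_card_subgroup_eq_two {G : Type*} [Group G] {H : Subgroup G}
    (hH : Nat.card H = 2) : ∃ x : G, x ≠ 1 ∧ x ^ 2 = 1 ∧ ∀ y, y ∈ H ↔ y = 1 ∨ y = x := by
  obtain ⟨a, b, hab, hu⟩ := Nat.card_eq_two_iff.1 hH
  have : ∃ x : H, x ≠ 1 ∧ ∀ y : H, y = 1 ∨ y = x := by
    have hu' : ∀ y : H, y = a ∨ y = b := fun y ↦ by
      have : y ∈ ({a, b} : Set H) := hu ▸ Set.mem_univ y
      simpa using this
    rcases hu' 1 with h | h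
    · exact ⟨b, by rw [h]; exact hab.symm, fun y ↦ by rw [h]; exact hu' y⟩
    · exact ⟨a, by rw [h]; exact hab, fun y ↦ by rw [h]; exact (hu' y).symm⟩
  obtain ⟨x, hx, hx'⟩ := this
  refine ⟨x, fun h ↦ hx (Subtype.ext h), ?_, fun y ↦ ⟨fun hy ↦ ?_, ?_⟩⟩
  · have := pow_card_eq_one' (x := x)
    rw [hH] at this
    exact_mod_cast congrArg Subtype.val this
  · rcases hx' ⟨y, hy⟩ with h | h
    · exact Or.inl (congrArg Subtype.val h)
    · exact Or.inr (congrArg Subtype.val h)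
  · rintro (rfl | rfl)
    exacts [H.one_mem, x.2]

theorem sum_card_subgroupOf {G : Type*} [Group G] (hG : Nat.card G = 4) {H₁ H₂ H₃ : Subgroup G}
    (h₁ : Nat.card H₁ = 2) (h₂ : Nat.card H₂ = 2) (h₃ : Nat.card H₃ = 2)
    (h₁₂ : H₁ ≠ H₂) (h₁₃ : H₁ ≠ H₃) (h₂₃ : H₂ ≠ H₃) :
    (∀ x : G, x ^ 2 = 1) ∧ ∀ J : Subgroup G, Nat.card (J.subgroupOf H₁) + Nat.card (J.subgroupOf
        H₂) +
      Nat.card (J.subgroupOf H₃) = Nat.card J + 2 := by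
  obtain ⟨x₁, hx₁, hp₁, hm₁⟩ := exists_of_card_subgroup_eq_two h₁
  obtain ⟨x₂, hx₂, hp₂, hm₂⟩ := exists_of_card_subgroup_eq_two h₂
  obtain ⟨x₃, hx₃, hp₃, hm₃⟩ := exists_of_card_subgroup_eq_two h₃
  have n₁₂ : x₁ ≠ x₂ := fun h ↦ h₁₂ (Subgroup.ext fun y ↦ by rw [hm₁, hm₂, h])
  have n₁₃ : x₁ ≠ x₃ := fun h ↦ h₁₃ (Subgroup.ext fun y ↦ by rw [hm₁, hm₃, h])
  have n₂₃ : x₂ ≠ x₃ := fun h ↦ h₂₃ (Subgroup.ext fun y ↦ by rw [hm₂, hm₃, h])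
  have : Finite G := Nat.finite_of_card_ne_zero (by omega)
  have : Fintype G := Fintype.ofFinite G
  have huniv : (Finset.univ : Finset G) = {1, x₁, x₂, x₃} := by
    symm
    apply Finset.eq_univ_of_card
    rw [← Nat.card_eq_fintype_card, hG]
    rw [Finset.card_insert_of_notMem, Finset.card_insert_of_notMem, Finset.card_insert_of_notMem,
      Finset.card_singleton] <;> simp [hx₁.symm, hx₂.symm, hx₃.symm, n₁₂, n₁₃, n₂₃]
  refine ⟨fun x ↦ ?_, fun J ↦ ?_⟩
  · have : x ∈ (Finset.univ : Finset G) := Finset.mem_univ x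
    rw [huniv] at this
    simp only [Finset.mem_insert, Finset.mem_singleton] at this
    rcases this with rfl | rfl | rfl | rfl <;> simp [hp₁, hp₂, hp₃]
  · have hcard : ∀ S : Subgroup G, Nat.card S = ∑ x : G, if x ∈ S then 1 else 0 := fun S ↦ by
      rw [Finset.sum_boole, Nat.card_eq_fintype_card, Fintype.card_subtype]; simp
    have hsub : ∀ H : Subgroup G, Nat.card (J.subgroupOf H) = Nat.card (J ⊓ H : Subgroup G) := by
      intro H
      rw [← Subgroup.inf_subgroupOf_right]
      exact Nat.card_congr (Subgroup.subgroupOfEquivOfLe inf_le_right).toEquiv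
    rw [hsub, hsub, hsub, hcard, hcard, hcard, hcard, huniv]
    rw [Finset.sum_insert, Finset.sum_insert, Finset.sum_insert, Finset.sum_singleton,
      Finset.sum_insert, Finset.sum_insert, Finset.sum_insert, Finset.sum_singleton,
      Finset.sum_insert, Finset.sum_insert, Finset.sum_insert, Finset.sum_singleton,
      Finset.sum_insert, Finset.sum_insert, Finset.sum_insert, Finset.sum_singleton] <;>
    simp [hx₁.symm, hx₂.symm, hx₃.symm, n₁₂, n₁₃, n₂₃, hm₁, hm₂, hm₃, hx₁, hx₂, hx₃, J.one_mem,
      n₁₂.symm, n₁₃.symm, n₂₃.symm]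
    omega

section BrauerRelation

open scoped Pointwise
open IsDedekindDomain (HeightOneSpectrum)

variable {k M : Type*} [Field k] [NumberField k] [Field M] [NumberField M] [Algebra k M]

theorem local_data_of_intermediateField [IsGalois k M] (p : HeightOneSpectrum (𝓞 k)) (Q : Ideal (𝓞
    M))
    [Q.IsPrime] [Q.LiesOver p.asIdeal] (K : IntermediateField k M) [IsGalois k K] :
    ∃ a b : ℕ, 
      (p.asIdeal.primesOver (𝓞 K)).ncard * (p.asIdeal.ramificationIdxIn (𝓞 K) *
        p.asIdeal.inertiaDegIn (𝓞 K)) = Module.finrank k K ∧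
      p.asIdeal.ramificationIdxIn (𝓞 K) * a = p.asIdeal.ramificationIdxIn (𝓞 M) ∧
      p.asIdeal.inertiaDegIn (𝓞 K) * b = p.asIdeal.inertiaDegIn (𝓞 M) ∧
      Nat.card ((Q.inertia Gal(M/k)).subgroupOf K.fixingSubgroup) = a ∧
      Nat.card ((MulAction.stabilizer Gal(M/k) Q).subgroupOf K.fixingSubgroup) = a * b := by
  have hQ : Q ≠ ⊥ := fun h ↦ p.ne_bot <| by
    rw [Q.over_def p.asIdeal, h, Ideal.under_bot]
  let q : Ideal (𝓞 K) := Q.under (𝓞 K)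
  have : q.IsPrime := Ideal.IsPrime.under _ Q
  have : Q.LiesOver q := ⟨rfl⟩
  have : q.LiesOver p.asIdeal := Ideal.LiesOver.tower_bot Q q p.asIdeal
  have hne : Nonempty (q.primesOver (𝓞 M)) := ⟨⟨Q, inferInstance, inferInstance⟩⟩
  have i0 : IsGaloisGroup K.fixingSubgroup K M :=
    IsGaloisGroup.intermediateField Gal(M/k) k M K
  have i1 : IsGaloisGroup K.fixingSubgroup (𝓞 K) (𝓞 M) :=
    IsGaloisGroup.of_isFractionRing K.fixingSubgroup (𝓞 K) (𝓞 M) K M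
  refine ⟨q.ramificationIdxIn (𝓞 M), q.inertiaDegIn (𝓞 M), ?_, ?_, ?_, ?_, ?_⟩
  · rw [Ideal.ncard_primesOver_mul_ramificationIdxIn_mul_inertiaDegIn p.asIdeal (𝓞 K) Gal(K/k),
      IsGalois.card_aut_eq_finrank]
  · exact Ideal.ramificationIdxIn_mul_ramificationIdxIn q Gal(K/k) (𝓞 M) Gal(M/k) K.fixingSubgroup
  · exact Ideal.inertiaDegIn_mul_inertiaDegIn p.asIdeal q Gal(K/k) (𝓞 M) Gal(M/k) K.fixingSubgroup
  · exact Ideal.card_inertia_eq_ramificationIdxIn (G := K.fixingSubgroup) q Q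
  · have := Ideal.card_stabilizer_eq (G := K.fixingSubgroup) q Q
    rw [← this]
    rfl

attribute [local instance] Ideal.Quotient.field in
theorem ramificationIdxIn_ne_one_or_inertiaDegIn_ne_four [IsGalois k M]
    (p : HeightOneSpectrum (𝓞 k)) (Q : Ideal (𝓞 M)) [Q.IsPrime] [Q.LiesOver p.asIdeal]
    (hG : ∀ x : Gal(M/k), x ^ 2 = 1) :
    p.asIdeal.ramificationIdxIn (𝓞 M) ≠ 1 ∨ p.asIdeal.inertiaDegIn (𝓞 M) ≠ 4 := by
  by_contra! h
  have hQ : Q ≠ ⊥ := fun h ↦ p.ne_bot <| by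
    rw [Q.over_def p.asIdeal, h, Ideal.under_bot]
  have : Q.IsMaximal := Ring.DimensionLEOne.maximalOfPrime hQ inferInstance
  have : p.asIdeal.IsMaximal := p.isMaximal
  have : Finite (𝓞 M ⧸ Q) := Ideal.finiteQuotientOfFreeOfNeBot Q hQ
  have hst := Ideal.card_stabilizer_eq (G := Gal(M/k)) p.asIdeal Q
  have hin := Ideal.card_inertia_eq_ramificationIdxIn (G := Gal(M/k)) p.asIdeal Q
  rw [h.1, h.2] at hst
  rw [h.1] at hin
  let e := Ideal.Quotient.stabilizerQuotientInertiaEquiv Gal(M/k) p.asIdeal Q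
  have hcyc : IsCyclic (MulAction.stabilizer Gal(M/k) Q ⧸
      Q.inertia (MulAction.stabilizer Gal(M/k) Q)) := by
    have : IsCyclic Gal((𝓞 M ⧸ Q)/(𝓞 k ⧸ p.asIdeal)) := inferInstance
    exact isCyclic_of_surjective e.symm e.symm.surjective
  obtain ⟨g, hg⟩ := hcyc.exists_generator
  have hcard := orderOf_eq_card_of_forall_mem_zpowers hg
  have h2 : g ^ 2 = 1 := by
    obtain ⟨x, rfl⟩ := QuotientGroup.mk_surjective g
    rw [← QuotientGroup.mk_pow, show x ^ 2 = 1 from Subtype.ext (hG x), QuotientGroup.mk_one]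
  have hd := orderOf_dvd_of_pow_eq_one h2
  have hi := Subgroup.card_mul_index (Q.inertia (MulAction.stabilizer Gal(M/k) Q))
  have hin' : Nat.card (Q.inertia (MulAction.stabilizer Gal(M/k) Q)) = 1 := by
    rw [← hin]
    exact Nat.card_congr (Subgroup.subgroupOfEquivOfLe (Ideal.inertia_le_stabilizer Q)).toEquiv
  rw [hin', hst, one_mul, Subgroup.index] at hi
  rw [hcard, hi] at hd
  omega

section Biquadratic

variable [IsGalois k M] (K₁ K₂ K₃ : IntermediateField k M)

theorem eulerFactor_mul_mul_of_biquadratic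
    (hM : Module.finrank k M = 4) (hK₁ : Module.finrank k K₁ = 2) (hK₂ : Module.finrank k K₂ = 2)
    (hK₃ : Module.finrank k K₃ = 2) (h₁₂ : K₁ ≠ K₂) (h₁₃ : K₁ ≠ K₃) (h₂₃ : K₂ ≠ K₃)
    (p : HeightOneSpectrum (𝓞 k)) (s : ℝ) :
    eulerFactor k K₁ p.asIdeal s * eulerFactor k K₂ p.asIdeal s * eulerFactor k K₃ p.asIdeal s =
      eulerFactor k M p.asIdeal s * (1 - (Ideal.absNorm p.asIdeal : ℝ) ^ (-s)) ^ 2 := by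
  have hq : ∀ K : IntermediateField k M, Module.finrank k K = 2 → IsGalois k K ∧
      Nat.card K.fixingSubgroup = 2 := by
    intro K hK
    have : Algebra.IsQuadraticExtension k K := ⟨hK⟩
    refine ⟨{}, ?_⟩
    rw [IsGalois.card_fixingSubgroup_eq_finrank]
    have := Module.finrank_mul_finrank k K M
    rw [hK, hM] at this
    omega
  have hinj : ∀ {K L : IntermediateField k M}, K ≠ L → K.fixingSubgroup ≠ L.fixingSubgroup := by
    intro K L h h'
    apply h
    rw [← IsGalois.fixedField_fixingSubgroup K, h', IsGalois.fixedField_fixingSubgroup]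
  obtain ⟨_, c₁⟩ := hq K₁ hK₁
  obtain ⟨_, c₂⟩ := hq K₂ hK₂
  obtain ⟨_, c₃⟩ := hq K₃ hK₃
  have hG : Nat.card Gal(M/k) = 4 := by rw [IsGalois.card_aut_eq_finrank, hM]
  obtain ⟨hsq, hsum⟩ := sum_card_subgroupOf hG c₁ c₂ c₃ (hinj h₁₂) (hinj h₁₃) (hinj h₂₃)
  obtain ⟨⟨Q, _, _⟩⟩ : Nonempty (p.asIdeal.primesOver (𝓞 M)) := inferInstance
  obtain ⟨a₁, b₁, A₁, B₁, C₁, D₁, E₁⟩ := local_data_of_intermediateField p Q K₁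
  obtain ⟨a₂, b₂, A₂, B₂, C₂, D₂, E₂⟩ := local_data_of_intermediateField p Q K₂
  obtain ⟨a₃, b₃, A₃, B₃, C₃, D₃, E₃⟩ := local_data_of_intermediateField p Q K₃
  have S₁ := hsum (Q.inertia Gal(M/k))
  have S₂ := hsum (MulAction.stabilizer Gal(M/k) Q)
  rw [D₁, D₂, D₃, Ideal.card_inertia_eq_ramificationIdxIn p.asIdeal Q] at S₁
  rw [E₁, E₂, E₃, Ideal.card_stabilizer_eq p.asIdeal Q] at S₂
  rw [eulerFactor_of_isGalois, eulerFactor_of_isGalois, eulerFactor_of_isGalois,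
    eulerFactor_of_isGalois]
  refine biquadratic_euler_identity ?_
    (ramificationIdxIn_ne_one_or_inertiaDegIn_ne_four p Q hsq) (A₁.trans hK₁) (A₂.trans hK₂)
    (A₃.trans hK₃) B₁ B₂ B₃ C₁ C₂ C₃ S₁ S₂ _
  rw [Ideal.ncard_primesOver_mul_ramificationIdxIn_mul_inertiaDegIn p.asIdeal (𝓞 M) Gal(M/k), hG]

/-- The zeta functions attached to a biquadratic extension satisfy the Brauer relation. -/
theorem zetaSum_mul_mul_of_biquadratic
    (hM : Module.finrank k M = 4) (hK₁ : Module.finrank k K₁ = 2) (hK₂ : Module.finrank k K₂ = 2)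
    (hK₃ : Module.finrank k K₃ = 2) (h₁₂ : K₁ ≠ K₂) (h₁₃ : K₁ ≠ K₃) (h₂₃ : K₂ ≠ K₃)
    {s : ℝ} (hs : 1 < s) :
    (zetaSum K₁ s).toReal * (zetaSum K₂ s).toReal * (zetaSum K₃ s).toReal =
      (zetaSum M s).toReal * (zetaSum k s).toReal ^ 2 := by
  have h1 := ((hasProd_eulerFactor k K₁ hs).mul (hasProd_eulerFactor k K₂ hs)).mul
    (hasProd_eulerFactor k K₃ hs)
  have h2 := (hasProd_eulerFactor k M hs).mul ((hasProd_zetaSum k hs).mul (hasProd_zetaSum k hs))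
  have h3 : (fun p : HeightOneSpectrum (𝓞 k) ↦ eulerFactor k K₁ p.asIdeal s *
      eulerFactor k K₂ p.asIdeal s * eulerFactor k K₃ p.asIdeal s) = fun p ↦
        eulerFactor k M p.asIdeal s * ((1 - (Ideal.absNorm p.asIdeal : ℝ) ^ (-s)) *
          (1 - (Ideal.absNorm p.asIdeal : ℝ) ^ (-s))) := funext fun p ↦ by
    rw [eulerFactor_mul_mul_of_biquadratic K₁ K₂ K₃ hM hK₁ hK₂ hK₃ h₁₂ h₁₃ h₂₃ p s, sq]
  have h4 := h1.unique (h3 ▸ h2)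
  rw [← mul_inv, ← mul_inv, ← mul_inv, ← mul_inv, inv_inj] at h4
  rw [h4, sq]

end Biquadratic

end BrauerRelation

section ZetaContinuation

open Module (finrank)
open scoped nonZeroDivisors

variable (K : Type*) [Field K] [NumberField K]

/-- The analytic continuation of `(s - 1) ζ_K(s)` to a real half line starting left of `1`. -/
noncomputable def zetaCont : ℝ → ℝ := (exists_zeta_continuation K).choose

theorem analyticOnNhd_zetaCont :
    AnalyticOnNhd ℝ (zetaCont K) (Set.Ioi (1 - 1 / (finrank ℚ K : ℝ))) :=
  (exists_zeta_continuation K).choose_spec.1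

theorem zetaCont_of_one_lt {s : ℝ} (hs : 1 < s) :
    zetaCont K s = (s - 1) * (zetaSum K s).toReal :=
  ((exists_zeta_continuation K).choose_spec.2.1 s hs).2

theorem zetaCont_one : zetaCont K 1 = dedekindZeta_residue K :=
  (exists_zeta_continuation K).choose_spec.2.2.1

theorem residue_lower_bound {β : ℝ} (hβ : 1 - 1 / (2 * finrank ℚ K : ℝ) ≤ β) (hβ1 : β < 1)
    (h : 0 ≤ zetaCont K β) : residueConst (finrank ℚ K) * (1 - β) ≤
      dedekindZeta_residue K * (covBound K : ℝ) ^ (finrank ℚ K * (1 - β)) :=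
  (exists_zeta_continuation K).choose_spec.2.2.2.1 β hβ hβ1 h

theorem residue_upper_bound {η : ℝ} (hη : 0 < η) : dedekindZeta_residue K ≤
    2 * (2 * 2 ^ (2 * finrank ℚ K) * (covBound K : ℝ)) ^ (finrank ℚ K * η) *
      (zetaSum K (1 + η)).toReal :=
  (exists_zeta_continuation K).choose_spec.2.2.2.2 η hη

variable {K}

theorem eqOn_Ioi_of_analyticOnNhd {f g : ℝ → ℝ} {a : ℝ} (ha : a < 1)
    (hf : AnalyticOnNhd ℝ f (Set.Ioi a)) (hg : AnalyticOnNhd ℝ g (Set.Ioi a))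
    (h : ∀ s, 1 < s → f s = g s) : Set.EqOn f g (Set.Ioi a) := by
  refine hf.eqOn_of_preconnected_of_eventuallyEq hg isPreconnected_Ioi
    (show (2 : ℝ) ∈ Set.Ioi a by simp only [Set.mem_Ioi]; linarith) ?_
  filter_upwards [Ioi_mem_nhds (show (1 : ℝ) < 2 by norm_num)] with s hs using h s hs

theorem one_sub_inv_finrank_mono {N N' : ℕ} (hN : 0 < N) (h : N ≤ N') :
    1 - 1 / (N : ℝ) ≤ 1 - 1 / (N' : ℝ) := by
  gcongr

variable {L : Type*} [Field L] [NumberField L]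

theorem zetaSum_congr (e : K ≃+* L) (s : ℝ) : zetaSum K s = zetaSum L s := by
  let r : 𝓞 K ≃+* 𝓞 L := RingOfIntegers.mapRingEquiv e
  have hnorm : ∀ I : Ideal (𝓞 K), Ideal.absNorm (I.map r) = Ideal.absNorm I := by
    intro I
    rw [Ideal.absNorm_apply, Ideal.absNorm_apply, Submodule.cardQuot_apply,
      Submodule.cardQuot_apply]
    exact (Nat.card_congr (Ideal.quotientEquiv I (I.map r) r rfl).toEquiv).symm
  let m : Ideal (𝓞 L) ≃o Ideal (𝓞 K) := Ideal.relIsoOfBijective r r.bijective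
  have hm : ∀ I, m.symm I = I.map r := fun I ↦ by
    rw [OrderIso.symm_apply_eq]
    exact (Ideal.comap_map_of_bijective r r.bijective).symm
  let m' : (Ideal (𝓞 K))⁰ ≃ (Ideal (𝓞 L))⁰ := m.symm.toEquiv.subtypeEquiv fun I ↦ by
    rw [mem_nonZeroDivisors_iff_ne_zero, mem_nonZeroDivisors_iff_ne_zero, Submodule.zero_eq_bot,
      Submodule.zero_eq_bot, ne_eq, ne_eq, ← m.symm.map_bot]
    exact (m.symm.injective.eq_iff).not.symm
  rw [zetaSum, zetaSum, ← m'.tsum_eq]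
  refine tsum_congr fun I ↦ ?_
  rw [← hnorm, ← hm]
  rfl

theorem finrank_rat_le (K L : Type*) [Field K] [NumberField K] [Field L] [NumberField L]
    [Algebra K L] : finrank ℚ K ≤ finrank ℚ L :=
  Nat.le_of_dvd Module.finrank_pos ⟨_, (Module.finrank_mul_finrank ℚ K L).symm⟩

theorem zetaCont_congr (e : K ≃+* L) {s : ℝ} (hs : 1 - 1 / (finrank ℚ K : ℝ) < s) :
    zetaCont K s = zetaCont L s := by
  have hN : finrank ℚ K = finrank ℚ L :=
    LinearEquiv.finrank_eq (AlgEquiv.ofRingEquiv (f := e) fun q ↦ by simp).toLinearEquiv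
  have h0 : (0 : ℝ) < finrank ℚ K := by exact_mod_cast Module.finrank_pos
  refine eqOn_Ioi_of_analyticOnNhd (a := 1 - 1 / (finrank ℚ K : ℝ)) (by simpa using h0)
    (analyticOnNhd_zetaCont K)
    (hN ▸ analyticOnNhd_zetaCont L) (fun s hs ↦ ?_) hs
  rw [zetaCont_of_one_lt K hs, zetaCont_of_one_lt L hs, zetaSum_congr e]

theorem dedekindZeta_residue_congr (e : K ≃+* L) :
    dedekindZeta_residue K = dedekindZeta_residue L := by
  have h0 : (0 : ℝ) < finrank ℚ K := by exact_mod_cast Module.finrank_pos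
  rw [← zetaCont_one, ← zetaCont_one, zetaCont_congr e (by simpa using h0)]

section Biquadratic

variable {k M : Type*} [Field k] [NumberField k] [Field M] [NumberField M] [Algebra k M]
  [IsGalois k M] (K₁ K₂ K₃ : IntermediateField k M)

theorem zetaCont_mul_mul_of_biquadratic
    (hM : finrank k M = 4) (hK₁ : finrank k K₁ = 2) (hK₂ : finrank k K₂ = 2)
    (hK₃ : finrank k K₃ = 2) (h₁₂ : K₁ ≠ K₂) (h₁₃ : K₁ ≠ K₃) (h₂₃ : K₂ ≠ K₃)
    {s : ℝ} (hs : 1 - 1 / (finrank ℚ M : ℝ) < s) :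
    zetaCont K₁ s * zetaCont K₂ s * zetaCont K₃ s = zetaCont M s * zetaCont k s ^ 2 := by
  have h0 : (0 : ℝ) < finrank ℚ M := by exact_mod_cast Module.finrank_pos
  have hmono : ∀ (E : Type _) [Field E] [NumberField E] [Algebra E M], AnalyticOnNhd ℝ (zetaCont E)
      (Set.Ioi (1 - 1 / (finrank ℚ M : ℝ))) := by
    intro E _ _ _
    refine (analyticOnNhd_zetaCont E).mono (Set.Ioi_subset_Ioi (one_sub_inv_finrank_mono
      Module.finrank_pos ?_))
    exact finrank_rat_le E M
  have hk : AnalyticOnNhd ℝ (zetaCont k) (Set.Ioi (1 - 1 / (finrank ℚ M : ℝ))) := by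
    refine (analyticOnNhd_zetaCont k).mono (Set.Ioi_subset_Ioi (one_sub_inv_finrank_mono
      Module.finrank_pos ?_))
    exact finrank_rat_le k M
  refine eqOn_Ioi_of_analyticOnNhd (f := fun s ↦ zetaCont K₁ s * zetaCont K₂ s * zetaCont K₃ s)
    (g := fun s ↦ zetaCont M s * zetaCont k s ^ 2) (a := 1 - 1 / (finrank ℚ M : ℝ))
    (by simpa using h0) (((hmono K₁).mul (hmono K₂)).mul (hmono K₃))
    ((hmono M).mul (hk.pow 2)) (fun s hs ↦ ?_) hs
  have h := zetaSum_mul_mul_of_biquadratic K₁ K₂ K₃ hM hK₁ hK₂ hK₃ h₁₂ h₁₃ h₂₃ hs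
  simp only [zetaCont_of_one_lt _ hs]
  linear_combination (s - 1) ^ 3 * h

theorem residue_mul_mul_of_biquadratic
    (hM : finrank k M = 4) (hK₁ : finrank k K₁ = 2) (hK₂ : finrank k K₂ = 2)
    (hK₃ : finrank k K₃ = 2) (h₁₂ : K₁ ≠ K₂) (h₁₃ : K₁ ≠ K₃) (h₂₃ : K₂ ≠ K₃) :
    dedekindZeta_residue K₁ * dedekindZeta_residue K₂ * dedekindZeta_residue K₃ =
      dedekindZeta_residue M * dedekindZeta_residue k ^ 2 := by
  have h0 : (0 : ℝ) < finrank ℚ M := by exact_mod_cast Module.finrank_pos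
  simp only [← zetaCont_one]
  exact zetaCont_mul_mul_of_biquadratic K₁ K₂ K₃ hM hK₁ hK₂ hK₃ h₁₂ h₁₃ h₂₃ (by simpa using h0)

end Biquadratic

end ZetaContinuation

section DiscriminantBound

open Module (finrank)

variable {k M : Type*} [Field k] [NumberField k] [Field M] [NumberField M] [Algebra k M]

theorem natAbs_discr_le_of_linearDisjoint [IsPrincipalIdealRing (𝓞 k)]
    (K₁ K₂ : IntermediateField k M) (h : K₁.LinearDisjoint K₂) (h' : K₁ ⊔ K₂ = ⊤) :
    (discr M).natAbs ≤
      (discr K₁).natAbs ^ finrank K₁ M * (discr K₂).natAbs ^ finrank K₂ M := by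
  have hfree : Module.Free (𝓞 k) (𝓞 K₁) := inferInstance
  have i1 : IsScalarTower (𝓞 k) (𝓞 K₂) M := .of_algebraMap_eq fun x ↦ rfl
  have i2 : @IsScalarTower (𝓞 k) K₁ M (K₁.algebra' (R' := 𝓞 k)).toSMul _ _ :=
    letI := K₁.algebra' (R' := 𝓞 k)
    .of_algebraMap_eq fun x ↦ rfl
  have i3 : @IsScalarTower (𝓞 k) (𝓞 K₁) K₁ _ _ (K₁.algebra' (R' := 𝓞 k)).toSMul :=
    letI := K₁.algebra' (R' := 𝓞 k)
    .of_algebraMap_eq fun x ↦ rfl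
  have hd := IsDedekindDomain.differentIdeal_dvd_map_differentIdeal (𝓞 k) (𝓞 M) (𝓞 K₂) (𝓞 K₁)
    (F₁ := K₂) (F₂ := K₁) h.symm (by rw [sup_comm]; exact h')
  have h1 := natAbs_discr_eq_absNorm_differentIdeal_mul_natAbs_discr_pow K₂ (𝓞 K₂) M (𝓞 M)
  have h2 := natAbs_discr_eq_absNorm_differentIdeal_mul_natAbs_discr_pow k (𝓞 k) K₁ (𝓞 K₁)
  have h3 := map_dvd Ideal.absNorm hd
  rw [Ideal.absNorm_algebraMap] at h3
  rw [← IsFractionRing.finrank_eq (𝓞 K₁) K₁ (𝓞 M) M] at h3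
  have h4 : Ideal.absNorm (differentIdeal (𝓞 k) (𝓞 K₁)) ≤ (discr K₁).natAbs := by
    rw [h2]
    exact Nat.le_mul_of_pos_right _ (pow_pos (Int.natAbs_pos.2 (discr_ne_zero k)) _)
  have h0 : Ideal.absNorm (differentIdeal (𝓞 k) (𝓞 K₁)) ≠ 0 := fun h ↦
    discr_ne_zero K₁ (by rw [← Int.natAbs_eq_zero, h2, h, zero_mul])
  rw [h1]
  exact Nat.mul_le_mul_right _ ((Nat.le_of_dvd (pow_pos (Nat.pos_of_ne_zero h0) _) h3).trans
    (Nat.pow_le_pow_left h4 _))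

end DiscriminantBound

section BiquadraticField

open Module (finrank)

variable {k M : Type*} [Field k] [CharZero k] [Field M] [Algebra k M]

theorem exists_third_quadratic_subfield [FiniteDimensional k M] (K₁ K₂ : IntermediateField k M)
    (h₁ : finrank k K₁ = 2) (h₂ : finrank k K₂ = 2) (hne : K₁ ≠ K₂) (hsup : K₁ ⊔ K₂ = ⊤) :
    IsGalois k M ∧ finrank k M = 4 ∧ K₁.LinearDisjoint K₂ ∧
      ∃ K₃ : IntermediateField k M, finrank k K₃ = 2 ∧ K₁ ≠ K₃ ∧ K₂ ≠ K₃ := by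
  have hq₁ : Algebra.IsQuadraticExtension k K₁ := ⟨h₁⟩
  have hq₂ : Algebra.IsQuadraticExtension k K₂ := ⟨h₂⟩
  have g₁ : IsGalois k K₁ := {}
  have g₂ : IsGalois k K₂ := {}
  have hnorm : Normal k (K₁ ⊔ K₂ : IntermediateField k M) := inferInstance
  rw [hsup] at hnorm
  have hnormM : Normal k M := Normal.of_algEquiv IntermediateField.topEquiv
  have hgal : IsGalois k M := {}
  have hinf : K₁ ⊓ K₂ = ⊥ := by
    by_contra hb
    have hd : finrank k (K₁ ⊓ K₂ : IntermediateField k M) ≠ 1 := fun h ↦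
      hb (IntermediateField.finrank_eq_one_iff.1 h)
    have hle : ∀ K : IntermediateField k M, finrank k K = 2 → K₁ ⊓ K₂ ≤ K → K₁ ⊓ K₂ = K := by
      intro K hK hle
      have hdvd := IntermediateField.finrank_dvd_of_le_right hle
      rw [hK, Nat.dvd_prime Nat.prime_two] at hdvd
      exact IntermediateField.eq_of_le_of_finrank_eq hle (by rw [hK]; tauto)
    exact hne ((hle K₁ h₁ inf_le_left).symm.trans (hle K₂ h₂ inf_le_right))
  have hdisj : K₁.LinearDisjoint K₂ := IntermediateField.LinearDisjoint.of_inf_eq_bot hinf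
  have hM : finrank k M = 4 := by
    have := hdisj.finrank_sup
    rw [hsup, IntermediateField.finrank_top', h₁, h₂] at this
    exact this
  refine ⟨hgal, hM, hdisj, ?_⟩
  have hcard : ∀ K : IntermediateField k M, finrank k K = 2 → Nat.card K.fixingSubgroup = 2 := by
    intro K hK
    rw [IsGalois.card_fixingSubgroup_eq_finrank]
    have := Module.finrank_mul_finrank k K M
    rw [hK, hM] at this
    omega
  have hinj : ∀ {K L : IntermediateField k M}, K.fixingSubgroup = L.fixingSubgroup → K = L := by
    intro K L h'
    rw [← IsGalois.fixedField_fixingSubgroup K, h', IsGalois.fixedField_fixingSubgroup]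
  have hG : Nat.card Gal(M/k) = 2 ^ 2 := by rw [IsGalois.card_aut_eq_finrank, hM]; norm_num
  obtain ⟨x, hx, hx2, hHx⟩ := exists_of_card_subgroup_eq_two (hcard K₁ h₁)
  obtain ⟨y, hy, hy2, hHy⟩ := exists_of_card_subgroup_eq_two (hcard K₂ h₂)
  have hcomm : x * y = y * x :=
    (IsPGroup.isMulCommutative_of_card_eq_prime_sq hG).is_comm.comm x y
  have hxy : x ≠ y := fun h ↦ hne (hinj (Subgroup.ext fun z ↦ by rw [hHx, hHy, h]))
  have hz : orderOf (x * y) = 2 := by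
    refine orderOf_eq_prime ?_ fun h ↦ hxy ?_
    · rw [(show Commute x y from hcomm).mul_pow, hx2, hy2, one_mul]
    · rw [← mul_one x, ← hy2, sq, ← mul_assoc, h, one_mul]
  have hxy1 : x * y ≠ 1 := fun h ↦ hxy <| by rw [← mul_one x, ← hy2, sq, ← mul_assoc, h, one_mul]
  refine ⟨IntermediateField.fixedField (Subgroup.zpowers (x * y)), ?_, fun h ↦ ?_, fun h ↦ ?_⟩
  · have := IntermediateField.finrank_fixedField_eq_card (Subgroup.zpowers (x * y))
    rw [Nat.card_zpowers, hz] at this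
    have h2 := Module.finrank_mul_finrank k
      (IntermediateField.fixedField (Subgroup.zpowers (x * y))) M
    rw [this, hM] at h2
    omega
  · have hm : x * y ∈ K₁.fixingSubgroup := by
      rw [h, IntermediateField.fixingSubgroup_fixedField]
      exact Subgroup.mem_zpowers _
    rcases (hHx _).1 hm with h | h
    · exact hxy1 h
    · exact hy (mul_eq_left.1 h)
  · have hm : x * y ∈ K₂.fixingSubgroup := by
      rw [h, IntermediateField.fixingSubgroup_fixedField]
      exact Subgroup.mem_zpowers _
    rcases (hHy _).1 hm with h | h
    · exact hxy1 h
    · exact hx (mul_eq_right.1 h)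

end BiquadraticField

section SiegelStep

open Module (finrank)

theorem covBound_le_of_algebra (K M : Type*) [Field K] [NumberField K] [Field M] [NumberField M]
    [Algebra K M] : covBound K ≤ covBound M := by
  have hN : finrank ℚ K ≤ finrank ℚ M := finrank_rat_le K M
  have hD : (discr K).natAbs ≤ (discr M).natAbs :=
    Nat.le_of_dvd (Int.natAbs_pos.2 (discr_ne_zero M))
      (Int.natAbs_dvd_natAbs.2 (discr_dvd_discr K M))
  have h1 := one_le_natAbs_discr K
  have h2 := one_le_natAbs_discr M
  unfold covBound
  have : ((discr K).natAbs * 2 ^ (finrank ℚ K + 2)) ^ finrank ℚ K ≤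
      ((discr M).natAbs * 2 ^ (finrank ℚ M + 2)) ^ finrank ℚ M :=
    (Nat.pow_le_pow_left (Nat.mul_le_mul hD (Nat.pow_le_pow_right two_pos (by lia))) _).trans
      (Nat.pow_le_pow_right (by positivity) hN)
  gcongr
  norm_num

theorem covBound_le_mul_pow (K : Type*) [Field K] [NumberField K] {D : ℕ}
    (h : (discr K).natAbs ≤ D) : covBound K ≤
      2 ^ (finrank ℚ K + 1) * finrank ℚ K * 2 ^ ((finrank ℚ K + 2) * finrank ℚ K) *
        D ^ (finrank ℚ K + 1) := by
  calc covBound K ≤ D * 2 ^ (finrank ℚ K + 1) *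
        (finrank ℚ K * (D * 2 ^ (finrank ℚ K + 2)) ^ finrank ℚ K) := by
        unfold covBound
        gcongr
    _ = _ := by rw [mul_pow, pow_mul]; ring

section

variable {k M : Type*} [Field k] [NumberField k] [Field M] [NumberField M] [Algebra k M]

theorem residue_le_of_quadratic (K : IntermediateField k M) (hK : finrank k K = 2) {η : ℝ}
    (hη : 0 < η) : dedekindZeta_residue K ≤
      2 * (2 * 2 ^ (4 * finrank ℚ k) * (covBound M : ℝ)) ^ (2 * finrank ℚ k * η) *
        (zetaSum k (1 + η)).toReal ^ 2 := by
  have hN : finrank ℚ K = 2 * finrank ℚ k := by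
    rw [← Module.finrank_mul_finrank ℚ k K, hK, mul_comm]
  have h := residue_upper_bound K hη
  have h1 := zetaSum_le_pow k K (s := 1 + η) (by linarith)
  rw [hK] at h1
  rw [hN] at h
  have h2 : (covBound K : ℝ) ≤ covBound M := by exact_mod_cast covBound_le_of_algebra K M
  refine h.trans ?_
  rw [show 2 * (2 * finrank ℚ k) = 4 * finrank ℚ k by ring]
  push_cast
  gcongr

theorem mul_residue_le_of_zero (K₁ K₂ : IntermediateField k M)
    (h₁ : finrank k K₁ = 2) (h₂ : finrank k K₂ = 2) (hne : K₁ ≠ K₂) (hsup : K₁ ⊔ K₂ = ⊤)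
    {β η : ℝ} (hη : 0 < η) (hβ : 1 - 1 / (8 * finrank ℚ k : ℝ) ≤ β) (hβ1 : β < 1)
    (hz : zetaCont K₁ β = 0) (hk : zetaCont k β ≠ 0) :
    residueConst (4 * finrank ℚ k) * (1 - β) * dedekindZeta_residue k ^ 2 ≤
      dedekindZeta_residue K₁ * dedekindZeta_residue K₂ *
        (2 * (2 * 2 ^ (4 * finrank ℚ k) * (covBound M : ℝ)) ^ (2 * finrank ℚ k * η) *
        (zetaSum k (1 + η)).toReal ^ 2) * (covBound M : ℝ) ^ (4 * finrank ℚ k * (1 - β)) := by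
  obtain ⟨hG, hM, -, K₃, h₃, h₁₃, h₂₃⟩ := exists_third_quadratic_subfield K₁ K₂ h₁ h₂ hne hsup
  have hN : finrank ℚ M = 4 * finrank ℚ k := by
    rw [← Module.finrank_mul_finrank ℚ k M, hM, mul_comm]
  have hn : (0 : ℝ) < finrank ℚ k := by exact_mod_cast Module.finrank_pos
  have hNr : (finrank ℚ M : ℝ) = 4 * finrank ℚ k := by exact_mod_cast hN
  have hid := zetaCont_mul_mul_of_biquadratic K₁ K₂ K₃ hM h₁ h₂ h₃ hne h₁₃ h₂₃ (s := β) (by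
    refine lt_of_lt_of_le ?_ hβ
    rw [hNr]
    gcongr
    norm_num)
  rw [hz, zero_mul, zero_mul, eq_comm, mul_eq_zero, or_iff_left (pow_ne_zero 2 hk)] at hid
  have hlow := residue_lower_bound M (β := β) (by
    rw [hNr]
    convert hβ using 3
    ring) hβ1 hid.ge
  rw [hN, Nat.cast_mul, Nat.cast_ofNat] at hlow
  have hres := residue_mul_mul_of_biquadratic K₁ K₂ K₃ hM h₁ h₂ h₃ hne h₁₃ h₂₃
  have hup := residue_le_of_quadratic K₃ h₃ hη
  have p1 := (dedekindZeta_residue_pos K₁).le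
  have p2 := (dedekindZeta_residue_pos K₂).le
  calc _ ≤ dedekindZeta_residue M * (covBound M : ℝ) ^ (4 * finrank ℚ k * (1 - β)) *
        dedekindZeta_residue k ^ 2 := by gcongr
    _ = dedekindZeta_residue K₁ * dedekindZeta_residue K₂ * dedekindZeta_residue K₃ *
        (covBound M : ℝ) ^ (4 * finrank ℚ k * (1 - β)) := by rw [hres]; ring
    _ ≤ _ := by gcongr

end

end SiegelStep

section SiegelTransfer

open Module (finrank)

variable {k Ω : Type*} [Field k] [NumberField k] [Field Ω] [Algebra k Ω]

theorem exists_mul_residue_le_of_zero [IsPrincipalIdealRing (𝓞 k)] (K₁ K₂ : IntermediateField k Ω)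
    [NumberField K₁] [NumberField K₂]
    (h₁ : finrank k K₁ = 2) (h₂ : finrank k K₂ = 2) (hne : K₁ ≠ K₂)
    {β η : ℝ} (hη : 0 < η) (hβ : 1 - 1 / (8 * finrank ℚ k : ℝ) ≤ β) (hβ1 : β < 1)
    (hz : zetaCont K₁ β = 0) (hk : zetaCont k β ≠ 0) :
    ∃ Y : ℕ, 1 ≤ Y ∧ Y ≤ 2 ^ (4 * finrank ℚ k + 1) * (4 * finrank ℚ k) *
        2 ^ ((4 * finrank ℚ k + 2) * (4 * finrank ℚ k)) *
        ((discr K₁).natAbs ^ 2 * (discr K₂).natAbs ^ 2) ^ (4 * finrank ℚ k + 1) ∧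
    residueConst (4 * finrank ℚ k) * (1 - β) * dedekindZeta_residue k ^ 2 ≤
      dedekindZeta_residue K₁ * dedekindZeta_residue K₂ *
        (2 * (2 * 2 ^ (4 * finrank ℚ k) * (Y : ℝ)) ^ (2 * finrank ℚ k * η) *
        (zetaSum k (1 + η)).toReal ^ 2) * (Y : ℝ) ^ (4 * finrank ℚ k * (1 - β)) := by
  have f₁ : FiniteDimensional k K₁ := .of_finrank_pos (by lia)
  have f₂ : FiniteDimensional k K₂ := .of_finrank_pos (by lia)
  let M : IntermediateField k Ω := K₁ ⊔ K₂
  have fM : FiniteDimensional k M := inferInstanceAs (FiniteDimensional k ↥(K₁ ⊔ K₂))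
  have nM : NumberField M :=
    { to_charZero := charZero_of_injective_algebraMap (algebraMap k M).injective
      to_finiteDimensional := by
        have := charZero_of_injective_algebraMap (algebraMap k M).injective
        exact FiniteDimensional.trans ℚ k M }
  let L₁ : IntermediateField k M := IntermediateField.restrict (le_sup_left : K₁ ≤ M)
  let L₂ : IntermediateField k M := IntermediateField.restrict (le_sup_right : K₂ ≤ M)
  let e₁ : K₁ ≃ₐ[k] L₁ := IntermediateField.restrictAlgEquiv (le_sup_left : K₁ ≤ M)
  let e₂ : K₂ ≃ₐ[k] L₂ := IntermediateField.restrictAlgEquiv (le_sup_right : K₂ ≤ M)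
  have l₁ : IntermediateField.lift L₁ = K₁ := IntermediateField.lift_restrict _
  have l₂ : IntermediateField.lift L₂ = K₂ := IntermediateField.lift_restrict _
  have g₁ : finrank k L₁ = 2 := e₁.toLinearEquiv.finrank_eq.symm.trans h₁
  have g₂ : finrank k L₂ = 2 := e₂.toLinearEquiv.finrank_eq.symm.trans h₂
  have hne' : L₁ ≠ L₂ := fun h ↦ hne (by rw [← l₁, h, l₂])
  have hsup : L₁ ⊔ L₂ = ⊤ := by
    apply IntermediateField.lift_injective M
    rw [IntermediateField.lift_sup, l₁, l₂, IntermediateField.lift_top]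
  have hN : finrank ℚ K₁ = 2 * finrank ℚ k := by
    rw [← Module.finrank_mul_finrank ℚ k K₁, h₁, mul_comm]
  have hn : (0 : ℝ) < finrank ℚ k := by exact_mod_cast Module.finrank_pos
  have hz' : zetaCont L₁ β = 0 := by
    rw [← zetaCont_congr e₁.toRingEquiv, hz]
    refine lt_of_lt_of_le ?_ hβ
    rw [hN]
    push_cast
    gcongr
    norm_num
  obtain ⟨-, hM, hdisj, -⟩ := exists_third_quadratic_subfield L₁ L₂ g₁ g₂ hne' hsup
  have hD := natAbs_discr_le_of_linearDisjoint L₁ L₂ hdisj hsup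
  have t₁ := Module.finrank_mul_finrank k L₁ M
  have t₂ := Module.finrank_mul_finrank k L₂ M
  rw [g₁, hM] at t₁
  rw [g₂, hM] at t₂
  rw [show finrank L₁ M = 2 by lia, show finrank L₂ M = 2 by lia,
    ← discr_eq_discr_of_algEquiv K₁ (AlgEquiv.ofRingEquiv (f := e₁.toRingEquiv) fun q ↦ by simp :
      K₁ ≃ₐ[ℚ] L₁),
    ← discr_eq_discr_of_algEquiv K₂ (AlgEquiv.ofRingEquiv (f := e₂.toRingEquiv) fun q ↦ by simp :
      K₂ ≃ₐ[ℚ] L₂)] at hD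
  have hNM : finrank ℚ M = 4 * finrank ℚ k := by
    rw [← Module.finrank_mul_finrank ℚ k M, hM, mul_comm]
  have hb := covBound_le_mul_pow M hD
  rw [hNM] at hb
  have hfin := mul_residue_le_of_zero L₁ L₂ g₁ g₂ hne' hsup hη hβ hβ1 hz' hk
  rw [← dedekindZeta_residue_congr e₁.toRingEquiv, ← dedekindZeta_residue_congr e₂.toRingEquiv]
    at hfin
  exact ⟨covBound M, covBound_pos M, hb, hfin⟩

end SiegelTransfer

section Siegel

open Module (finrank)

theorem residueConst_pos {N : ℕ} (hN : 0 < N) : 0 < residueConst N := by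
  unfold residueConst
  positivity

theorem natCast_rpow_le {Y C D p q : ℕ} {t : ℝ} (ht : 0 ≤ t) (h : Y ≤ C * D ^ p) (hD : 1 ≤ D)
    {η : ℝ} (hη : p * q * t ≤ η) :
    (Y : ℝ) ^ (q * t) ≤ (C : ℝ) ^ (q * t) * (D : ℝ) ^ η := by
  have hD' : (1 : ℝ) ≤ D := by exact_mod_cast hD
  calc (Y : ℝ) ^ (q * t) ≤ ((C : ℝ) * (D : ℝ) ^ p) ^ (q * t) := by
        have : (Y : ℝ) ≤ C * D ^ p := by exact_mod_cast h
        gcongr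
    _ = (C : ℝ) ^ (q * t) * (D : ℝ) ^ (p * q * t) := by
        rw [Real.mul_rpow (by positivity) (by positivity), ← Real.rpow_natCast,
          ← Real.rpow_mul (by positivity), mul_assoc (p : ℝ)]
    _ ≤ _ := by gcongr

variable {k Ω : Type*} [Field k] [NumberField k] [Field Ω] [Algebra k Ω]

theorem exists_zero_free_interval (k : Type*) [Field k] [NumberField k] :
    ∃ δ : ℝ, 0 < δ ∧ ∀ s, 1 - δ < s → s ≤ 1 → zetaCont k s ≠ 0 := by
  have hn : (0 : ℝ) < finrank ℚ k := by exact_mod_cast Module.finrank_pos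
  have hc : ContinuousAt (zetaCont k) 1 :=
    (analyticOnNhd_zetaCont k 1 (by simpa using hn)).continuousAt
  have h1 : zetaCont k 1 ≠ 0 := by
    rw [zetaCont_one]
    exact (dedekindZeta_residue_pos k).ne'
  obtain ⟨δ, hδ, h⟩ := Metric.eventually_nhds_iff.1 (hc.eventually_ne h1)
  refine ⟨δ, hδ, fun s hs hs1 ↦ h ?_⟩
  rw [Real.dist_eq, abs_lt]
  constructor <;> linarith

theorem exists_residue_lower_bound_of_nonneg {e η : ℝ} (he : 0 < e)
    (hen : e ≤ 1 / (8 * finrank ℚ k : ℝ)) (heη : 12 * finrank ℚ k * (4 * finrank ℚ k + 1) * e ≤ η)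
    (h : ∀ K : IntermediateField k Ω, ∀ _ : NumberField K, finrank k K = 2 →
      0 ≤ zetaCont K (1 - e)) :
    ∃ c : ℝ, 0 < c ∧ ∀ K : IntermediateField k Ω, ∀ _ : NumberField K, finrank k K = 2 →
      c ≤ dedekindZeta_residue K * ((discr K).natAbs : ℝ) ^ η := by
  have hn : 0 < finrank ℚ k := Module.finrank_pos
  set n := finrank ℚ k
  have hn' : (0 : ℝ) < n := by exact_mod_cast hn
  set C : ℕ := 2 ^ (2 * n + 1) * (2 * n) * 2 ^ ((2 * n + 2) * (2 * n)) with hC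
  have hC0 : 0 < C := by positivity
  refine ⟨residueConst (2 * n) * e / (C : ℝ) ^ (((2 * n : ℕ) : ℝ) * e), ?_, fun K _ hK ↦ ?_⟩
  · have := residueConst_pos (N := 2 * n) (by lia)
    positivity
  have hN : finrank ℚ K = 2 * n := by
    rw [← Module.finrank_mul_finrank ℚ k K, hK, mul_comm]
  have hlow := residue_lower_bound K (β := 1 - e) (by
    rw [hN]
    have : e ≤ 1 / (2 * ((2 * n : ℕ) : ℝ)) := hen.trans
      (one_div_le_one_div_of_le (by positivity) (by push_cast; linarith))
    linarith) (by linarith) (h K _ hK)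
  have hb := covBound_le_mul_pow K le_rfl
  rw [hN] at hb hlow
  rw [sub_sub_cancel] at hlow
  have h1 := natCast_rpow_le (q := 2 * n) (t := e) (η := η) he.le hb (one_le_natAbs_discr K) (by
    refine le_trans ?_ heη
    push_cast
    nlinarith [mul_pos hn' he, mul_pos hn' (mul_pos hn' he)])
  rw [div_le_iff₀ (by positivity)]
  calc _ ≤ _ := hlow
    _ ≤ _ := mul_le_mul_of_nonneg_left h1 (dedekindZeta_residue_pos K).le
    _ = _ := by ring

theorem exists_residue_lower_bound_of_neg [IsPrincipalIdealRing (𝓞 k)] {e η : ℝ} (he : 0 < e)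
    (hen : e ≤ 1 / (8 * finrank ℚ k : ℝ)) (heη : 12 * finrank ℚ k * (4 * finrank ℚ k + 1) * e ≤ η)
    (hk : ∀ s, 1 - e ≤ s → s ≤ 1 → zetaCont k s ≠ 0)
    (K₁ : IntermediateField k Ω) [NumberField K₁] (hK₁ : finrank k K₁ = 2)
    (h : zetaCont K₁ (1 - e) < 0) :
    ∃ c : ℝ, 0 < c ∧ ∀ K : IntermediateField k Ω, ∀ _ : NumberField K, finrank k K = 2 →
      c ≤ dedekindZeta_residue K * ((discr K).natAbs : ℝ) ^ η := by
  have hn : 0 < finrank ℚ k := Module.finrank_pos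
  have hN : finrank ℚ K₁ = 2 * finrank ℚ k := by
    rw [← Module.finrank_mul_finrank ℚ k K₁, hK₁, mul_comm]
  have hn' : (0 : ℝ) < finrank ℚ k := by exact_mod_cast hn
  have hη : 0 ≤ η := le_trans (by positivity) heη
  obtain ⟨β, hβ, hz⟩ : ∃ β ∈ Set.Ioo (1 - e) 1, zetaCont K₁ β = 0 := by
    have hcont : ContinuousOn (zetaCont K₁) (Set.Icc (1 - e) 1) := by
      refine (analyticOnNhd_zetaCont K₁).continuousOn.mono fun s hs ↦ ?_
      have : e < 1 / (finrank ℚ K₁ : ℝ) := hen.trans_lt (by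
        rw [hN]
        push_cast
        gcongr
        linarith)
      have := hs.1
      simp only [Set.mem_Ioi]
      linarith
    obtain ⟨β, hβ, hz⟩ := intermediate_value_Ioo (by linarith) hcont
      (show (0 : ℝ) ∈ Set.Ioo _ _ from ⟨h, by
        rw [zetaCont_one]; exact dedekindZeta_residue_pos K₁⟩)
    exact ⟨β, hβ, hz⟩
  have hβ1 := hβ.1
  have hβ2 := hβ.2
  have hkβ := hk β hβ1.le hβ2.le
  set n := finrank ℚ k
  set D₁ := (discr K₁).natAbs with hD₁
  have hD₁1 : 1 ≤ D₁ := one_le_natAbs_discr K₁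
  set C : ℕ := 2 ^ (4 * n + 1) * (4 * n) * 2 ^ ((4 * n + 2) * (4 * n)) *
    D₁ ^ (2 * (4 * n + 1)) with hC
  have hC0 : 0 < C := by positivity
  set Z := (zetaSum k (1 + e)).toReal
  have hZ : 0 < Z := zetaSum_toReal_pos k (by linarith)
  set A : ℝ := residueConst (4 * n) * (1 - β) * dedekindZeta_residue k ^ 2
  have hA : 0 < A := by
    have h1 := residueConst_pos (N := 4 * n) (by lia)
    have h2 := dedekindZeta_residue_pos k
    have h3 : 0 < 1 - β := by linarith
    positivity
  set B : ℝ := dedekindZeta_residue K₁ * (2 * (2 * 2 ^ (4 * n)) ^ (2 * n * e) * Z ^ 2) *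
    (C : ℝ) ^ (((6 * n : ℕ) : ℝ) * e) with hB
  have hρ := dedekindZeta_residue_pos K₁
  have hB0 : 0 < B := by positivity
  refine ⟨min (A / B) (dedekindZeta_residue K₁), lt_min (div_pos hA hB0) hρ, fun K _ hK ↦ ?_⟩
  have hD1 := one_le_natAbs_discr K
  have hD1' : (1 : ℝ) ≤ (discr K).natAbs := by exact_mod_cast hD1
  by_cases hKK : K₁ = K
  · subst hKK
    refine (min_le_right _ _).trans (le_mul_of_one_le_right hρ.le ?_)
    exact Real.one_le_rpow hD1' hη
  refine (min_le_left _ _).trans ?_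
  obtain ⟨Y, hY1, hY, hmain⟩ := exists_mul_residue_le_of_zero K₁ K hK₁ hK hKK he
    (hβ := by linarith) hβ2 hz hkβ
  have hY1' : (1 : ℝ) ≤ Y := by exact_mod_cast hY1
  have h1 := natCast_rpow_le (Y := Y) (C := C) (D := (discr K).natAbs) (p := 2 * (4 * n + 1))
    (q := 6 * n) (t := e) (η := η) he.le (hY.trans_eq (by rw [hC, hD₁]; ring)) hD1 (by
      refine le_trans (le_of_eq ?_) heη
      push_cast
      ring)
  have hYY : (Y : ℝ) ^ (2 * n * e) * (Y : ℝ) ^ (4 * n * (1 - β)) ≤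
      (Y : ℝ) ^ (((6 * n : ℕ) : ℝ) * e) := by
    rw [← Real.rpow_add (by positivity)]
    refine Real.rpow_le_rpow_of_exponent_le hY1' ?_
    push_cast
    nlinarith
  have hρK := dedekindZeta_residue_pos K
  rw [div_le_iff₀ hB0]
  calc A ≤ _ := hmain
    _ = dedekindZeta_residue K₁ * dedekindZeta_residue K *
        (2 * (2 * 2 ^ (4 * n)) ^ (2 * n * e) * Z ^ 2) *
        ((Y : ℝ) ^ (2 * n * e) * (Y : ℝ) ^ (4 * n * (1 - β))) := by
      rw [Real.mul_rpow (by positivity) (by positivity)]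
      ring
    _ ≤ dedekindZeta_residue K₁ * dedekindZeta_residue K *
        (2 * (2 * 2 ^ (4 * n)) ^ (2 * n * e) * Z ^ 2) *
        ((C : ℝ) ^ (((6 * n : ℕ) : ℝ) * e) * ((discr K).natAbs : ℝ) ^ η) := by
      exact mul_le_mul_of_nonneg_left (hYY.trans h1) (by positivity)
    _ = _ := by
      rw [hB]
      ring

theorem exists_residue_lower_bound [IsPrincipalIdealRing (𝓞 k)] (Ω : Type*) [Field Ω]
    [Algebra k Ω] {η : ℝ} (hη : 0 < η) :
    ∃ c : ℝ, 0 < c ∧ ∀ K : IntermediateField k Ω, ∀ _ : NumberField K, finrank k K = 2 →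
      c ≤ dedekindZeta_residue K * ((discr K).natAbs : ℝ) ^ η := by
  have hn : (0 : ℝ) < finrank ℚ k := by exact_mod_cast Module.finrank_pos
  obtain ⟨δ, hδ, hk⟩ := exists_zero_free_interval k
  set e : ℝ := min (min (1 / (8 * finrank ℚ k : ℝ)) (δ / 2))
    (η / (12 * finrank ℚ k * (4 * finrank ℚ k + 1))) with he_def
  have he : 0 < e := by positivity
  have he1 : e ≤ 1 / (8 * finrank ℚ k : ℝ) := (min_le_left _ _).trans (min_le_left _ _)
  have he2 : e ≤ δ / 2 := (min_le_left _ _).trans (min_le_right _ _)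
  have he3 : 12 * finrank ℚ k * (4 * finrank ℚ k + 1) * e ≤ η := by
    have h3 : e ≤ η / (12 * finrank ℚ k * (4 * finrank ℚ k + 1)) := min_le_right _ _
    rwa [le_div_iff₀ (by positivity), mul_comm] at h3
  by_cases h : ∀ K : IntermediateField k Ω, ∀ _ : NumberField K, finrank k K = 2 →
      0 ≤ zetaCont K (1 - e)
  · exact exists_residue_lower_bound_of_nonneg he he1 he3 h
  · push Not at h
    obtain ⟨K₁, _, hK₁, hneg⟩ := h
    exact exists_residue_lower_bound_of_neg he he1 he3
      (fun s hs hs1 ↦ hk s (by linarith) hs1) K₁ hK₁ hneg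

end Siegel

section ClassNumber

open Module (finrank)
open NumberField.InfinitePlace NumberField.Units

theorem torsionOrder_congr {K L : Type*} [Field K] [NumberField K] [Field L] [NumberField L]
    (e : K ≃+* L) : torsionOrder K = torsionOrder L := by
  let u : (𝓞 K)ˣ ≃* (𝓞 L)ˣ := Units.mapEquiv (RingOfIntegers.mapRingEquiv e).toMulEquiv
  refine Nat.card_congr (u.toEquiv.subtypeEquiv fun x ↦ ?_)
  simp only [torsion, CommGroup.mem_torsion]
  exact (Function.Injective.isOfFinOrder_iff (f := (u : (𝓞 K)ˣ →* (𝓞 L)ˣ)) u.injective).symm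

theorem regulator_le_residue_mul (K : Type*) [Field K] [NumberField K] :
    regulator K ≤ dedekindZeta_residue K * (torsionOrder K * Real.sqrt |(discr K : ℝ)|) := by
  have hd : (0 : ℝ) < Real.sqrt |(discr K : ℝ)| :=
    Real.sqrt_pos.2 (abs_pos.2 (Int.cast_ne_zero.2 (discr_ne_zero K)))
  have hw : (0 : ℝ) < torsionOrder K := by exact_mod_cast torsionOrder_pos K
  rw [dedekindZeta_residue_def, div_mul_cancel₀ _ (by positivity)]
  have h1 : (1 : ℝ) ≤ 2 ^ nrRealPlaces K := one_le_pow₀ one_le_two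
  have h2 : (1 : ℝ) ≤ (2 * Real.pi) ^ nrComplexPlaces K :=
    one_le_pow₀ (by linarith [Real.pi_gt_three])
  have h3 : (1 : ℝ) ≤ classNumber K := by exact_mod_cast Nat.one_le_iff_ne_zero.2 (by
    exact Fintype.card_ne_zero)
  have hR := (regulator_pos K).le
  calc regulator K = 1 * 1 * regulator K * 1 := by ring
    _ ≤ _ := by gcongr

theorem residue_mul_sqrt_le_of_CM (k K : Type*) [Field k] [NumberField k] [IsTotallyReal k]
    [Field K] [NumberField K] [Algebra k K] [Algebra.IsQuadraticExtension k K]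
    [IsTotallyComplex K] :
    dedekindZeta_residue K * Real.sqrt ((discr K).natAbs : ℝ) ≤
      (2 * Real.pi) ^ finrank ℚ k * (2 ^ finrank ℚ k *
        (dedekindZeta_residue k * (torsionOrder k * Real.sqrt |(discr k : ℝ)|))) *
        classNumber K := by
  have hCM : IsCMField K := IsCMField.ofCMExtension k K
  let e : k ≃+* maximalRealSubfield K := CMExtension.equivMaximalRealSubfield k K
  have hN : finrank ℚ K = 2 * finrank ℚ k := by
    rw [← Module.finrank_mul_finrank ℚ k K, Algebra.IsQuadraticExtension.finrank_eq_two k K,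
        mul_comm]
  have hr1 : nrRealPlaces K = 0 := nrRealPlaces_eq_zero_iff.2 inferInstance
  have hr2 : nrComplexPlaces K = finrank ℚ k := by
    have := card_add_two_mul_card_eq_rank K
    lia
  have hcard := card_eq_nrRealPlaces_add_nrComplexPlaces K
  have hrank : rank K ≤ finrank ℚ k := by
    rw [rank]
    lia
  have hreg : regulator K ≤ 2 ^ finrank ℚ k *
      (dedekindZeta_residue k * (torsionOrder k * Real.sqrt |(discr k : ℝ)|)) := by
    have h1 := IsCMField.regulator_div_regulator_eq_two_pow_mul_indexRealUnits_inv K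
    have h2 := regulator_le_residue_mul (maximalRealSubfield K)
    rw [← dedekindZeta_residue_congr e, ← torsionOrder_congr e,
      ← discr_eq_discr_of_algEquiv k (AlgEquiv.ofRingEquiv (f := e) fun q ↦ by simp)] at h2
    have hp := regulator_pos (maximalRealSubfield K)
    rw [div_eq_iff hp.ne'] at h1
    rw [h1]
    have h3 : ((IsCMField.indexRealUnits K : ℕ) : ℝ)⁻¹ ≤ 1 := by
      rcases IsCMField.indexRealUnits_eq_one_or_two K with h | h <;> rw [h] <;> norm_num
    have h4 : (2 : ℝ) ^ rank K ≤ 2 ^ finrank ℚ k := pow_le_pow_right₀ one_le_two hrank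
    calc _ ≤ 2 ^ finrank ℚ k * 1 * regulator (maximalRealSubfield K) := by gcongr
      _ ≤ _ := by rw [mul_one]; gcongr
  have hd : (0 : ℝ) < Real.sqrt |(discr K : ℝ)| :=
    Real.sqrt_pos.2 (abs_pos.2 (Int.cast_ne_zero.2 (discr_ne_zero K)))
  have hw : (1 : ℝ) ≤ torsionOrder K := by exact_mod_cast torsionOrder_pos K
  have hdn : ((discr K).natAbs : ℝ) = |(discr K : ℝ)| := by
    rw [← Int.cast_abs, Int.abs_eq_natAbs, Int.cast_natCast]
  have hR := regulator_pos K
  rw [hdn, dedekindZeta_residue_def, hr1, hr2, pow_zero, one_mul, ← div_div,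
    div_mul_cancel₀ _ hd.ne']
  refine (div_le_self (by positivity) hw).trans ?_
  gcongr

theorem exists_classNumber_lower_bound (k Ω : Type*) [Field k] [NumberField k] [IsTotallyReal k]
    [IsPrincipalIdealRing (𝓞 k)] [Field Ω] [Algebra k Ω] {η : ℝ} (hη : 0 < η) :
    ∃ c : ℝ, 0 < c ∧ ∀ K : IntermediateField k Ω, ∀ _ : NumberField K, finrank k K = 2 →
      IsTotallyComplex K → c * ((discr K).natAbs : ℝ) ^ (1 / 2 - η) ≤ classNumber K := by
  obtain ⟨c, hc, h⟩ := exists_residue_lower_bound (k := k) Ω hη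
  set B : ℝ := (2 * Real.pi) ^ finrank ℚ k * (2 ^ finrank ℚ k *
        (dedekindZeta_residue k * (torsionOrder k * Real.sqrt |(discr k : ℝ)|)))
  have hB : 0 < B := by
    have hd : (0 : ℝ) < Real.sqrt |(discr k : ℝ)| :=
      Real.sqrt_pos.2 (abs_pos.2 (Int.cast_ne_zero.2 (discr_ne_zero k)))
    have hw : (0 : ℝ) < torsionOrder k := by exact_mod_cast torsionOrder_pos k
    have := dedekindZeta_residue_pos k
    positivity
  refine ⟨c / B, by positivity, fun K hKn hK hcx ↦ ?_⟩
  have hq : Algebra.IsQuadraticExtension k K := ⟨hK⟩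
  have h1 := residue_mul_sqrt_le_of_CM k K
  have h2 := h K hKn hK
  have hD : (0 : ℝ) < (discr K).natAbs := by exact_mod_cast one_le_natAbs_discr ↥K
  have hDη := Real.rpow_pos_of_pos hD η
  rw [div_mul_eq_mul_div, div_le_iff₀ hB, Real.rpow_sub hD, ← Real.sqrt_eq_rpow, ← mul_div_assoc,
    div_le_iff₀ hDη]
  calc _ ≤ dedekindZeta_residue K * ((discr K).natAbs : ℝ) ^ η *
        Real.sqrt ((discr K).natAbs : ℝ) := by gcongr
    _ = dedekindZeta_residue K * Real.sqrt ((discr K).natAbs : ℝ) *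
        ((discr K).natAbs : ℝ) ^ η := by ring
    _ ≤ B * classNumber K * ((discr K).natAbs : ℝ) ^ η := by gcongr
    _ = _ := by ring

end ClassNumber

section Family

open Module (finrank)

theorem classNumber_congr {K L : Type*} [Field K] [NumberField K] [Field L] [NumberField L]
    (e : K ≃+* L) : classNumber K = classNumber L :=
  Fintype.card_congr (ClassGroup.mulEquiv (RingOfIntegers.mapRingEquiv e)).toEquiv

theorem finrank_eq_two_of_finrank_rat (k L : Type*) [Field k] [NumberField k] [Field L]
    [NumberField L] [Algebra k L] (h : finrank ℚ L = 2 * finrank ℚ k) : finrank k L = 2 := by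
  rw [← Module.finrank_mul_finrank ℚ k L, mul_comm] at h
  exact Nat.eq_of_mul_eq_mul_right Module.finrank_pos h

theorem isTotallyComplex_of_isEmpty (K : Type*) [Field K] [h : IsEmpty (K →+* ℝ)] :
    IsTotallyComplex K where
  isComplex v := by
    by_contra hv
    exact h.false (InfinitePlace.embedding_of_isReal (InfinitePlace.not_isComplex_iff_isReal.1 hv))

theorem isTotallyReal_of_forall_im_eq_zero (K : Type*) [Field K]
    (h : ∀ φ : K →+* ℂ, ∀ z : K, (φ z).im = 0) : IsTotallyReal K where
  isReal v := by
    rw [InfinitePlace.isReal_iff]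
    ext z
    exact Complex.conj_eq_iff_im.2 (h _ z)

theorem clsNum_eq (K : IntermediateField ℚ ℂ) [NumberField K] : clsNum K = classNumber K := by
  rw [clsNum, dif_pos NumberField.to_finiteDimensional]

theorem absDisc_eq (K : IntermediateField ℚ ℂ) [NumberField K] :
    absDisc K = (discr K).natAbs := by
  rw [absDisc, dif_pos NumberField.to_finiteDimensional]

variable (K₀ : IntermediateField ℚ ℂ) [FiniteDimensional ℚ K₀]

theorem exists_clsNum_lower_bound (hTR : ∀ φ : K₀ →+* ℂ, ∀ z : K₀, (φ z).im = 0)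
    (hcl : clsNum K₀ = 1) {η : ℝ} (hη : 0 < η) :
    ∃ c : ℝ, 0 < c ∧ ∀ K : IntermediateField ℚ ℂ, IsCMover K₀ K →
      c * (absDisc K : ℝ) ^ (1 / 2 - η) ≤ clsNum K := by
  have n₀ : NumberField K₀ := ⟨⟩
  have hr : IsTotallyReal K₀ := isTotallyReal_of_forall_im_eq_zero K₀ hTR
  rw [clsNum_eq, classNumber_eq_one_iff] at hcl
  obtain ⟨c, hc, h⟩ := exists_classNumber_lower_bound K₀ ℂ hη
  refine ⟨c, hc, fun K ⟨hfin, hle, hrank, hemp⟩ ↦ ?_⟩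
  have nK : NumberField K := ⟨⟩
  let L : IntermediateField K₀ ℂ := IntermediateField.extendScalars hle
  let e : K ≃+* L := RingEquiv.refl K
  have fL : FiniteDimensional ℚ L := hfin
  have nL : NumberField L := ⟨⟩
  have hL : finrank ℚ L = 2 * finrank ℚ K₀ := by
    rw [← hrank]
    exact (LinearEquiv.finrank_eq
      (AlgEquiv.ofRingEquiv (f := e) fun q ↦ by simp).toLinearEquiv).symm
  have h2 : finrank K₀ L = 2 := finrank_eq_two_of_finrank_rat K₀ L hL
  have hempL : IsEmpty (L →+* ℝ) := ⟨fun f ↦ hemp.false (f.comp e.toRingHom)⟩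
  have := h L nL h2 (isTotallyComplex_of_isEmpty L)
  rwa [← classNumber_congr e, ← discr_eq_discr_of_algEquiv K
    (AlgEquiv.ofRingEquiv (f := e) fun q ↦ by simp), ← clsNum_eq, ← absDisc_eq] at this

theorem finite_setOf_absDisc_le (N : ℕ) :
    {K : IntermediateField ℚ ℂ | FiniteDimensional ℚ K ∧ absDisc K ≤ N}.Finite := by
  refine ((NumberField.finite_of_discr_bdd ℂ N).image Subtype.val).subset ?_
  rintro K ⟨hK, hN⟩
  have nK : NumberField K := ⟨⟩
  refine ⟨⟨K, hK⟩, ?_, rfl⟩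
  rw [absDisc_eq] at hN
  simp only [Set.mem_ofPred_eq]
  rw [Int.abs_eq_natAbs]
  exact_mod_cast hN

theorem norm_integral_mul_cosh_le {g : ℝ → ℂ} {C σ L : ℝ} (hC : ∀ x, ‖g x‖ ≤ C) (hσ : 0 < σ)
    (hg : Function.support g ⊆ Set.Ioo (-σ) σ) (hL : 0 < L) :
    ‖∫ x in Set.Ioi (0 : ℝ), g (x / L) * ((Real.cosh (x / 2) : ℝ) : ℂ)‖ ≤
      C * Real.exp (σ * L / 2) * (σ * L) := by
  have hσL := mul_pos hσ hL
  have hC0 : 0 ≤ C := (norm_nonneg _).trans (hC 0)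
  have heq : ∫ x in Set.Ioi (0 : ℝ), g (x / L) * ((Real.cosh (x / 2) : ℝ) : ℂ) =
      ∫ x in Set.Ioc (0 : ℝ) (σ * L), g (x / L) * ((Real.cosh (x / 2) : ℝ) : ℂ) := by
    refine setIntegral_eq_of_subset_of_forall_sdiff_eq_zero measurableSet_Ioi
      Set.Ioc_subset_Ioi_self fun x hx ↦ ?_
    have hx1 : σ * L < x := by
      by_contra hcon
      exact hx.2 ⟨hx.1, not_lt.1 hcon⟩
    have : g (x / L) = 0 := by
      by_contra hne
      have := (hg hne).2
      rw [div_lt_iff₀ hL] at this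
      linarith
    rw [this, zero_mul]
  rw [heq]
  refine (norm_setIntegral_le_of_norm_le_const (C := C * Real.exp (σ * L / 2))
    measure_Ioc_lt_top fun x hx ↦ ?_).trans_eq ?_
  · rw [norm_mul, Complex.norm_real, Real.norm_of_nonneg (Real.cosh_pos _).le]
    refine mul_le_mul (hC _) ?_ (Real.cosh_pos _).le hC0
    have hx1 := hx.1
    have hx2 := hx.2
    have h1 : Real.exp (x / 2) ≤ Real.exp (σ * L / 2) := Real.exp_le_exp.2 (by linarith)
    have h2 : Real.exp (-(x / 2)) ≤ Real.exp (σ * L / 2) := Real.exp_le_exp.2 (by linarith)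
    rw [Real.cosh_eq]
    linarith
  · rw [Real.volume_real_Ioc_of_le hσL.le, sub_zero]

end Family

end Auxiliary

/-- fix a totally real number field `K₀` of class number one and `0 < σ < 1`, and
let `φ` be an even Schwartz function with `supp(φ̂) ⊆ (−σ, σ)`. Over the family of all
CM-fields `K` with maximal totally real subfield `K₀`, the quantity
`(4/(h_K·log Δ_K))·∫₀^∞ φ̂(x/log Δ_K)·cosh(x/2) dx` tends to `0` as `Δ_K → ∞`: for every
`ε > 0`, all but finitely many members of the family satisfy `|…| < ε`. -/
theorem stmt_1 (K₀ : IntermediateField ℚ ℂ) [FiniteDimensional ℚ K₀]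
    (hTR : ∀ φ : K₀ →+* ℂ, ∀ z : K₀, (φ z).im = 0)
    (hcl : clsNum K₀ = 1)
    (σ : ℝ) (hσ0 : 0 < σ) (hσ1 : σ < 1)
    (φ : SchwartzMap ℝ ℂ) (heven : ∀ x : ℝ, φ (-x) = φ x)
    (hsupp : Function.support (𝓕 ⇑φ) ⊆ Set.Ioo (-σ) σ)
    (ε : ℝ) (hε : 0 < ε) :
    {K : IntermediateField ℚ ℂ | IsCMover K₀ K ∧
      ¬ ‖((4 / (clsNum K * Real.log (absDisc K)) : ℝ) : ℂ) *
          ∫ x in Set.Ioi (0 : ℝ),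
            𝓕 ⇑φ (x / Real.log (absDisc K)) * ((Real.cosh (x / 2) : ℝ) : ℂ)‖ < ε}.Finite := by
  obtain ⟨c, hc, h⟩ := exists_clsNum_lower_bound K₀ hTR hcl (η := (1 - σ) / 4) (by linarith)
  set C : ℝ := ∫ x, ‖φ x‖
  have hC : ∀ x, ‖𝓕 ⇑φ x‖ ≤ C := fun x ↦
    VectorFourier.norm_fourierIntegral_le_integral_norm _ _ _ _ _
  have hlim : Filter.Tendsto (fun D : ℕ ↦ 4 * C * σ / c * (D : ℝ) ^ (-((1 - σ) / 4)))
      Filter.atTop (nhds 0) := by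
    have := ((tendsto_rpow_neg_atTop (y := (1 - σ) / 4) (by linarith)).comp
      tendsto_natCast_atTop_atTop).const_mul (4 * C * σ / c)
    rwa [mul_zero] at this
  obtain ⟨N, hN⟩ := Filter.eventually_atTop.1 (hlim.eventually_lt_const hε)
  refine (finite_setOf_absDisc_le (max N 1)).subset ?_
  rintro K ⟨hK, hbad⟩
  refine ⟨hK.1, ?_⟩
  by_contra hlarge
  refine hbad ?_
  have hN' := hN (absDisc K) (by lia)
  have hD1 : (1 : ℝ) < absDisc K := by
    have : 1 < absDisc K := by lia
    exact_mod_cast this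
  have hh := h K hK
  set D : ℝ := ((absDisc K : ℕ) : ℝ)
  have hD : 0 < D := by linarith
  have hL : 0 < Real.log D := Real.log_pos hD1
  have hpow := Real.rpow_pos_of_pos hD (1 / 2 - (1 - σ) / 4)
  have hcls : 0 < (clsNum K : ℝ) := lt_of_lt_of_le (by positivity) hh
  have hC0 : 0 ≤ C := (norm_nonneg _).trans (hC 0)
  rw [norm_mul, Complex.norm_real, Real.norm_of_nonneg (by positivity)]
  refine lt_of_le_of_lt ?_ hN'
  calc _ ≤ 4 / (clsNum K * Real.log D) *
        (C * Real.exp (σ * Real.log D / 2) * (σ * Real.log D)) := by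
        gcongr
        exact norm_integral_mul_cosh_le hC hσ0 hsupp hL
    _ = 4 * C * σ * D ^ (σ / 2) / clsNum K := by
        rw [Real.rpow_def_of_pos hD, show σ * Real.log D / 2 = Real.log D * (σ / 2) by ring]
        field_simp
    _ ≤ 4 * C * σ * D ^ (σ / 2) / (c * D ^ (1 / 2 - (1 - σ) / 4)) := by gcongr
    _ = 4 * C * σ / c * (D ^ (σ / 2) / D ^ (1 / 2 - (1 - σ) / 4)) := by field_simp
    _ = _ := by
        rw [← Real.rpow_sub hD]
        congr 2
        ring
end

section
/- Let φ be an even Schwartz function on ℝ. Then the functions x ↦ (φ̂(0) − φ̂(x))/(2·sinh(x/2)) and x ↦ (φ̂(0) − φ̂(x))/(2·cosh(x/2)) are integrable on (0, ∞); in particular the integrals ∫₀^∞ (φ̂(0) − φ̂(x))/(2·sinh(x/2)) dx and ∫₀^∞ (φ̂(0) − φ̂(x))/(2·cosh(x/2)) dx converge absolutely. -/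
open MeasureTheory FourierTransform

/-- A Schwartz function on `ℝ` is Lipschitz. -/
lemma SchwartzMap.exists_norm_sub_le (g : SchwartzMap ℝ ℂ) :
    ∃ C : ℝ, 0 ≤ C ∧ ∀ x y : ℝ, ‖g x - g y‖ ≤ C * |x - y| := by
  obtain ⟨C, hC⟩ := g.decay 0 1
  have hderiv : ∀ x, ‖deriv g x‖ ≤ C := fun x => by
    simpa [norm_iteratedFDeriv_eq_norm_iteratedDeriv] using hC.2 x
  refine ⟨C, hC.1.le, fun x y => ?_⟩
  simpa using convex_univ.norm_image_sub_le_of_norm_deriv_le (f := g)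
    (fun z _ => g.differentiableAt) (fun z _ => hderiv z) (Set.mem_univ y) (Set.mem_univ x)

lemma Real.mul_exp_half_le_two_mul_sinh {u : ℝ} (hu : 0 ≤ u) :
    u * Real.exp (u / 2) ≤ 2 * Real.sinh u := by
  have hsinh : u / 2 ≤ Real.sinh (u / 2) := Real.self_le_sinh_iff.2 (by positivity)
  have hcosh : Real.exp (u / 2) ≤ 2 * Real.cosh (u / 2) := by
    rw [Real.cosh_eq]
    linarith [Real.exp_pos (-(u / 2))]
  calc u * Real.exp (u / 2) = 2 * ((u / 2) * Real.exp (u / 2)) := by ring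
    _ ≤ 2 * (Real.sinh (u / 2) * (2 * Real.cosh (u / 2))) := by gcongr
    _ = 2 * Real.sinh (2 * (u / 2)) := by rw [Real.sinh_two_mul]; ring
    _ = 2 * Real.sinh u := by congr 2; ring

/-- The difference quotient of a Schwartz function at the origin stays integrable on `(0, ∞)` when
the denominator is replaced by a function dominating `2 * sinh (x / 2)`. -/
lemma SchwartzMap.integrableOn_sub_div (g : SchwartzMap ℝ ℂ) {d : ℝ → ℝ} (hd : Measurable d)
    (hle : ∀ x, 0 < x → 2 * Real.sinh (x / 2) ≤ d x) :
    IntegrableOn (fun x : ℝ => (g 0 - g x) / (d x : ℂ)) (Set.Ioi 0) volume := by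
  obtain ⟨C, hC0, hC⟩ := g.exists_norm_sub_le
  have hint : IntegrableOn (fun x : ℝ => 2 * C * Real.exp (-(1 / 4) * x)) (Set.Ioi 0) volume :=
    (exp_neg_integrableOn_Ioi 0 (by norm_num)).const_mul _
  refine hint.mono' ?_ ?_
  · exact ((measurable_const.sub g.continuous.measurable).div
      (Complex.measurable_ofReal.comp hd)).aestronglyMeasurable
  · refine (ae_restrict_iff' measurableSet_Ioi).2 (.of_forall fun x (hx : 0 < x) => ?_)
    have hlow : x / 2 * Real.exp (x / 4) ≤ d x := by
      have h := Real.mul_exp_half_le_two_mul_sinh (u := x / 2) (by positivity)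
      rw [show x / 2 / 2 = x / 4 by ring] at h
      exact h.trans (hle x hx)
    have hlow_pos : 0 < x / 2 * Real.exp (x / 4) := by positivity
    have hnum : ‖g 0 - g x‖ ≤ C * x := by simpa [abs_of_pos hx] using hC 0 x
    rw [norm_div, Complex.norm_real, Real.norm_of_nonneg (hlow_pos.le.trans hlow)]
    calc ‖g 0 - g x‖ / d x ≤ C * x / (x / 2 * Real.exp (x / 4)) := by gcongr
      _ = 2 * C * Real.exp (-(1 / 4) * x) := by
        rw [show -(1 / 4) * x = -(x / 4) by ring, Real.exp_neg]
        field_simp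

/-- for an even Schwartz function `φ` on `ℝ`, the functions
`x ↦ (φ̂(0) − φ̂(x))/(2 sinh(x/2))` and `x ↦ (φ̂(0) − φ̂(x))/(2 cosh(x/2))` are integrable
on `(0, ∞)`; in particular the corresponding integrals converge absolutely. -/
theorem stmt_2 (φ : SchwartzMap ℝ ℂ) (heven : ∀ x : ℝ, φ (-x) = φ x) :
    IntegrableOn (fun x : ℝ => (𝓕 ⇑φ 0 - 𝓕 ⇑φ x) / ((2 * Real.sinh (x / 2) : ℝ) : ℂ))
        (Set.Ioi (0 : ℝ)) volume ∧
      IntegrableOn (fun x : ℝ => (𝓕 ⇑φ 0 - 𝓕 ⇑φ x) / ((2 * Real.cosh (x / 2) : ℝ) : ℂ))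
        (Set.Ioi (0 : ℝ)) volume := by
  rw [← SchwartzMap.fourier_coe]
  refine ⟨(𝓕 φ).integrableOn_sub_div (by fun_prop) fun x _ => le_rfl,
    (𝓕 φ).integrableOn_sub_div (by fun_prop) fun x _ => ?_⟩
  gcongr
  exact (Real.sinh_lt_cosh _).le
end
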